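/- For every constant k there exist an integer d ≥ k, constants c₁, c₂ > 0, and infinitely many integers n such that there is an (n,d,β)-expander G with β ≤ 2/√d whose girth is at least c₁·log n/log d and whose diameter is at most c₂·log n/log d. -/

import Mathlib

open scoped Classical

noncomputable section

/-- A finitely supported probability distribution on a type `A`. -/
structure FinDist (A : Type*) where
  w : A →₀ ℝ
  nonneg : ∀ a, 0 ≤ w a
  total : ∑ a ∈ w.support, w a = 1

namespace FinDist

variable {A : Type*}

/-- The (finite) support of a finitely supported distribution. -/
def support (D : FinDist A) : Finset A := D.w.support

/-- The probability of an event under a finitely supported distribution. -/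
def pr (D : FinDist A) (p : A → Prop) : ℝ :=
  ∑ a ∈ D.support.filter p, D.w a

/-- The expectation of a real-valued function under a finitely supported distribution. -/
def exp (D : FinDist A) (f : A → ℝ) : ℝ :=
  ∑ a ∈ D.support, D.w a * f a

end FinDist

/-- `c` is a metric on `V`. -/
structure IsMetric {V : Type*} (c : V → V → ℝ) : Prop where
  refl : ∀ x, c x x = 0
  pos : ∀ x y, x ≠ y → 0 < c x y
  symm : ∀ x y, c x y = c y x
  triangle : ∀ x y z, c x z ≤ c x y + c y z

/-- The cost of an unordered pair of vertices (agrees with `c` when `c` is symmetric). -/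
def sym2Cost {V : Type*} (c : V → V → ℝ) : Sym2 V → ℝ :=
  Sym2.lift ⟨fun x y => (c x y + c y x) / 2, fun x y => by dsimp; ring⟩

/-- A path (sequence of distinct vertices) from `v` to `r`. -/
def RootPath (V : Type*) (v r : V) : Type _ :=
  {l : List V // l.Nodup ∧ l.head? = some v ∧ l.getLast? = some r}

/-- A collection of vertex-to-root paths, one for each vertex. -/
def PathSystem (V : Type*) (r : V) : Type _ := ∀ v : V, RootPath V v r

/-- The set of (unordered) edges of a list of vertices: pairs of consecutive entries. -/
def listEdges {V : Type*} [DecidableEq V] (l : List V) : Finset (Sym2 V) :=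
  ((l.zip l.tail).map (fun p => s(p.1, p.2))).toFinset

/-- `c(P[X])`: the total cost of the union of the edges of the paths `p_v`, `v ∈ X`. -/
def pathSystemCost {V : Type*} [DecidableEq V] (c : V → V → ℝ) {r : V}
    (P : PathSystem V r) (X : Finset V) : ℝ :=
  ∑ e ∈ X.biUnion (fun v => listEdges (P v).1), sym2Cost c e

/-- The set of costs of Steiner trees for `X ∪ {r}`: trees `T` on vertex sets `W`
with `X ∪ {r} ⊆ W ⊆ V`. -/
def steinerCosts {V : Type*} [Fintype V] [DecidableEq V] (c : V → V → ℝ) (r : V)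
    (X : Finset V) : Set ℝ :=
  {y | ∃ (W : Finset V) (T : SimpleGraph V),
    insert r X ⊆ W ∧
    (∀ e ∈ T.edgeSet, ∀ v ∈ e, v ∈ W) ∧
    (SimpleGraph.induce (↑W) T).IsTree ∧
    y = ∑ e ∈ Finset.univ.filter (fun e : Sym2 V => e ∈ T.edgeSet), sym2Cost c e}

/-- `opt_ST(X)`: the optimal Steiner tree cost for `X ∪ {r}`. -/
def optST {V : Type*} [Fintype V] [DecidableEq V] (c : V → V → ℝ) (r : V)
    (X : Finset V) : ℝ :=
  sInf (steinerCosts c r X)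

/-- The cost of the closed tour that starts at `r`, visits the vertices of `l` in order,
and returns to `r`. -/
def tourCost {V : Type*} (c : V → V → ℝ) (r : V) (l : List V) : ℝ :=
  ((((r :: l) ++ [r]).zip (((r :: l) ++ [r]).tail)).map (fun p => c p.1 p.2)).sum

/-- `σ_X`: the ordering that the tour `σ` induces on the elements of `X`. -/
def permInduced {n : ℕ} (σ : Equiv.Perm (Fin n)) (X : Finset (Fin n)) : List (Fin n) :=
  ((List.finRange n).map σ).filter (fun v => decide (v ∈ X))

/-- `opt_TSP(X)`: the minimum closed-tour cost through `X ∪ {r}`. -/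
def optTSP {V : Type*} [DecidableEq V] (c : V → V → ℝ) (r : V) (X : Finset V) : ℝ :=
  sInf {y | ∃ l : List V, l.Nodup ∧ l.toFinset = X ∧ y = tourCost c r l}

/-- An `(n,d,β)`-expander: a `d`-regular graph on `n` vertices such that
`|xᵀAx| ≤ β·d·xᵀx` for every `x` orthogonal to the all-ones vector. -/
def IsExpander (n d : ℕ) (β : ℝ) (G : SimpleGraph (Fin n)) : Prop :=
  (∀ v : Fin n, (Finset.univ.filter (fun w => G.Adj v w)).card = d) ∧
  ∀ x : Fin n → ℝ, (∑ v, x v = 0) →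
    |∑ v, ∑ w, (if G.Adj v w then x v * x w else 0)| ≤ β * d * ∑ v, (x v) ^ 2

/-- `u : Fin (t+1) → Fin n` encodes a `t`-step walk in `G`. -/
def IsWalkFun {n : ℕ} (G : SimpleGraph (Fin n)) {t : ℕ} (u : Fin (t + 1) → Fin n) : Prop :=
  ∀ i : Fin t, G.Adj (u i.castSucc) (u i.succ)

/-- The probability that a `t`-step random walk on a `d`-regular graph `G`
(uniform start, uniform steps; each walk has probability `1/(n·dᵗ)`) satisfies `p`. -/
def walkPr {n : ℕ} (G : SimpleGraph (Fin n)) (d t : ℕ)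
    (p : (Fin (t + 1) → Fin n) → Prop) : ℝ :=
  ((Finset.univ.filter
      (fun u : Fin (t + 1) → Fin n => IsWalkFun G u ∧ p u)).card : ℝ) / (n * d ^ t)

/-- The probability that two independent `t`-step random walks on `G` satisfy `p`. -/
def walkPairPr {n : ℕ} (G : SimpleGraph (Fin n)) (d t : ℕ)
    (p : (Fin (t + 1) → Fin n) → (Fin (t + 1) → Fin n) → Prop) : ℝ :=
  ((Finset.univ.filter
      (fun q : (Fin (t + 1) → Fin n) × (Fin (t + 1) → Fin n) =>
        IsWalkFun G q.1 ∧ IsWalkFun G q.2 ∧ p q.1 q.2)).card : ℝ) / (n * d ^ t) ^ 2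

/-- The edge set of the path from `u` to `v` in `T` (the unique such path when `T`
is a tree); empty if `u` and `v` are not connected in `T`. -/
def treePathEdges {V : Type*} [DecidableEq V] (T : SimpleGraph V) (u v : V) :
    Finset (Sym2 V) :=
  if h : T.Reachable u v then (h.some.toPath : T.Path u v).1.edges.toFinset else ∅

/-- `c_T(u,v)`: the cost of the unique `u`–`v` path in the tree `T`. -/
def treePathCost {V : Type*} [DecidableEq V] (c : V → V → ℝ) (T : SimpleGraph V)
    (u v : V) : ℝ :=
  ∑ e ∈ treePathEdges T u v, sym2Cost c e

/-- `c(T[X])`: the cost of the minimal subtree of the tree `T` containing `X ∪ {r}`. -/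
def subtreeCost {V : Type*} [DecidableEq V] (c : V → V → ℝ) (T : SimpleGraph V)
    (r : V) (X : Finset V) : ℝ :=
  ∑ e ∈ (insert r X).biUnion (fun v => treePathEdges T v r), sym2Cost c e

end

namespace RamanujanGraph

open Polynomial in
/-- A weak form of Markov's inequality for polynomials bounded at an endpoint of an interval. -/
lemma abs_derivative_eval_endpoint_le {f : ℝ[X]} {D : ℕ} (hD : f.natDegree ≤ D)
    {x y M : ℝ} (hxy : x ≠ y)
    (h : ∀ z ∈ Set.uIcc x y, |f.eval z| ≤ M) :
    |f.derivative.eval y| ≤ 2 * (D : ℝ) ^ 2 / |y - x| * M := by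
  have hM : 0 ≤ M := (abs_nonneg _).trans (h x Set.left_mem_uIcc)
  rcases hM.eq_or_lt with rfl | hM
  · have hf : f = 0 := by
      refine Polynomial.eq_zero_of_infinite_isRoot f (Set.Infinite.mono (s := Set.uIcc x y) ?_ ?_)
      · intro z hz
        exact abs_eq_zero.mp (le_antisymm (h z hz) (abs_nonneg _))
      · rw [Set.uIcc]
        exact Set.Icc_infinite (by simpa using hxy.symm)
    simp [hf]
  have key : ∀ s : ℝ, |s| = 1 → s * f.derivative.eval y * ((y - x) / 2) ≤ (D : ℝ) ^ 2 * M := by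
    intro s hs
    set P : ℝ[X] := C (s * M⁻¹) * f.comp (C ((y - x) / 2) * X + C ((x + y) / 2)) with hP
    have hdeg : P.degree ≤ D := by
      refine natDegree_le_iff_degree_le.mp ?_
      refine (natDegree_C_mul_le _ _).trans ?_
      rw [natDegree_comp]
      calc f.natDegree * (C ((y - x) / 2) * X + C ((x + y) / 2)).natDegree
          ≤ f.natDegree * 1 := Nat.mul_le_mul_left _ natDegree_linear_le
        _ ≤ D := by simpa using hD
    have hbd : ∀ t ∈ Set.Icc (-1 : ℝ) 1, |P.eval t| ≤ 1 := by
      intro t ht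
      have hz : (y - x) / 2 * t + (x + y) / 2 ∈ Set.uIcc x y := by
        have : (y - x) / 2 * t + (x + y) / 2 = x + ((1 + t) / 2) * (y - x) := by ring
        rw [this, ← segment_eq_uIcc, segment_eq_image']
        exact ⟨(1 + t) / 2, ⟨by linarith [ht.1], by linarith [ht.2]⟩, by simp⟩
      have := h _ hz
      simp only [hP, eval_mul, eval_C, eval_comp, eval_add, eval_X, abs_mul, hs, one_mul,
        abs_inv, abs_of_pos hM]
      rw [inv_mul_le_iff₀ hM]
      simpa using this
    have := Polynomial.Chebyshev.eval_iterate_derivative_le_of_forall_abs_le_one (k := 1)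
      (le_refl (1 : ℝ)) hdeg hbd
    simp only [Function.iterate_one, Polynomial.Chebyshev.T_derivative_eq_U, hP] at this
    have e1 : (derivative (C (s * M⁻¹) * f.comp (C ((y - x) / 2) * X + C ((x + y) / 2)))).eval 1
        = s * M⁻¹ * (f.derivative.eval y * ((y - x) / 2)) := by
      simp [derivative_comp]
      left
      rw [show (y - x) / 2 + (x + y) / 2 = y by ring]
      ring
    rw [e1] at this
    have e2 : ((((D : ℤ) : ℝ[X])) * Polynomial.Chebyshev.U ℝ ((D : ℤ) - 1)).eval 1
        = (D : ℝ) ^ 2 := by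
      simp [Polynomial.Chebyshev.U_eval_one]; ring
    rw [e2] at this
    calc s * f.derivative.eval y * ((y - x) / 2)
        = M * (s * M⁻¹ * (f.derivative.eval y * ((y - x) / 2))) := by field_simp
      _ ≤ M * (D : ℝ) ^ 2 := by gcongr
      _ = _ := mul_comm _ _
  have hpos : 0 < |y - x| := abs_pos.mpr (sub_ne_zero.mpr hxy.symm)
  have key2 : |f.derivative.eval y * ((y - x) / 2)| ≤ (D : ℝ) ^ 2 * M := by
    rw [abs_le]
    constructor
    · have := key (-1) (by simp)
      linarith
    · have := key 1 (by simp)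
      linarith
  rw [abs_mul, abs_div, abs_two] at key2
  rw [div_mul_eq_mul_div, le_div_iff₀ hpos]
  linarith

open Polynomial in
lemma abs_derivative_eval_le {f : ℝ[X]} {D : ℕ} (hD : f.natDegree ≤ D)
    {b M : ℝ} (hb : 0 < b) (h : ∀ z ∈ Set.Icc 0 b, |f.eval z| ≤ M) :
    ∀ z ∈ Set.Icc 0 b, |f.derivative.eval z| ≤ 4 * (D : ℝ) ^ 2 / b * M := by
  intro z hz
  have hM : 0 ≤ M := (abs_nonneg _).trans (h z hz)
  obtain ⟨x, hx, hxz⟩ : ∃ x ∈ Set.Icc 0 b, b / 2 ≤ |z - x| := by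
    rcases le_total z (b / 2) with h1 | h1
    · exact ⟨b, ⟨hb.le, le_rfl⟩, by rw [abs_sub_comm]; exact le_trans (by linarith) (le_abs_self _)⟩
    · exact ⟨0, ⟨le_rfl, hb.le⟩, by rw [sub_zero]; exact h1.trans (le_abs_self _)⟩
  have hne : x ≠ z := by
    rintro rfl
    simp at hxz
    linarith
  have := abs_derivative_eval_endpoint_le hD hne
    (fun w hw => h w (Set.OrdConnected.uIcc_subset Set.ordConnected_Icc hx hz hw))
  refine this.trans (mul_le_mul_of_nonneg_right ?_ hM)
  calc 2 * (D : ℝ) ^ 2 / |z - x| ≤ 2 * (D : ℝ) ^ 2 / (b / 2) := by gcongr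
    _ = 4 * (D : ℝ) ^ 2 / b := by field_simp; ring

open Polynomial in
lemma abs_eval_sub_eval_le {f : ℝ[X]} {b K : ℝ}
    (h : ∀ z ∈ Set.Icc 0 b, |f.derivative.eval z| ≤ K) {x y : ℝ} (hx : x ∈ Set.Icc 0 b)
    (hy : y ∈ Set.Icc 0 b) : |f.eval y - f.eval x| ≤ K * |y - x| := by
  have := Convex.norm_image_sub_le_of_norm_deriv_le (f := fun t => f.eval t) (s := Set.Icc 0 b)
    (C := K) (fun t _ => f.differentiableAt) (fun t ht => by simpa using h t ht)
    (convex_Icc 0 b) hx hy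
  simpa using this

open Polynomial in
/-- A polynomial bounded at the points `1 / N` is bounded on the whole interval. -/
lemma abs_eval_le_of_bounded_at_inv {f : ℝ[X]} {D N₀ : ℕ} (hD : f.natDegree ≤ D)
    (hN₀ : 8 * D ^ 2 ≤ N₀) (hpos : 0 < N₀) {B : ℝ}
    (h : ∀ N : ℕ, N₀ ≤ N → |f.eval (1 / (N : ℝ))| ≤ B) :
    ∀ z ∈ Set.Icc 0 (1 / (N₀ : ℝ)), |f.eval z| ≤ 2 * B := by
  have hB : 0 ≤ B := (abs_nonneg _).trans (h N₀ le_rfl)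
  have hN0' : (0 : ℝ) < N₀ := by exact_mod_cast hpos
  have hb : (0 : ℝ) < 1 / N₀ := by positivity
  obtain ⟨x, hx, hmax⟩ := (isCompact_Icc (a := (0 : ℝ)) (b := 1 / (N₀ : ℝ))).exists_isMaxOn
    ⟨0, by simp⟩ (f := fun z => |f.eval z|) (by fun_prop)
  have hle : ∀ z ∈ Set.Icc 0 (1 / (N₀ : ℝ)), |f.eval z| ≤ |f.eval x| := fun z hz => hmax hz
  suffices |f.eval x| ≤ 2 * B from fun z hz => (hle z hz).trans this
  rcases hx.1.eq_or_lt with h0 | h0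
  · subst h0
    have ht : Filter.Tendsto (fun N : ℕ => |f.eval (1 / (N : ℝ))|) Filter.atTop
        (nhds |f.eval 0|) := by
      have hc : Continuous fun t : ℝ => |f.eval t| := by fun_prop
      exact (hc.tendsto 0).comp tendsto_one_div_atTop_nhds_zero_nat
    have : |f.eval 0| ≤ B := le_of_tendsto ht
      (Filter.eventually_atTop.mpr ⟨N₀, fun N hN => h N hN⟩)
    linarith
  · set N := ⌊1 / x⌋₊ with hN
    have hNN : N₀ ≤ N := by
      apply Nat.le_floor
      rw [le_div_iff₀ h0]
      have := hx.2
      rwa [le_div_iff₀ hN0', mul_comm] at this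
    have hN0 : (N₀ : ℝ) ≤ N := by exact_mod_cast hNN
    have hNpos : (0 : ℝ) < N := hN0'.trans_le hN0
    have h1 : x ≤ 1 / N := by
      rw [le_div_iff₀ hNpos]
      have := Nat.floor_le (a := 1 / x) (by positivity)
      rw [← hN, le_div_iff₀ h0] at this
      linarith
    have h2 : 1 / ((N : ℝ) + 1) ≤ x := by
      rw [div_le_iff₀ (by positivity)]
      have := Nat.lt_floor_add_one (1 / x)
      rw [← hN, div_lt_iff₀ h0] at this
      linarith
    have h3 : 1 / (N : ℝ) ∈ Set.Icc 0 (1 / (N₀ : ℝ)) :=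
      ⟨by positivity, by gcongr⟩
    have h4 : |x - 1 / N| ≤ 1 / (N₀ : ℝ) ^ 2 := by
      rw [abs_sub_comm, abs_of_nonneg (by linarith)]
      calc 1 / (N : ℝ) - x ≤ 1 / N - 1 / (N + 1) := by linarith
        _ = 1 / (N * (N + 1)) := by field_simp; ring
        _ ≤ 1 / (N₀ : ℝ) ^ 2 := by
          apply one_div_le_one_div_of_le (by positivity)
          nlinarith
    have h5 := abs_eval_sub_eval_le (abs_derivative_eval_le hD hb hle) h3 hx
    have h6 : 4 * (D : ℝ) ^ 2 / (1 / N₀) * |f.eval x| * |x - 1 / N| ≤ |f.eval x| / 2 := by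
      have h8 : 8 * (D : ℝ) ^ 2 ≤ N₀ := by exact_mod_cast hN₀
      calc 4 * (D : ℝ) ^ 2 / (1 / N₀) * |f.eval x| * |x - 1 / N|
          ≤ 4 * (D : ℝ) ^ 2 / (1 / N₀) * |f.eval x| * (1 / (N₀ : ℝ) ^ 2) := by gcongr
        _ = (8 * (D : ℝ) ^ 2) / N₀ * (|f.eval x| / 2) := by field_simp; ring
        _ ≤ 1 * (|f.eval x| / 2) := by
          gcongr
          rw [div_le_one hN0']; exact h8
        _ = _ := one_mul _
    have h7 := h N hNN
    have h8 : |f.eval x| ≤ |f.eval x - f.eval (1 / (N : ℝ))| + |f.eval (1 / (N : ℝ))| := by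
      simpa using abs_add_le (f.eval x - f.eval (1 / (N : ℝ))) (f.eval (1 / (N : ℝ)))
    linarith

open Polynomial in
/-- Second order Taylor bound at the points `1 / N` for a polynomial bounded at these points. -/
lemma abs_eval_inv_le_taylor {f : ℝ[X]} {D N₀ : ℕ} (hD : f.natDegree ≤ D)
    (hN₀ : 8 * D ^ 2 ≤ N₀) (hpos : 0 < N₀) {B : ℝ}
    (h : ∀ N : ℕ, N₀ ≤ N → |f.eval (1 / (N : ℝ))| ≤ B) {N : ℕ} (hN : N₀ ≤ N) :
    |f.eval (1 / (N : ℝ))| ≤ |f.eval 0| + |f.derivative.eval 0| / N +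
      32 * (D : ℝ) ^ 4 * N₀ ^ 2 * B / N ^ 2 := by
  have hN0' : (0 : ℝ) < N₀ := by exact_mod_cast hpos
  have hN0 : (N₀ : ℝ) ≤ N := by exact_mod_cast hN
  have hNpos : (0 : ℝ) < N := hN0'.trans_le hN0
  have hb : (0 : ℝ) < 1 / N₀ := by positivity
  have b1 := abs_derivative_eval_le hD hb (abs_eval_le_of_bounded_at_inv hD hN₀ hpos h)
  have b2 := abs_derivative_eval_le ((natDegree_derivative_le f).trans (by lia : _ ≤ D)) hb b1
  set K := 4 * (D : ℝ) ^ 2 / (1 / N₀) * (4 * (D : ℝ) ^ 2 / (1 / N₀) * (2 * B)) with hK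
  have hKe : K = 32 * (D : ℝ) ^ 4 * N₀ ^ 2 * B := by rw [hK]; field_simp; ring
  have hNb : 1 / (N : ℝ) ≤ 1 / N₀ := by gcongr
  have hNn : (0 : ℝ) ≤ 1 / N := by positivity
  have b3 : ∀ z ∈ Set.Icc 0 (1 / (N : ℝ)), |f.derivative.eval z| ≤
      |f.derivative.eval 0| + K / N := by
    intro z hz
    have hz' : z ∈ Set.Icc 0 (1 / (N₀ : ℝ)) := ⟨hz.1, hz.2.trans hNb⟩
    have := abs_eval_sub_eval_le b2 ⟨le_rfl, hb.le⟩ hz'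
    rw [sub_zero, abs_of_nonneg hz.1] at this
    have hK0 : 0 ≤ K := (abs_nonneg _).trans (b2 z hz')
    have h1 : K * z ≤ K / N := by
      rw [div_eq_mul_one_div]; gcongr; exact hz.2
    have h2 : |f.derivative.eval z| ≤
        |f.derivative.eval z - f.derivative.eval 0| + |f.derivative.eval 0| := by
      simpa using abs_add_le (f.derivative.eval z - f.derivative.eval 0) (f.derivative.eval 0)
    linarith
  have b4 := abs_eval_sub_eval_le b3 ⟨le_rfl, hNn⟩ ⟨hNn, le_rfl⟩
  rw [sub_zero, abs_of_nonneg hNn] at b4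
  have h2 : |f.eval (1 / (N : ℝ))| ≤ |f.eval (1 / (N : ℝ)) - f.eval 0| + |f.eval 0| := by
    simpa using abs_add_le (f.eval (1 / (N : ℝ)) - f.eval 0) (f.eval 0)
  rw [← hKe]
  have e : (|f.derivative.eval 0| + K / N) * (1 / N) = |f.derivative.eval 0| / N + K / N ^ 2 := by
    field_simp
  linarith

/-- A letter `(i, true)` stands for the `i`-th generator and `(i, false)` for its inverse. -/
abbrev Letter (m : ℕ) := Fin m × Bool

/-- The inverse letter. -/
def linv {m : ℕ} (a : Letter m) : Letter m := (a.1, !a.2)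

@[simp] lemma linv_linv {m : ℕ} (a : Letter m) : linv (linv a) = a := by simp [linv]

lemma linv_ne {m : ℕ} (a : Letter m) : linv a ≠ a := by
  intro h
  have := congrArg Prod.snd h
  simp [linv] at this

lemma linv_injective {m : ℕ} : Function.Injective (linv (m := m)) :=
  Function.LeftInverse.injective linv_linv

lemma ne_linv_comm {m : ℕ} {a b : Letter m} : b ≠ linv a ↔ a ≠ linv b := by
  constructor <;> (rintro h rfl; simp at h)

/-- A word is reduced if no letter is followed by its inverse. -/
def Reduced {m : ℕ} (w : List (Letter m)) : Prop := w.IsChain (fun a b => b ≠ linv a)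

/-- The inverse word. -/
def winv {m : ℕ} (w : List (Letter m)) : List (Letter m) := (w.map linv).reverse

lemma Reduced.nil {m : ℕ} : Reduced ([] : List (Letter m)) := List.isChain_nil

lemma Reduced.singleton {m : ℕ} (a : Letter m) : Reduced [a] := List.isChain_singleton a

lemma reduced_cons_cons {m : ℕ} {a b : Letter m} {w : List (Letter m)} :
    Reduced (a :: b :: w) ↔ b ≠ linv a ∧ Reduced (b :: w) := List.isChain_cons_cons

lemma Reduced.of_infix {m : ℕ} {w w' : List (Letter m)} (h : Reduced w) (h' : w' <:+: w) :
    Reduced w' := List.IsChain.infix h h'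

lemma Reduced.tail {m : ℕ} {a : Letter m} {w : List (Letter m)} (h : Reduced (a :: w)) :
    Reduced w := h.of_infix (List.suffix_cons a w).isInfix

lemma Reduced.winv {m : ℕ} {w : List (Letter m)} (h : Reduced w) : Reduced (winv w) := by
  unfold Reduced RamanujanGraph.winv
  rw [List.isChain_reverse, List.isChain_map]
  refine List.IsChain.imp ?_ h
  intro a b hab
  simp only [linv_linv]
  exact hab.symm

@[simp] lemma length_winv {m : ℕ} (w : List (Letter m)) : (winv w).length = w.length := by
  simp [winv]

lemma winv_cons {m : ℕ} (a : Letter m) (w : List (Letter m)) :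
    winv (a :: w) = winv w ++ [linv a] := by simp [winv]

section Run

variable {m : ℕ} {V : Type*} (σ : Fin m → Equiv.Perm V)

/-- The permutation attached to a letter. -/
def step (a : Letter m) : Equiv.Perm V := if a.2 then σ a.1 else (σ a.1)⁻¹

/-- The endpoint of the walk that starts at `v` and follows the letters of a word. -/
def run : List (Letter m) → V → V
  | [], v => v
  | a :: w, v => run w (step σ a v)

@[simp] lemma run_nil (v : V) : run σ [] v = v := rfl

@[simp] lemma run_cons (a : Letter m) (w : List (Letter m)) (v : V) :
    run σ (a :: w) v = run σ w (step σ a v) := rfl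

lemma step_linv (a : Letter m) : step σ (linv a) = (step σ a)⁻¹ := by
  rcases a with ⟨i, _ | _⟩ <;> simp [step, linv]

@[simp] lemma step_linv_step (a : Letter m) (v : V) : step σ (linv a) (step σ a v) = v := by
  simp [step_linv]

@[simp] lemma step_step_linv (a : Letter m) (v : V) : step σ a (step σ (linv a) v) = v := by
  simp [step_linv]

lemma run_append (w w' : List (Letter m)) (v : V) :
    run σ (w ++ w') v = run σ w' (run σ w v) := by
  induction w generalizing v with
  | nil => rfl
  | cons a w ih => simp [ih]

@[simp] lemma run_winv_run (w : List (Letter m)) (v : V) : run σ (winv w) (run σ w v) = v := by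
  induction w generalizing v with
  | nil => rfl
  | cons a w ih => simp [winv_cons, run_append, ih]

lemma run_injective (w : List (Letter m)) : Function.Injective (run σ w) :=
  Function.LeftInverse.injective (run_winv_run σ w)

end Run

/-- The reduced words of length `k`. -/
noncomputable def redWords (m k : ℕ) : Finset (List (Letter m)) :=
  ((Finset.univ : Finset (List.Vector (Letter m) k)).image List.Vector.toList).filter Reduced

lemma mem_redWords {m k : ℕ} {w : List (Letter m)} :
    w ∈ redWords m k ↔ w.length = k ∧ Reduced w := by
  simp only [redWords, Finset.mem_filter, Finset.mem_image, Finset.mem_univ, true_and]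
  refine and_congr_left fun _ => ⟨?_, fun h => ⟨⟨w, h⟩, rfl⟩⟩
  rintro ⟨v, rfl⟩
  exact v.2

lemma redWords_zero (m : ℕ) : redWords m 0 = {[]} := by
  ext w
  simp only [mem_redWords, List.length_eq_zero_iff, Finset.mem_singleton, and_iff_left_iff_imp]
  rintro rfl
  exact Reduced.nil

/-- Sums over reduced words of length `k + 1`, split according to the first letter. -/
lemma sum_redWords_succ {M : Type*} [AddCommMonoid M] (m k : ℕ) (F : List (Letter m) → M) :
    ∑ w ∈ redWords m (k + 1), F w =
      ∑ a : Letter m, ∑ w ∈ (redWords m k).filter (fun w => Reduced (a :: w)), F (a :: w) := by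
  rw [Finset.sum_sigma']
  symm
  refine Finset.sum_bij (fun p _ => p.1 :: p.2) ?_ ?_ ?_ ?_
  · rintro ⟨a, w⟩ h
    simp only [Finset.mem_sigma, Finset.mem_univ, true_and, Finset.mem_filter, mem_redWords] at h
    simp [mem_redWords, h.1.1, h.2]
  · rintro ⟨a, w⟩ _ ⟨b, w'⟩ _ h
    simp only [List.cons.injEq] at h
    obtain ⟨rfl, rfl⟩ := h
    rfl
  · intro w hw
    rw [mem_redWords] at hw
    match w, hw with
    | a :: w, hw =>
      refine ⟨⟨a, w⟩, ?_, rfl⟩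
      simp only [Finset.mem_sigma, Finset.mem_univ, true_and, Finset.mem_filter, mem_redWords]
      exact ⟨⟨by simpa using hw.1, hw.2.tail⟩, hw.2⟩
  · rintro ⟨a, w⟩ _
    rfl

/-- The number of ways to extend a reduced word by one letter on the left. -/
lemma card_cons_reduced {m : ℕ} {w : List (Letter m)} (hw : Reduced w) (hne : w ≠ []) :
    (Finset.univ.filter (fun a : Letter m => Reduced (a :: w))).card = 2 * m - 1 := by
  match w, hne with
  | b :: w, _ =>
    have : (Finset.univ.filter (fun a : Letter m => Reduced (a :: b :: w)))
        = Finset.univ.erase (linv b) := by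
      ext a
      simp only [Finset.mem_filter, Finset.mem_univ, true_and, Finset.mem_erase, and_true,
        reduced_cons_cons, hw]
      exact ne_linv_comm
    rw [this, Finset.card_erase_of_mem (Finset.mem_univ _)]
    simp [mul_comm]

lemma card_redWords_le (m k : ℕ) :
    (redWords m (k + 1)).card = 2 * m * (2 * m - 1) ^ k := by
  induction k with
  | zero =>
    rw [Finset.card_eq_sum_ones, sum_redWords_succ]
    simp [redWords_zero, Finset.filter_singleton, Reduced.singleton, mul_comm]
  | succ k ih =>
    rw [Finset.card_eq_sum_ones, sum_redWords_succ]
    simp_rw [Finset.sum_filter]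
    rw [Finset.sum_comm]
    have : ∀ w ∈ redWords m (k + 1), (∑ a : Letter m, if Reduced (a :: w) then 1 else 0)
        = 2 * m - 1 := by
      intro w hw
      rw [mem_redWords] at hw
      rw [← card_cons_reduced hw.2 (by rintro rfl; simp at hw), Finset.card_filter]
    rw [Finset.sum_congr rfl this, Finset.sum_const, ih, smul_eq_mul, pow_succ]
    ring

section Matrices

variable {m : ℕ} {V : Type*} [DecidableEq V] (σ : Fin m → Equiv.Perm V)

/-- The permutation matrix of a word. -/
noncomputable def wordMat (w : List (Letter m)) : Matrix V V ℝ :=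
  Matrix.of fun u v : V => if run σ w u = v then 1 else 0

/-- The adjacency matrix of the Schreier graph. -/
noncomputable def adjMat : Matrix V V ℝ := ∑ a : Letter m, wordMat σ [a]

/-- The sum of all reduced words of length `k`. -/
noncomputable def redSum (k : ℕ) : Matrix V V ℝ := ∑ w ∈ redWords m k, wordMat σ w

lemma wordMat_nil : wordMat σ [] = 1 := by
  ext u v
  rfl

lemma wordMat_transpose_singleton (a : Letter m) :
    (wordMat σ [a]).transpose = wordMat σ [linv a] := by
  ext u v
  simp only [Matrix.transpose_apply, wordMat, Matrix.of_apply, run_cons, run_nil, step_linv]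
  refine if_congr ?_ rfl rfl
  rw [Equiv.Perm.inv_eq_iff_eq, eq_comm]

lemma redSum_one : redSum σ 1 = adjMat σ := by
  rw [redSum, sum_redWords_succ]
  simp [redWords_zero, Finset.filter_singleton, Reduced.singleton, adjMat]

lemma adjMat_isHermitian : (adjMat σ).IsHermitian := by
  unfold Matrix.IsHermitian
  rw [Matrix.conjTranspose_eq_transpose_of_trivial, adjMat, Matrix.transpose_sum]
  simp_rw [wordMat_transpose_singleton]
  exact Function.Bijective.sum_comp (Function.Involutive.bijective linv_linv)
    (fun a => wordMat σ [a])

lemma redSum_zero : redSum σ 0 = 1 := by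
  simp [redSum, redWords_zero, wordMat_nil]

variable [Fintype V]

lemma wordMat_append (w w' : List (Letter m)) :
    wordMat σ (w ++ w') = wordMat σ w * wordMat σ w' := by
  ext u v
  rw [Matrix.mul_apply, Finset.sum_eq_single (run σ w u)]
  · simp [wordMat, run_append]
  · intro b _ hb
    simp [wordMat, hb.symm]
  · simp

lemma wordMat_mulVec (w : List (Letter m)) (f : V → ℝ) (v : V) :
    (wordMat σ w).mulVec f v = f (run σ w v) := by
  simp [wordMat, Matrix.mulVec, dotProduct]

lemma adjMat_mulVec (f : V → ℝ) (v : V) :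
    (adjMat σ).mulVec f v = ∑ a : Letter m, f (step σ a v) := by
  simp [adjMat, Matrix.sum_mulVec, wordMat_mulVec]

lemma adjMat_mul_redSum (k : ℕ) : adjMat σ * redSum σ (k + 1) = redSum σ (k + 2) +
    ∑ w ∈ redWords m k, ((Finset.univ.filter (fun a : Letter m => Reduced (a :: w))).card : ℝ) •
      wordMat σ w := by
  have h1 : adjMat σ * redSum σ (k + 1) =
      ∑ a : Letter m, ∑ w ∈ redWords m (k + 1), wordMat σ (a :: w) := by
    rw [adjMat, redSum, Finset.sum_mul]
    refine Finset.sum_congr rfl fun a _ => ?_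
    rw [Finset.mul_sum]
    exact Finset.sum_congr rfl fun w _ => (wordMat_append σ [a] w).symm
  have h2 : redSum σ (k + 2) = ∑ a : Letter m, ∑ w ∈ (redWords m (k + 1)).filter
      (fun w => Reduced (a :: w)), wordMat σ (a :: w) := sum_redWords_succ m (k + 1) _
  have h3 : ∑ a : Letter m, ∑ w ∈ (redWords m (k + 1)).filter
      (fun w => ¬ Reduced (a :: w)), wordMat σ (a :: w) =
      ∑ w ∈ redWords m k, ((Finset.univ.filter (fun a : Letter m => Reduced (a :: w))).card : ℝ) •
      wordMat σ w := by
    simp_rw [Finset.sum_filter]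
    rw [Finset.sum_comm, sum_redWords_succ]
    simp_rw [Finset.sum_filter]
    rw [Finset.sum_comm]
    refine Finset.sum_congr rfl fun w hw => ?_
    rw [← Finset.sum_filter, Nat.cast_smul_eq_nsmul, ← Finset.sum_const]
    refine Finset.sum_congr rfl fun b hb => ?_
    rw [Finset.sum_eq_single (linv b)]
    · rw [if_pos (by simp [reduced_cons_cons])]
      ext u v
      simp [wordMat]
    · intro a _ hab
      rw [if_neg]
      rw [not_not, reduced_cons_cons]
      exact ⟨ne_linv_comm.mpr hab, (Finset.mem_filter.mp hb).2⟩
    · simp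
  rw [h1, h2, ← h3, ← Finset.sum_add_distrib]
  exact Finset.sum_congr rfl fun a _ => (Finset.sum_filter_add_sum_filter_not _ _ _).symm

lemma adjMat_mul_adjMat : adjMat σ * adjMat σ = redSum σ 2 + (2 * m : ℝ) • 1 := by
  have := adjMat_mul_redSum σ 0
  rw [zero_add, redSum_one] at this
  rw [this]
  simp [redWords_zero, wordMat_nil, Reduced.singleton, mul_comm]

lemma adjMat_mul_redSum_succ (hm : 0 < m) (k : ℕ) : adjMat σ * redSum σ (k + 2) =
    redSum σ (k + 3) + (2 * m - 1 : ℝ) • redSum σ (k + 1) := by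
  rw [adjMat_mul_redSum σ (k + 1)]
  congr 1
  rw [redSum, Finset.smul_sum]
  refine Finset.sum_congr rfl fun w hw => ?_
  rw [mem_redWords] at hw
  rw [card_cons_reduced hw.2 (by rintro rfl; simp at hw)]
  congr 1
  rw [Nat.cast_sub (by omega)]
  simp

open Polynomial in
/-- The orthogonal polynomials of the regular tree: `q ^ (k / 2) * U k (x / (2 * √q))`. -/
noncomputable def treePoly (q : ℝ) : ℕ → ℝ[X]
  | 0 => 1
  | 1 => X
  | k + 2 => X * treePoly q (k + 1) - C q * treePoly q k

open Polynomial in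
lemma treePoly_add_two (q : ℝ) (k : ℕ) :
    treePoly q (k + 2) = X * treePoly q (k + 1) - C q * treePoly q k := rfl

open Polynomial in
lemma aeval_treePoly_add_two (hm : 0 < m) {q : ℝ} (hq : q = 2 * m - 1) (k : ℕ) :
    aeval (adjMat σ) (treePoly q (k + 2)) =
      redSum σ (k + 2) + aeval (adjMat σ) (treePoly q k) := by
  have hrec : ∀ k, aeval (adjMat σ) (treePoly q (k + 2)) = adjMat σ *
      aeval (adjMat σ) (treePoly q (k + 1)) - q • aeval (adjMat σ) (treePoly q k) := fun k => by
    rw [treePoly_add_two, map_sub, map_mul, map_mul, aeval_X, aeval_C,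
      Algebra.algebraMap_eq_smul_one, smul_one_mul]
  induction k using Nat.strong_induction_on with
  | _ k ih =>
    match k with
    | 0 =>
      rw [hrec]
      simp only [treePoly, map_one, aeval_X, adjMat_mul_adjMat, zero_add, hq]
      module
    | 1 =>
      have h0 := ih 0 (by omega)
      rw [hrec, h0, mul_add, adjMat_mul_redSum_succ σ hm 0, ← hq]
      simp only [treePoly, map_one, aeval_X, zero_add, redSum_one, mul_one]
      module
    | k + 2 =>
      have h0 := ih k (by omega)
      have h1 := ih (k + 1) (by omega)
      have h2 : adjMat σ * aeval (adjMat σ) (treePoly q (k + 1)) =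
          redSum σ (k + 2) + aeval (adjMat σ) (treePoly q k) +
            q • aeval (adjMat σ) (treePoly q k) := by
        rw [← h0, hrec k, sub_add_cancel]
      rw [hrec, h1, mul_add, adjMat_mul_redSum_succ σ hm, ← hq, h2, h0]
      module

end Matrices

open Polynomial in
lemma eval_treePoly (r : ℝ) (k : ℕ) (y : ℝ) :
    (treePoly (r ^ 2) k).eval (2 * r * y) = r ^ k * (Chebyshev.U ℝ k).eval y := by
  induction k using Nat.twoStepInduction with
  | zero => simp [treePoly]
  | one => simp [treePoly]; ring
  | more k h1 h2 =>
    have := Chebyshev.U_add_two ℝ (k : ℤ)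
    push_cast at h2 ⊢
    simp only [treePoly, eval_sub, eval_mul, eval_X, eval_C, h1, h2, this, eval_ofNat]
    ring

open Polynomial in
lemma eval_treePoly_growth {r x : ℝ} (hr : 0 < r) (hx : 2 * r ≤ x) (k : ℕ) :
    r ^ k * (k + 1) ≤ (treePoly (r ^ 2) k).eval x ∧
      r * (treePoly (r ^ 2) k).eval x + r ^ (k + 1) ≤ (treePoly (r ^ 2) (k + 1)).eval x := by
  induction k with
  | zero =>
    simp only [treePoly, eval_one, eval_X]
    constructor
    · norm_num
    · rw [zero_add, pow_one]
      linarith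
  | succ k ih =>
    obtain ⟨h2, h1⟩ := ih
    have h3 : r ^ (k + 1) * (k + 1 + 1) ≤ (treePoly (r ^ 2) (k + 1)).eval x := by
      have : r * (r ^ k * (k + 1)) ≤ r * (treePoly (r ^ 2) k).eval x := by gcongr
      calc r ^ (k + 1) * (k + 1 + 1) = r * (r ^ k * (k + 1)) + r ^ (k + 1) := by ring
        _ ≤ _ := by linarith
    have h4 : 0 ≤ (treePoly (r ^ 2) (k + 1)).eval x := le_trans (by positivity) h3
    refine ⟨by push_cast; exact h3, ?_⟩
    simp only [treePoly, eval_sub, eval_mul, eval_X, eval_C]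
    have e1 : x * (treePoly (r ^ 2) (k + 1)).eval x ≥
        2 * r * (treePoly (r ^ 2) (k + 1)).eval x := by gcongr
    have e2 := mul_le_mul_of_nonneg_left h1 hr.le
    have : r * r ^ (k + 1) = r ^ (k + 1 + 1) := by ring
    nlinarith

open Polynomial in
lemma eval_neg_treePoly (q x : ℝ) (k : ℕ) :
    (treePoly q k).eval (-x) = (-1) ^ k * (treePoly q k).eval x := by
  induction k using Nat.twoStepInduction with
  | zero => simp [treePoly]
  | one => simp [treePoly]
  | more k h1 h2 => simp only [treePoly, eval_sub, eval_mul, eval_X, eval_C, h1, h2]; ring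

open Polynomial in
/-- Lower bound for the sum over the reduced words of length `k + 2` outside the tree spectrum. -/
lemma le_abs_eval_treePoly_sub {r x : ℝ} (hr : 0 < r) (hr2 : 2 ≤ r ^ 2) (hx : 2 * r ≤ |x|)
    (k : ℕ) :
    r ^ k * (k + 1) ≤ |(treePoly (r ^ 2) (k + 2)).eval x - (treePoly (r ^ 2) k).eval x| := by
  have key : ∀ x : ℝ, 2 * r ≤ x → r ^ k * (k + 1) ≤
      (treePoly (r ^ 2) (k + 2)).eval x - (treePoly (r ^ 2) k).eval x := by
    intro x hx
    obtain ⟨h0, h1⟩ := eval_treePoly_growth hr hx k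
    obtain ⟨-, h2⟩ := eval_treePoly_growth hr hx (k + 1)
    have e1 := mul_le_mul_of_nonneg_left h1 hr.le
    have e2 : 0 ≤ (treePoly (r ^ 2) k).eval x := le_trans (by positivity) h0
    have e3 : 0 ≤ r * r ^ (k + 1) := by positivity
    have e4 : 0 ≤ r ^ (k + 1 + 1) := by positivity
    nlinarith
  rcases abs_cases x with ⟨h, _⟩ | ⟨h, _⟩
  · rw [h] at hx
    exact (key x hx).trans (le_abs_self _)
  · rw [h] at hx
    have := key (-x) hx
    rw [eval_neg_treePoly, eval_neg_treePoly, pow_add, neg_one_sq, mul_one, ← mul_sub] at this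
    refine this.trans ((le_abs_self _).trans ?_)
    rw [abs_mul, abs_pow]
    simp

lemma card_image_eq_of_iff {ι α β : Type*} [DecidableEq α] [DecidableEq β] {s : Finset ι}
    {f : ι → α} {g : ι → β}
    (h : ∀ j ∈ s, ∀ j' ∈ s, (f j = f j' ↔ g j = g j')) :
    (s.image f).card = (s.image g).card := by
  have h1 : ∀ x : α, x ∈ s.image f → ∃ j ∈ s, f j = x := fun x hx => Finset.mem_image.mp hx
  choose c hc hfc using h1
  refine Finset.card_bij (fun x hx => g (c x hx)) ?_ ?_ ?_
  · exact fun x hx => Finset.mem_image_of_mem g (hc x hx)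
  · intro x hx y hy hxy
    rw [← h _ (hc x hx) _ (hc y hy), hfc, hfc] at hxy
    exact hxy
  · intro y hy
    obtain ⟨j, hj, rfl⟩ := Finset.mem_image.mp hy
    refine ⟨f j, Finset.mem_image_of_mem f hj, ?_⟩
    exact (h _ (hc _ _) _ hj).mp (hfc _ _)

lemma exists_perm_extending {α J : Type*} [Fintype α] (s : Finset J) (a b : J → α)
    (h : ∀ j ∈ s, ∀ j' ∈ s, (a j = a j' ↔ b j = b j')) :
    ∃ τ : Equiv.Perm α, ∀ j ∈ s, τ (a j) = b j := by
  have h1 : ∀ x : {x // x ∈ s.image a}, ∃ j ∈ s, a j = x := fun x =>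
    Finset.mem_image.mp x.2
  choose c hc hca using h1
  let f : {x // x ∈ s.image a} → {x // x ∈ s.image b} :=
    fun x => ⟨b (c x), Finset.mem_image_of_mem _ (hc x)⟩
  have hf : Function.Bijective f := by
    constructor
    · intro x y hxy
      have : b (c x) = b (c y) := congrArg Subtype.val hxy
      rw [← h _ (hc x) _ (hc y), hca, hca] at this
      exact Subtype.ext this
    · rintro ⟨y, hy⟩
      obtain ⟨j, hj, rfl⟩ := Finset.mem_image.mp hy
      refine ⟨⟨a j, Finset.mem_image_of_mem _ hj⟩, Subtype.ext ?_⟩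
      exact (h _ (hc _) _ hj).mp (hca _)
  refine ⟨(Equiv.ofBijective f hf).extendSubtype, fun j hj => ?_⟩
  rw [Equiv.extendSubtype_apply_of_mem _ _ (Finset.mem_image_of_mem a hj)]
  exact (h _ (hc _) _ hj).mp (hca _)

/-- The number of permutations extending a given partial injection. -/
lemma card_perm_extending {α J : Type*} [Fintype α] (s : Finset J) (a b : J → α)
    (h : ∀ j ∈ s, ∀ j' ∈ s, (a j = a j' ↔ b j = b j')) :
    (Finset.univ.filter (fun τ : Equiv.Perm α => ∀ j ∈ s, τ (a j) = b j)).card =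
      (Fintype.card α - (s.image a).card).factorial := by
  obtain ⟨τ₀, hτ₀⟩ := exists_perm_extending s a b h
  have h1 : (Finset.univ.filter (fun τ : Equiv.Perm α => ∀ j ∈ s, τ (a j) = b j)).card =
      Fintype.card {f : Equiv.Perm α // ∀ x, ¬ (x ∉ s.image a) → f x = x} := by
    rw [← Fintype.card_subtype]
    refine Fintype.card_congr ((Equiv.mulLeft τ₀⁻¹).subtypeEquiv fun τ => ?_)
    constructor
    · intro hτ x hx
      rw [not_not] at hx
      obtain ⟨j, hj, rfl⟩ := Finset.mem_image.mp hx
      simp [hτ j hj, ← hτ₀ j hj]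
    · intro hτ j hj
      have := hτ (a j) (by simpa using ⟨j, hj, rfl⟩)
      simp only [Equiv.coe_mulLeft, Equiv.Perm.coe_mul, Function.comp_apply,
        Equiv.Perm.inv_eq_iff_eq] at this
      rw [this, hτ₀ j hj]
  rw [h1, ← Fintype.card_congr (Equiv.Perm.subtypeEquivSubtypePerm (fun x => x ∉ s.image a)),
    Fintype.card_perm]
  congr 1
  rw [Fintype.card_subtype_compl]
  congr 1
  exact Fintype.card_coe _

noncomputable instance {α : Type*} [Finite α] : Fintype (Setoid α) :=
  @Fintype.ofFinite _ (Finite.of_injective (fun s : Setoid α => fun p : α × α => s p.1 p.2)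
    fun s t h => Setoid.ext fun x y => by
      have := congrFun h (x, y)
      exact iff_of_eq this)

/-- The number of functions with a given kernel. -/
lemma card_ker_eq {ι α : Type*} [Fintype ι] [DecidableEq ι] [Fintype α] [DecidableEq α]
    (π : Setoid ι) :
    (Finset.univ.filter (fun u : ι → α => Setoid.ker u = π)).card =
      (Fintype.card α).descFactorial (Fintype.card (Quotient π)) := by
  rw [← Fintype.card_subtype, ← Fintype.card_embedding_eq]
  refine Fintype.card_congr
    { toFun := fun u => ⟨Quotient.lift u.1 fun x y h => by
          have : Setoid.ker u.1 x y := by rw [u.2]; exact h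
          exact this, ?_⟩
      invFun := fun f => ⟨fun x => f (Quotient.mk π x), ?_⟩
      left_inv := fun u => rfl
      right_inv := fun f => ?_ }
  · intro x y
    induction x using Quotient.inductionOn
    induction y using Quotient.inductionOn
    rename_i x y
    intro h
    apply Quotient.sound
    have : Setoid.ker u.1 x y := h
    rwa [u.2] at this
  · ext x y
    rw [Setoid.ker_def, f.injective.eq_iff]
    exact Quotient.eq
  · ext x
    induction x using Quotient.inductionOn
    rfl

section Pattern

variable {m k : ℕ} (w : ZMod k → Letter m)

/-- The tail of the `j`-th edge of a cyclic word, oriented along its generator. -/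
def src (j : ZMod k) : ZMod k := if (w j).2 then j else j + 1

/-- The head of the `j`-th edge of a cyclic word, oriented along its generator. -/
def tgt (j : ZMod k) : ZMod k := if (w j).2 then j + 1 else j

lemma step_eq_iff {V : Type*} (σ : Fin m → Equiv.Perm V) (u : ZMod k → V) (j : ZMod k) :
    step σ (w j) (u j) = u (j + 1) ↔ σ (w j).1 (u (src w j)) = u (tgt w j) := by
  unfold step src tgt
  by_cases h : (w j).2 = true
  · simp [h]
  · simp only [h, if_false, Bool.false_eq_true]
    rw [Equiv.Perm.inv_eq_iff_eq, eq_comm]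

/-- A vertex pattern is consistent if it turns the generators into partial injections. -/
def Consistent (π : Setoid (ZMod k)) : Prop :=
  ∀ j j', (w j).1 = (w j').1 → (π (src w j) (src w j') ↔ π (tgt w j) (tgt w j'))

variable [NeZero k]

/-- The number of edges labelled by the `i`-th generator in a pattern. -/
noncomputable def edgeCount (π : Setoid (ZMod k)) (i : Fin m) : ℕ :=
  ((Finset.univ.filter (fun j => (w j).1 = i)).image
    (fun j => (Quotient.mk π (src w j)))).card

/-- The number of closed walks following `w`. -/
noncomputable def closedCount {V : Type*} [Fintype V] [DecidableEq V]
    (σ : Fin m → Equiv.Perm V) : ℕ :=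
  (Finset.univ.filter (fun u : ZMod k → V => ∀ j, step σ (w j) (u j) = u (j + 1))).card

lemma card_perms_following {V : Type*} [Fintype V] [DecidableEq V] (u : ZMod k → V) :
    (Finset.univ.filter (fun σ : Fin m → Equiv.Perm V =>
      ∀ j, step σ (w j) (u j) = u (j + 1))).card =
    if Consistent w (Setoid.ker u) then
      ∏ i, (Fintype.card V - edgeCount w (Setoid.ker u) i).factorial else 0 := by
  have e : (Finset.univ.filter (fun σ : Fin m → Equiv.Perm V =>
      ∀ j, step σ (w j) (u j) = u (j + 1))) = Fintype.piFinset fun i =>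
      Finset.univ.filter (fun τ : Equiv.Perm V =>
        ∀ j ∈ Finset.univ.filter (fun j => (w j).1 = i), τ (u (src w j)) = u (tgt w j)) := by
    ext σ
    simp only [Finset.mem_filter, Finset.mem_univ, true_and, Fintype.mem_piFinset, step_eq_iff]
    constructor
    · rintro h i j rfl
      exact h j
    · intro h j
      exact h _ j rfl
  rw [e, Fintype.card_piFinset]
  split_ifs with hc
  · refine Finset.prod_congr rfl fun i _ => ?_
    have hce := card_perm_extending (Finset.univ.filter (fun j => (w j).1 = i))
      (fun j => u (src w j)) (fun j => u (tgt w j)) ?_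
    · trans (Fintype.card V - ((Finset.univ.filter (fun j => (w j).1 = i)).image
        (fun j => u (src w j))).card).factorial
      · convert hce
      congr 2
      unfold edgeCount
      refine @card_image_eq_of_iff _ _ _ _ (_) _ _ _ fun j _ j' _ => ?_
      rw [Quotient.eq]
      exact Iff.rfl
    · intro j hj j' hj'
      simp only [Finset.mem_filter, Finset.mem_univ, true_and] at hj hj'
      exact hc j j' (hj.trans hj'.symm)
  · rw [Consistent] at hc
    push Not at hc
    obtain ⟨j, j', hjj, hne⟩ := hc
    refine Finset.prod_eq_zero (Finset.mem_univ (w j).1) ?_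
    rw [Finset.card_eq_zero, Finset.filter_eq_empty_iff]
    intro τ _ hτ
    have h1 := hτ j (by simp)
    have h2 := hτ j' (by simp [hjj])
    rcases hne with ⟨h3, h4⟩ | ⟨h3, h4⟩
    · apply h4
      have h3' : u (src w j) = u (src w j') := h3
      change u (tgt w j) = u (tgt w j')
      rw [← h1, ← h2, h3']
    · apply h3
      change u (src w j) = u (src w j')
      have h4' : u (tgt w j) = u (tgt w j') := h4
      rw [← h1, ← h2] at h4'
      exact τ.injective h4'

lemma sum_closedCount {V : Type*} [Fintype V] [DecidableEq V] :
    ∑ σ : Fin m → Equiv.Perm V, closedCount w σ =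
      ∑ π ∈ Finset.univ.filter (Consistent w),
        (Fintype.card V).descFactorial (Fintype.card (Quotient π)) *
          ∏ i, (Fintype.card V - edgeCount w π i).factorial := by
  simp_rw [closedCount, Finset.card_filter]
  rw [Finset.sum_comm]
  simp_rw [← Finset.card_filter, card_perms_following]
  rw [← Finset.sum_fiberwise (s := Finset.univ) (g := fun u : ZMod k → V => Setoid.ker u),
    Finset.sum_filter]
  refine Finset.sum_congr rfl fun π _ => ?_
  have : ∀ u ∈ Finset.univ.filter (fun u : ZMod k → V => Setoid.ker u = π),
      (if Consistent w (Setoid.ker u) then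
        ∏ i, (Fintype.card V - edgeCount w (Setoid.ker u) i).factorial else 0) =
      if Consistent w π then ∏ i, (Fintype.card V - edgeCount w π i).factorial else 0 := by
    intro u hu
    rw [(Finset.mem_filter.mp hu).2]
  rw [Finset.sum_congr rfl this, Finset.sum_const, card_ker_eq, smul_eq_mul, mul_ite, mul_zero]

end Pattern

section Pattern

variable {m k : ℕ} {w : ZMod k → Letter m}

/-- A cyclic word is reduced if no letter is cyclically followed by its inverse. -/
def CycReduced (w : ZMod k → Letter m) : Prop := ∀ j, w (j + 1) ≠ linv (w j)

/-- A cyclic word is periodic if it is invariant under a non-trivial rotation. -/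
def Periodic (w : ZMod k → Letter m) : Prop := ∃ s ≠ 0, ∀ t, w (t + s) = w t

lemma rel_succ_of_eq {π : Setoid (ZMod k)} (hc : Consistent w π) {i j : ZMod k} (h : π i j)
    (hij : w j = w i) : π (i + 1) (j + 1) := by
  have := hc i j (by rw [hij])
  simp only [src, tgt, hij] at this
  split_ifs at this
  · exact this.mp h
  · exact this.mpr h

lemma rel_pred_succ_of_eq {π : Setoid (ZMod k)} (hc : Consistent w π) {i j : ZMod k} (h : π i j)
    (hij : w j = linv (w (i - 1))) : π (i - 1) (j + 1) := by
  have := hc (i - 1) j (by rw [hij, linv])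
  simp only [src, tgt, hij, linv, sub_add_cancel] at this
  cases hb : (w (i - 1)).2 <;> simp only [hb, Bool.not_false, Bool.not_true, if_true,
    Bool.false_eq_true, if_false] at this
  · exact this.mp h
  · exact this.mpr h

lemma consistent_bot (hw : CycReduced w) : Consistent w ⊥ := by
  intro j j' h
  simp only [Setoid.bot_def, src, tgt]
  have hw' : ∀ a b : ZMod k, (w a).1 = (w b).1 → (w a).2 ≠ (w b).2 → a ≠ b + 1 := by
    rintro a b h1 h2 rfl
    apply hw b
    refine Prod.ext h1 ?_
    simp only [linv]
    revert h2
    cases (w b).2 <;> cases (w (b + 1)).2 <;> simp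
  by_cases h1 : (w j).2 = (w j').2
  · rw [h1]
    split_ifs <;> simp
  · have a1 := hw' j j' h h1
    have a2 := hw' j' j h.symm (Ne.symm h1)
    cases hb : (w j).2 <;> cases hb' : (w j').2
    · simp [hb, hb'] at h1
    · simpa using iff_of_false a2.symm a1
    · simpa using iff_of_false a1 a2.symm
    · simp [hb, hb'] at h1

variable [NeZero k]

/-- The pairs of a vertex of a pattern and the label of an edge leaving that vertex. -/
noncomputable def halfEdges (w : ZMod k → Letter m) (π : Setoid (ZMod k)) :
    Finset (Quotient π × Letter m) :=
  Finset.univ.image (fun j => (Quotient.mk π (src w j), ((w j).1, true))) ∪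
    Finset.univ.image (fun j => (Quotient.mk π (tgt w j), ((w j).1, false)))

lemma mk_mem_halfEdges (π : Setoid (ZMod k)) (j : ZMod k) :
    (Quotient.mk π j, w j) ∈ halfEdges w π := by
  rw [halfEdges, Finset.mem_union, Finset.mem_image, Finset.mem_image]
  rcases h : w j with ⟨i, _ | _⟩
  · exact Or.inr ⟨j, by simp [tgt, h]⟩
  · exact Or.inl ⟨j, by simp [src, h]⟩

lemma mk_succ_mem_halfEdges (π : Setoid (ZMod k)) (j : ZMod k) :
    (Quotient.mk π (j + 1), linv (w j)) ∈ halfEdges w π := by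
  rw [halfEdges, Finset.mem_union, Finset.mem_image, Finset.mem_image]
  rcases h : w j with ⟨i, _ | _⟩
  · exact Or.inl ⟨j, by simp [src, h, linv]⟩
  · exact Or.inr ⟨j, by simp [tgt, h, linv]⟩

lemma mk_mem_halfEdges' (π : Setoid (ZMod k)) (j : ZMod k) :
    (Quotient.mk π j, linv (w (j - 1))) ∈ halfEdges w π := by
  simpa using mk_succ_mem_halfEdges (w := w) π (j - 1)

lemma card_halfEdges {π : Setoid (ZMod k)} (hc : Consistent w π) :
    (halfEdges w π).card = 2 * ∑ i, edgeCount w π i := by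
  have h1 : (Finset.univ.image (fun j => (Quotient.mk π (src w j), ((w j).1, true)))).card =
      ∑ i, edgeCount w π i := by
    rw [Finset.card_eq_sum_card_fiberwise (f := fun x => x.2.1) (t := Finset.univ)
      (fun _ _ => Finset.mem_coe.mpr (Finset.mem_univ _))]
    refine Finset.sum_congr rfl fun i _ => ?_
    unfold edgeCount
    rw [Finset.filter_image]
    refine card_image_eq_of_iff fun j hj j' hj' => ?_
    simp only [Finset.mem_filter, Finset.mem_univ, true_and] at hj hj'
    simp [hj, hj']
  have h2 : (Finset.univ.image (fun j => (Quotient.mk π (tgt w j), ((w j).1, false)))).card =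
      (Finset.univ.image (fun j => (Quotient.mk π (src w j), ((w j).1, true)))).card := by
    refine card_image_eq_of_iff fun j _ j' _ => ?_
    simp only [Prod.mk.injEq, and_true]
    constructor
    · rintro ⟨h, h'⟩
      exact ⟨Quotient.sound ((hc j j' h').mpr (Quotient.exact h)), h'⟩
    · rintro ⟨h, h'⟩
      exact ⟨Quotient.sound ((hc j j' h').mp (Quotient.exact h)), h'⟩
  rw [halfEdges, Finset.card_union_of_disjoint, h2, h1, two_mul]
  rw [Finset.disjoint_left]
  intro x hx hx'
  simp only [Finset.mem_image, Finset.mem_univ, true_and] at hx hx'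
  obtain ⟨j, rfl⟩ := hx
  obtain ⟨j', h⟩ := hx'
  simp at h

lemma two_le_card_halfEdges_at (hw : CycReduced w) (π : Setoid (ZMod k)) (c : Quotient π) :
    2 ≤ ((halfEdges w π).filter (fun x => x.1 = c)).card := by
  induction c using Quotient.inductionOn
  rename_i j
  have hne : w j ≠ linv (w (j - 1)) := by simpa using hw (j - 1)
  refine Finset.one_lt_card.mpr ⟨(Quotient.mk π j, w j), ?_, (Quotient.mk π j, linv (w (j - 1))),
    ?_, by simpa using hne⟩
  · exact Finset.mem_filter.mpr ⟨mk_mem_halfEdges π j, rfl⟩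
  · exact Finset.mem_filter.mpr ⟨mk_mem_halfEdges' π j, rfl⟩

lemma card_halfEdges_eq_sum (π : Setoid (ZMod k)) : (halfEdges w π).card =
    ∑ c : Quotient π, ((halfEdges w π).filter (fun x => x.1 = c)).card :=
  Finset.card_eq_sum_card_fiberwise (fun _ _ => Finset.mem_coe.mpr (Finset.mem_univ _))

/-- A consistent pattern of a cyclically reduced word has at least as many edges as vertices. -/
lemma card_quotient_le (hw : CycReduced w) {π : Setoid (ZMod k)} (hc : Consistent w π) :
    Fintype.card (Quotient π) ≤ ∑ i, edgeCount w π i := by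
  have h1 := card_halfEdges_eq_sum (w := w) π
  rw [card_halfEdges hc] at h1
  have h2 := Finset.sum_le_sum fun c (_ : c ∈ Finset.univ) => two_le_card_halfEdges_at hw π c
  rw [← h1] at h2
  simp at h2
  omega

lemma eq_or_eq_of_mem_halfEdges (hw : CycReduced w) {π : Setoid (ZMod k)} (hc : Consistent w π)
    (he : ∑ i, edgeCount w π i = Fintype.card (Quotient π)) {j : ZMod k} {a : Letter m}
    (ha : (Quotient.mk π j, a) ∈ halfEdges w π) : a = w j ∨ a = linv (w (j - 1)) := by
  have h1 := card_halfEdges_eq_sum (w := w) π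
  rw [card_halfEdges hc, he] at h1
  have h2 : ∑ c : Quotient π, 2 =
      ∑ c : Quotient π, ((halfEdges w π).filter (fun x => x.1 = c)).card := by
    rw [← h1]; simp [mul_comm]
  have h3 := (Finset.sum_eq_sum_iff_of_le
    (fun c _ => two_le_card_halfEdges_at hw π c)).mp h2 (Quotient.mk π j) (Finset.mem_univ _)
  have hne : w j ≠ linv (w (j - 1)) := by simpa using hw (j - 1)
  have h4 : ({(Quotient.mk π j, w j), (Quotient.mk π j, linv (w (j - 1)))} : Finset _) =
      (halfEdges w π).filter (fun x => x.1 = Quotient.mk π j) := by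
    apply Finset.eq_of_subset_of_card_le
    · intro x hx
      simp only [Finset.mem_insert, Finset.mem_singleton] at hx
      rcases hx with rfl | rfl
      · exact Finset.mem_filter.mpr ⟨mk_mem_halfEdges π j, rfl⟩
      · exact Finset.mem_filter.mpr ⟨mk_mem_halfEdges' π j, rfl⟩
    · rw [← h3, Finset.card_pair (by simpa using hne)]
  have h5 : (Quotient.mk π j, a) ∈ (halfEdges w π).filter (fun x => x.1 = Quotient.mk π j) :=
    Finset.mem_filter.mpr ⟨ha, rfl⟩
  rw [← h4] at h5
  simpa using h5

lemma rel_letter (hw : CycReduced w) {π : Setoid (ZMod k)} (hc : Consistent w π)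
    (he : ∑ i, edgeCount w π i = Fintype.card (Quotient π)) {i j : ZMod k} (h : π i j) :
    w j = w i ∨ w j = linv (w (i - 1)) := by
  apply eq_or_eq_of_mem_halfEdges hw hc he
  rw [Quotient.sound (s := π) h]
  exact mk_mem_halfEdges π j

/-- In a pattern with as many edges as vertices, a visit to a vertex in the opposite direction
is impossible. -/
lemma not_opposite (hw : CycReduced w) {π : Setoid (ZMod k)} (hc : Consistent w π)
    (he : ∑ i, edgeCount w π i = Fintype.card (Quotient π)) {i j : ZMod k} (h : π i j) :
    w j ≠ linv (w (i - 1)) := by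
  intro hij
  have key : ∀ t : ℕ, π (i - t) (j + t) ∧ w (j + t) = linv (w (i - t - 1)) := by
    intro t
    induction t with
    | zero => simpa using ⟨h, hij⟩
    | succ t ih =>
      have h1 := rel_pred_succ_of_eq hc ih.1 ih.2
      push_cast
      rw [← sub_sub, ← add_assoc]
      refine ⟨h1, (rel_letter hw hc he h1).resolve_left fun h2 => ?_⟩
      apply hw (j + t)
      rw [h2, ih.2, linv_linv]
  obtain ⟨s, hs⟩ : ∃ s : ℕ, i = j + s := ⟨(i - j).val, by simp⟩
  obtain ⟨t, rfl | rfl⟩ := Nat.even_or_odd' s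
  · have h1 := (key t).2
    rw [show i - t - 1 = j + t - 1 by rw [hs]; push_cast; ring] at h1
    apply hw (j + t - 1)
    simpa using h1
  · have h1 := (key t).2
    rw [show i - t - 1 = j + t by rw [hs]; push_cast; ring] at h1
    exact linv_ne _ h1.symm

lemma rel_add (hw : CycReduced w) {π : Setoid (ZMod k)} (hc : Consistent w π)
    (he : ∑ i, edgeCount w π i = Fintype.card (Quotient π)) {i j : ZMod k} (h : π i j)
    (t : ZMod k) : π (i + t) (j + t) ∧ w (j + t) = w (i + t) := by
  have key : ∀ t : ℕ, π (i + t) (j + t) ∧ w (j + t) = w (i + t) := by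
    intro t
    induction t with
    | zero =>
      simpa using ⟨h, (rel_letter hw hc he h).resolve_right (not_opposite hw hc he h)⟩
    | succ t ih =>
      have h1 := rel_succ_of_eq hc ih.1 ih.2
      push_cast
      rw [← add_assoc, ← add_assoc]
      exact ⟨h1, (rel_letter hw hc he h1).resolve_right (not_opposite hw hc he h1)⟩
  simpa using key t.val

lemma eq_bot_of_not_periodic (hw : CycReduced w) (hp : ¬ Periodic w) {π : Setoid (ZMod k)}
    (hc : Consistent w π) (he : ∑ i, edgeCount w π i = Fintype.card (Quotient π)) : π = ⊥ := by
  ext i j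
  rw [Setoid.bot_def]
  refine ⟨fun h => ?_, fun h => h ▸ π.refl i⟩
  by_contra hne
  refine hp ⟨j - i, sub_ne_zero.mpr (Ne.symm hne), fun t => ?_⟩
  have := (rel_add hw hc he h (t - i)).2
  rw [show t + (j - i) = j + (t - i) by ring, this]
  congr 1
  ring

lemma sum_edgeCount_bot (hw : CycReduced w) :
    ∑ i, edgeCount w ⊥ i = Fintype.card (Quotient (⊥ : Setoid (ZMod k))) := by
  have h1 : Fintype.card (Quotient (⊥ : Setoid (ZMod k))) = Fintype.card (ZMod k) :=
    Fintype.card_congr (Equiv.ofBijective (Quotient.mk ⊥)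
      ⟨fun x y h => by simpa [Setoid.bot_def] using Quotient.exact h,
        Quotient.mk_surjective⟩).symm
  rw [h1, ← Finset.card_univ,
    Finset.card_eq_sum_card_fiberwise (f := fun j => (w j).1) (t := Finset.univ)
      (fun _ _ => Finset.mem_coe.mpr (Finset.mem_univ _))]
  refine Finset.sum_congr rfl fun i _ => ?_
  unfold edgeCount
  apply Finset.card_image_of_injOn
  intro j hj j' hj' h
  simp only [Finset.coe_filter, Finset.mem_univ, true_and, Set.mem_ofPred_eq] at hj hj'
  have hs : src w j = src w j' := by simpa [Setoid.bot_def] using Quotient.exact h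
  have ht : tgt w j = tgt w j' := (consistent_bot hw j j' (hj.trans hj'.symm)).mp hs
  simp only [src, tgt] at hs ht
  cases hb : (w j).2 <;> cases hb' : (w j').2 <;> simp [hb, hb'] at hs ht
  · exact ht
  · exfalso
    apply hw j
    rw [hs]
    exact Prod.ext (by simp [linv, hj, hj']) (by simp [linv, hb, hb'])
  · exfalso
    apply hw j
    rw [ht]
    exact Prod.ext (by simp [linv, hj, hj']) (by simp [linv, hb, hb'])
  · exact hs

/-- The consistent patterns with as many edges as vertices. -/
noncomputable def unicyclicPatterns (w : ZMod k → Letter m) : Finset (Setoid (ZMod k)) :=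
  (Finset.univ.filter (Consistent w)).filter
    (fun π => ∑ i, edgeCount w π i = Fintype.card (Quotient π))

lemma card_unicyclicPatterns_of_not_periodic (hw : CycReduced w) (hp : ¬ Periodic w) :
    (unicyclicPatterns w).card = 1 := by
  rw [Finset.card_eq_one]
  refine ⟨⊥, ?_⟩
  ext π
  simp only [unicyclicPatterns, Finset.mem_filter, Finset.mem_univ, true_and,
    Finset.mem_singleton]
  constructor
  · rintro ⟨h1, h2⟩
    exact eq_bot_of_not_periodic hw hp h1 h2
  · rintro rfl
    exact ⟨consistent_bot hw, sum_edgeCount_bot hw⟩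

lemma card_unicyclicPatterns_le (hw : CycReduced w) : (unicyclicPatterns w).card ≤ k := by
  let F : ZMod k → Setoid (ZMod k) := fun g =>
    { r := fun i j => j - i ∈ AddSubgroup.zmultiples g
      iseqv :=
        { refl := fun i => by simp
          symm := fun {i j} h => by simpa using neg_mem h
          trans := fun {i j l} h h' => by simpa using add_mem h' h } }
  have hsub : unicyclicPatterns w ⊆ Finset.univ.image F := by
    intro π hπ
    simp only [unicyclicPatterns, Finset.mem_filter, Finset.mem_univ, true_and] at hπ
    obtain ⟨hc, he⟩ := hπ
    let H : AddSubgroup (ZMod k) :=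
      { carrier := {s | π 0 s}
        zero_mem' := π.refl 0
        add_mem' := fun {a b} ha hb => by
          have := (rel_add hw hc he hb a).1
          rw [zero_add, add_comm] at this
          exact π.trans ha this
        neg_mem' := fun {a} ha => by
          have := (rel_add hw hc he ha (-a)).1
          rw [zero_add, add_neg_cancel] at this
          exact π.symm this }
    obtain ⟨g, hg⟩ := IsAddCyclic.exists_generator (α := H)
    refine Finset.mem_image.mpr ⟨g, Finset.mem_univ _, ?_⟩
    have hH : AddSubgroup.zmultiples (g : ZMod k) = H := by
      apply le_antisymm
      · rw [AddSubgroup.zmultiples_le]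
        exact g.2
      · intro x hx
        obtain ⟨z, hz⟩ := AddSubgroup.mem_zmultiples_iff.mp (hg ⟨x, hx⟩)
        exact AddSubgroup.mem_zmultiples_iff.mpr ⟨z, by simpa using congrArg Subtype.val hz⟩
    ext i j
    change j - i ∈ AddSubgroup.zmultiples (g : ZMod k) ↔ π i j
    rw [hH]
    change π 0 (j - i) ↔ π i j
    constructor
    · intro h
      simpa using (rel_add hw hc he h i).1
    · intro h
      simpa [sub_eq_add_neg] using (rel_add hw hc he h (-i)).1
  calc (unicyclicPatterns w).card ≤ (Finset.univ.image F).card := Finset.card_le_card hsub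
    _ ≤ Fintype.card (ZMod k) := Finset.card_image_le
    _ = k := ZMod.card k

end Pattern

open Polynomial

/-- The polynomial `∏ (1 - j X)` over `a ≤ j < b`. -/
noncomputable def fallPoly (a b : ℕ) : ℝ[X] := ∏ j ∈ Finset.Ico a b, (1 - C (j : ℝ) * X)

lemma natDegree_fallPoly_le (a b : ℕ) : (fallPoly a b).natDegree ≤ b - a := by
  refine (natDegree_prod_le _ _).trans ?_
  have : ∀ j ∈ Finset.Ico a b, (1 - C (j : ℝ) * X).natDegree ≤ 1 := by
    intro j _
    compute_degree
  refine (Finset.sum_le_sum this).trans ?_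
  simp

@[simp] lemma eval_zero_fallPoly (a b : ℕ) : (fallPoly a b).eval 0 = 1 := by
  simp [fallPoly, eval_prod]

lemma fallPoly_mul {a b c : ℕ} (hab : a ≤ b) (hbc : b ≤ c) :
    fallPoly a b * fallPoly b c = fallPoly a c :=
  Finset.prod_Ico_consecutive _ hab hbc

lemma descFactorial_eq {N : ℕ} (hN : 0 < N) (V : ℕ) (hV : V ≤ N) :
    (N.descFactorial V : ℝ) = N ^ V * (fallPoly 0 V).eval (1 / (N : ℝ)) := by
  have hN' : (N : ℝ) ≠ 0 := by positivity
  induction V with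
  | zero => simp [fallPoly]
  | succ V ih =>
    rw [Nat.descFactorial_succ, Nat.cast_mul, ih (by omega), Nat.cast_sub (by omega),
      ← fallPoly_mul (Nat.zero_le V) (Nat.le_succ V), eval_mul]
    simp [fallPoly]
    field_simp
    ring

lemma factorial_eq {N : ℕ} (hN : 0 < N) {e : ℕ} (he : e ≤ N) :
    (N.factorial : ℝ) =
      (N - e).factorial * (N ^ e * (fallPoly 0 e).eval (1 / (N : ℝ))) := by
  rw [← descFactorial_eq hN e he, ← Nat.cast_mul, Nat.factorial_mul_descFactorial he]

section Pattern

variable {m k : ℕ} [NeZero k] {w : ZMod k → Letter m}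

/-- The contribution of a pattern to the expected number of closed walks. -/
noncomputable def patternPoly (n : ℕ) (w : ZMod k → Letter m) (π : Setoid (ZMod k)) : ℝ[X] :=
  X ^ (1 + ∑ i, edgeCount w π i - Fintype.card (Quotient π)) *
    (fallPoly 0 (Fintype.card (Quotient π)) * ∏ i, fallPoly (edgeCount w π i) n)

/-- The numerator of the expected number of closed walks as a rational function of `1 / N`. -/
noncomputable def closedPoly (n : ℕ) (w : ZMod k → Letter m) : ℝ[X] :=
  ∑ π ∈ Finset.univ.filter (Consistent w), patternPoly n w π

lemma edgeCount_le (π : Setoid (ZMod k)) (i : Fin m) : edgeCount w π i ≤ k := by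
  unfold edgeCount
  refine Finset.card_image_le.trans ((Finset.card_le_univ _).trans ?_)
  rw [ZMod.card]

lemma card_quotient_le_card (π : Setoid (ZMod k)) : Fintype.card (Quotient π) ≤ k := by
  have := Fintype.card_quotient_le π
  rwa [ZMod.card] at this

lemma natDegree_closedPoly_le {n : ℕ} (hkn : k ≤ n) (hw : CycReduced w) :
    (closedPoly n w).natDegree ≤ m * n + 1 := by
  refine natDegree_sum_le_of_forall_le _ _ fun π hπ => ?_
  have hV := card_quotient_le hw (Finset.mem_filter.mp hπ).2
  have h1 : (∏ i, fallPoly (edgeCount w π i) n).natDegree ≤ ∑ i, (n - edgeCount w π i) :=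
    (natDegree_prod_le _ _).trans (Finset.sum_le_sum fun i _ => natDegree_fallPoly_le _ _)
  have h2 : ∑ i, (n - edgeCount w π i) + ∑ i, edgeCount w π i = m * n := by
    rw [← Finset.sum_add_distrib, Finset.sum_congr rfl fun i _ =>
      Nat.sub_add_cancel ((edgeCount_le π i).trans hkn)]
    simp
  have h3 := natDegree_fallPoly_le 0 (Fintype.card (Quotient π))
  unfold patternPoly
  refine natDegree_mul_le.trans ?_
  rw [natDegree_X_pow]
  have h4 := natDegree_mul_le (p := fallPoly 0 (Fintype.card (Quotient π)))
    (q := ∏ i, fallPoly (edgeCount w π i) n)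
  omega

lemma eval_zero_closedPoly (n : ℕ) (hw : CycReduced w) : (closedPoly n w).eval 0 = 0 := by
  rw [closedPoly, eval_finsetSum]
  refine Finset.sum_eq_zero fun π hπ => ?_
  have hV := card_quotient_le hw (Finset.mem_filter.mp hπ).2
  rw [patternPoly, eval_mul, eval_pow, eval_X, zero_pow (by omega), zero_mul]

lemma eval_zero_derivative_closedPoly (n : ℕ) (hw : CycReduced w) :
    (closedPoly n w).derivative.eval 0 = (unicyclicPatterns w).card := by
  rw [closedPoly, derivative_sum, eval_finsetSum, unicyclicPatterns, Finset.card_filter]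
  push_cast
  refine Finset.sum_congr rfl fun π hπ => ?_
  have hV := card_quotient_le hw (Finset.mem_filter.mp hπ).2
  have h1 : (fallPoly 0 (Fintype.card (Quotient π)) *
      ∏ i, fallPoly (edgeCount w π i) n).eval 0 = 1 := by
    simp [eval_prod]
  rw [patternPoly]
  generalize fallPoly 0 (Fintype.card (Quotient π)) *
    ∏ i, fallPoly (edgeCount w π i) n = P at h1 ⊢
  rw [derivative_mul, eval_add, eval_mul, eval_mul, h1, derivative_X_pow]
  split_ifs with h
  · simp [h]
  · have h2 : 1 + ∑ i, edgeCount w π i - Fintype.card (Quotient π) - 1 ≠ 0 := by omega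
    have h3 : 1 + ∑ i, edgeCount w π i - Fintype.card (Quotient π) ≠ 0 := by omega
    simp [h2, h3]

lemma eval_closedPoly {n N : ℕ} (hkn : k ≤ n) (hnN : n ≤ N) (hN : 0 < N) (hw : CycReduced w) :
    (closedPoly n w).eval (1 / (N : ℝ)) =
      (∑ σ : Fin m → Equiv.Perm (Fin N), (closedCount w σ : ℝ)) / (N * (N.factorial : ℝ) ^ m) *
        ((fallPoly 0 n) ^ m).eval (1 / (N : ℝ)) := by
  have hN' : (N : ℝ) ≠ 0 := by positivity
  have hs := sum_closedCount w (V := Fin N)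
  rw [← Nat.cast_sum, hs, closedPoly, eval_finsetSum, Nat.cast_sum, Finset.sum_div,
    Finset.sum_mul]
  refine Finset.sum_congr rfl fun π hπ => ?_
  have hV := card_quotient_le hw (Finset.mem_filter.mp hπ).2
  have hVk := card_quotient_le_card π
  rw [Fintype.card_fin, Nat.cast_mul, descFactorial_eq hN _ (by omega), patternPoly]
  set x := 1 / (N : ℝ) with hx
  set V := Fintype.card (Quotient π)
  have h1 : ∀ i, ((N - edgeCount w π i).factorial : ℝ) * (fallPoly 0 n).eval x =
      N.factorial * (x ^ edgeCount w π i * (fallPoly (edgeCount w π i) n).eval x) := by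
    intro i
    have he := edgeCount_le (w := w) π i
    rw [factorial_eq hN (he.trans (hkn.trans hnN)),
      ← fallPoly_mul (Nat.zero_le _) (he.trans hkn), eval_mul, ← hx]
    have : (N : ℝ) ^ edgeCount w π i * x ^ edgeCount w π i = 1 := by
      rw [← mul_pow, hx, mul_one_div_cancel hN', one_pow]
    linear_combination (-((N - edgeCount w π i).factorial : ℝ)
      * (fallPoly 0 (edgeCount w π i)).eval x * (fallPoly (edgeCount w π i) n).eval x) * this
  have h2 : ((∏ i, (N - edgeCount w π i).factorial : ℕ) : ℝ) * ((fallPoly 0 n) ^ m).eval x =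
      (N.factorial : ℝ) ^ m * (x ^ (∑ i, edgeCount w π i) *
        ∏ i, (fallPoly (edgeCount w π i) n).eval x) := by
    have e1 : ((fallPoly 0 n) ^ m).eval x = ∏ _i : Fin m, (fallPoly 0 n).eval x := by simp
    rw [e1, Nat.cast_prod, ← Finset.prod_mul_distrib, Finset.prod_congr rfl fun i _ => h1 i,
      Finset.prod_mul_distrib, Finset.prod_mul_distrib, Finset.prod_pow_eq_pow_sum]
    simp
  have h3 : x ^ (1 + ∑ i, edgeCount w π i - V) = x * x ^ (∑ i, edgeCount w π i) * N ^ V := by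
    have : x ^ V * (N : ℝ) ^ V = 1 := by
      rw [← mul_pow, hx, one_div_mul_cancel hN', one_pow]
    calc x ^ (1 + ∑ i, edgeCount w π i - V)
        = x ^ (1 + ∑ i, edgeCount w π i - V) * (x ^ V * (N : ℝ) ^ V) := by rw [this, mul_one]
      _ = x ^ (1 + ∑ i, edgeCount w π i - V + V) * N ^ V := by rw [pow_add]; ring
      _ = x ^ (1 + ∑ i, edgeCount w π i) * N ^ V := by rw [Nat.sub_add_cancel (by omega)]
      _ = _ := by rw [pow_add, pow_one]
  have hfac : (N.factorial : ℝ) ^ m ≠ 0 := by positivity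
  have hxN : x * N = 1 := one_div_mul_cancel hN'
  clear_value x
  rw [eval_mul, eval_mul, eval_pow, eval_X, h3, eval_prod, div_mul_eq_mul_div,
    eq_div_iff (by positivity)]
  linear_combination (x ^ (∑ i, edgeCount w π i) * (N : ℝ) ^ V * (fallPoly 0 V).eval x *
    (∏ i, (fallPoly (edgeCount w π i) n).eval x) * (N.factorial : ℝ) ^ m) * hxN -
    (N : ℝ) ^ V * (fallPoly 0 V).eval x * h2

end Pattern

open Polynomial

section Fix

variable {m : ℕ}

/-- The number of fixed points of the permutation attached to a word. -/
noncomputable def fixCount {V : Type*} [Fintype V] [DecidableEq V] (σ : Fin m → Equiv.Perm V)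
    (w : List (Letter m)) : ℕ :=
  (Finset.univ.filter (fun v => run σ w v = v)).card

/-- The cyclic word attached to the nonempty list `a :: l`. -/
def cyc (a : Letter m) (l : List (Letter m)) (t : ZMod (l.length + 1)) : Letter m :=
  (a :: l)[t.val]'(ZMod.val_lt t)

lemma cyc_natCast (a : Letter m) (l : List (Letter m)) {t : ℕ} (ht : t < (a :: l).length) :
    cyc a l (t : ZMod (l.length + 1)) = (a :: l)[t] := by
  have : (t : ZMod (l.length + 1)).val = t := ZMod.val_cast_of_lt ht
  simp only [cyc, this]

lemma run_take_succ {V : Type*} (σ : Fin m → Equiv.Perm V) (w : List (Letter m)) {t : ℕ}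
    (ht : t < w.length) (v : V) :
    run σ (w.take (t + 1)) v = step σ w[t] (run σ (w.take t) v) := by
  rw [List.take_succ_eq_append_getElem ht, run_append]
  simp

lemma closedCount_cyc {V : Type*} [Fintype V] [DecidableEq V] (σ : Fin m → Equiv.Perm V)
    (a : Letter m) (l : List (Letter m)) :
    closedCount (cyc a l) σ = fixCount σ (a :: l) := by
  have key : ∀ u : ZMod (l.length + 1) → V, (∀ j, step σ (cyc a l j) (u j) = u (j + 1)) →
      ∀ t : ℕ, t ≤ (a :: l).length → u t = run σ ((a :: l).take t) (u 0) := by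
    intro u hu t
    induction t with
    | zero => simp
    | succ t ih =>
      intro ht
      rw [run_take_succ σ _ (by omega), ← ih (by omega), ← cyc_natCast a l (by omega), hu]
      push_cast
      rfl
  unfold closedCount fixCount
  refine Finset.card_bij (fun u _ => u 0) ?_ ?_ ?_
  · intro u hu
    rw [Finset.mem_filter] at hu ⊢
    refine ⟨Finset.mem_univ _, ?_⟩
    have := key u hu.2 _ le_rfl
    rw [List.take_length] at this
    rw [← this]
    congr 1
    simp
  · intro u hu u' hu' h
    rw [Finset.mem_filter] at hu hu'
    funext t
    have hv := (ZMod.val_lt t).le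
    rw [← ZMod.natCast_zmod_val t, key u hu.2 _ hv, key u' hu'.2 _ hv, h]
  · intro v hv
    rw [Finset.mem_filter] at hv
    refine ⟨fun t => run σ ((a :: l).take t.val) v, ?_, by simp⟩
    rw [Finset.mem_filter]
    refine ⟨Finset.mem_univ _, fun t => ?_⟩
    have ht : t.val < (a :: l).length := ZMod.val_lt t
    rw [cyc, ← run_take_succ σ _ ht]
    beta_reduce
    rcases Nat.lt_or_ge (t.val + 1) (l.length + 1) with h | h
    · have : (t + 1).val = t.val + 1 := by
        conv_lhs => rw [← ZMod.natCast_zmod_val t]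
        rw [← Nat.cast_add_one, ZMod.val_cast_of_lt h]
      rw [this]
    · have h1 : t.val + 1 = l.length + 1 := by simp at ht; omega
      have : t + 1 = 0 := by
        rw [← ZMod.natCast_zmod_val t, ← Nat.cast_add_one, h1, ZMod.natCast_self]
      rw [this, h1]
      have h2 := hv.2
      have h3 : (a :: l).take (l.length + 1) = a :: l := List.take_of_length_le (by simp)
      rw [h3, h2]
      simp

lemma cycReduced_cyc {a : Letter m} {l : List (Letter m)} (h : Reduced (a :: l))
    (hl : a ≠ linv ((a :: l).getLast (by simp))) : CycReduced (cyc a l) := by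
  intro t
  have ht : t.val < (a :: l).length := ZMod.val_lt t
  rcases Nat.lt_or_ge (t.val + 1) (l.length + 1) with h1 | h1
  · have h2 : t + 1 = ((t.val + 1 : ℕ) : ZMod (l.length + 1)) := by
      rw [Nat.cast_add_one, ZMod.natCast_zmod_val]
    rw [h2, cyc_natCast a l h1, cyc]
    exact List.isChain_iff_getElem.mp h _ h1
  · have h1 : t.val + 1 = l.length + 1 := by simp at ht; omega
    have h2 : t + 1 = 0 := by
      rw [← ZMod.natCast_zmod_val t, ← Nat.cast_add_one, h1, ZMod.natCast_self]
    rw [h2]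
    have h3 : cyc a l 0 = a := by simp [cyc]
    have h4 : cyc a l t = (a :: l).getLast (by simp) := by
      rw [List.getLast_eq_getElem]
      simp only [cyc]
      congr 1
      simp; omega
    rw [h3, h4]
    exact hl

/-- Words whose cyclically reduced core is a proper power. -/
def Bad (w : List (Letter m)) : Prop :=
  ∃ i s, 0 < s ∧ 2 * (i + s) ≤ w.length ∧
    (∀ t, i + s ≤ t → t + i < w.length → w[t]? = w[t - s]?) ∧
    ∀ t < i, w[w.length - 1 - t]? = (w[t]?).map linv

lemma bad_of_periodic {a : Letter m} {l : List (Letter m)} (h : Periodic (cyc a l)) :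
    Bad (a :: l) := by
  obtain ⟨s, hs, hs2, h⟩ : ∃ s : ZMod (l.length + 1), s ≠ 0 ∧ 2 * s.val ≤ l.length + 1 ∧
      ∀ t, cyc a l (t + s) = cyc a l t := by
    obtain ⟨s, hs, h⟩ := h
    rcases Nat.lt_or_ge (l.length + 1) (2 * s.val) with h1 | h1
    · refine ⟨-s, neg_ne_zero.mpr hs, ?_, fun t => ?_⟩
      · have : NeZero s := ⟨hs⟩
        rw [ZMod.val_neg_of_ne_zero]
        omega
      · rw [← h]; simp
    · exact ⟨s, hs, h1, h⟩
  refine ⟨0, s.val, ZMod.val_pos.mpr hs, by simpa using hs2, fun t ht htl => ?_, by simp⟩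
  simp only [zero_add, add_zero] at ht htl
  have h1 := h ((t - s.val : ℕ) : ZMod (l.length + 1))
  have h2 : ((t - s.val : ℕ) : ZMod (l.length + 1)) + s = (t : ℕ) := by
    conv_lhs => rw [← ZMod.natCast_zmod_val s]
    rw [← Nat.cast_add, ZMod.natCast_zmod_val, Nat.sub_add_cancel ht]
  rw [h2, cyc_natCast a l htl, cyc_natCast a l (by omega)] at h1
  rw [List.getElem?_eq_getElem htl, List.getElem?_eq_getElem (by omega), h1]

lemma fixCount_conj {V : Type*} [Fintype V] [DecidableEq V] (σ : Fin m → Equiv.Perm V)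
    (a : Letter m) (w : List (Letter m)) :
    fixCount σ (a :: w ++ [linv a]) = fixCount σ w := by
  unfold fixCount
  refine Finset.card_bij (fun v _ => step σ a v) ?_ ?_ ?_
  · intro v hv
    simp only [List.cons_append, run_cons, run_append, run_nil, Finset.mem_filter,
      Finset.mem_univ, true_and] at hv ⊢
    apply (step σ (linv a)).injective
    rw [hv, step_linv_step]
  · intro v _ v' _ h
    exact (step σ a).injective h
  · intro v hv
    refine ⟨step σ (linv a) v, ?_, by simp⟩
    simp only [List.cons_append, run_cons, run_append, run_nil, Finset.mem_filter,
      Finset.mem_univ, true_and, step_step_linv] at hv ⊢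
    rw [hv]

lemma Bad.conj {w : List (Letter m)} (h : Bad w) (a : Letter m) :
    Bad (a :: w ++ [linv a]) := by
  obtain ⟨i, s, hs, hl, h1, h2⟩ := h
  have hlen : (a :: w ++ [linv a]).length = w.length + 2 := by simp
  have hget : ∀ t, t < w.length → (a :: w ++ [linv a])[t + 1]? = w[t]? := by
    intro t ht
    rw [List.cons_append, List.getElem?_cons_succ, List.getElem?_append_left ht]
  refine ⟨i + 1, s, hs, by omega, fun t ht ht' => ?_, fun t ht => ?_⟩
  · rw [hlen] at ht'
    obtain ⟨t, rfl⟩ : ∃ t', t = t' + 1 := ⟨t - 1, by omega⟩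
    rw [hget t (by omega), h1 t (by omega) (by omega), ← hget (t - s) (by omega)]
    congr 1
    omega
  · rw [hlen]
    rcases t with _ | t
    · simp
    · rw [hget t (by omega), ← h2 t (by omega), ← hget _ (by omega)]
      congr 1
      omega

lemma exists_fixPoly {n : ℕ} (w : List (Letter m)) (hw : Reduced w) (hne : w ≠ [])
    (hn : w.length ≤ n) :
    ∃ f : ℝ[X], f.natDegree ≤ m * n + 1 ∧ f.eval 0 = 0 ∧
      |f.derivative.eval 0 - 1| ≤ n ∧ (¬ Bad w → f.derivative.eval 0 = 1) ∧
      ∀ N : ℕ, n ≤ N → 0 < N → f.eval (1 / (N : ℝ)) =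
        (∑ σ : Fin m → Equiv.Perm (Fin N), (fixCount σ w : ℝ)) / (N * (N.factorial : ℝ) ^ m) *
          ((fallPoly 0 n) ^ m).eval (1 / (N : ℝ)) := by
  induction hL : w.length using Nat.strong_induction_on generalizing w with
  | _ L ih =>
  obtain ⟨a, l, rfl⟩ : ∃ a l, w = a :: l := List.exists_cons_of_ne_nil hne
  by_cases hl : a = linv ((a :: l).getLast (by simp))
  · have hlne : l ≠ [] := by
      rintro rfl
      simp only [List.getLast_singleton] at hl
      exact linv_ne a hl.symm
    obtain ⟨w', b, rfl⟩ : ∃ w' b, l = w' ++ [b] :=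
      ⟨l.dropLast, l.getLast hlne, (List.dropLast_append_getLast hlne).symm⟩
    have hb : b = linv a := by
      rw [hl]
      simp
    subst hb
    have hw' : Reduced w' := hw.of_infix ⟨[a], [linv a], by simp⟩
    have hne' : w' ≠ [] := by
      rintro rfl
      simp [reduced_cons_cons] at hw
    obtain ⟨f, h1, h2, h3, h4, h5⟩ := ih w'.length (by rw [← hL]; simp) w' hw' hne'
      (by simp at hn; omega) rfl
    refine ⟨f, h1, h2, h3, fun hB => h4 fun hB' => hB (hB'.conj a), fun N hnN hN => ?_⟩
    rw [h5 N hnN hN]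
    simp_rw [← List.cons_append, fixCount_conj]
  · have hcyc := cycReduced_cyc hw hl
    have hk : l.length + 1 ≤ n := hn
    refine ⟨closedPoly n (cyc a l), natDegree_closedPoly_le hk hcyc, eval_zero_closedPoly n hcyc,
      ?_, fun hB => ?_, fun N hnN hN => ?_⟩
    · rw [eval_zero_derivative_closedPoly n hcyc, abs_le]
      have h1 : ((unicyclicPatterns (cyc a l)).card : ℝ) ≤ n := by
        exact_mod_cast (card_unicyclicPatterns_le hcyc).trans hk
      have h2 : (1 : ℝ) ≤ n := by exact_mod_cast (by omega : 1 ≤ n)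
      have h3 : (0 : ℝ) ≤ ((unicyclicPatterns (cyc a l)).card : ℝ) := by positivity
      constructor <;> linarith
    · rw [eval_zero_derivative_closedPoly n hcyc,
        card_unicyclicPatterns_of_not_periodic hcyc fun hp => hB (bad_of_periodic hp)]
      simp
    · rw [eval_closedPoly hk hnN hN hcyc]
      simp_rw [closedCount_cyc]

lemma card_redWords_le_pow (hm : 0 < m) (k : ℕ) :
    (redWords m k).card ≤ 2 * (2 * m - 1) ^ k := by
  rcases k with _ | k
  · simp [redWords_zero]
  · rw [card_redWords_le, pow_succ, mul_comm (_ ^ k), ← mul_assoc]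
    exact Nat.mul_le_mul_right _ (by omega)

lemma card_bad_le (hm : 0 < m) (k : ℕ) :
    ((redWords m k).filter Bad).card ≤ (k + 1) ^ 2 * (2 * (2 * m - 1) ^ (k / 2)) := by
  have hB : ∀ w : List (Letter m), ∃ p : ℕ × ℕ, Bad w → 0 < p.2 ∧ 2 * (p.1 + p.2) ≤ w.length ∧
      (∀ t, p.1 + p.2 ≤ t → t + p.1 < w.length → w[t]? = w[t - p.2]?) ∧
      ∀ t < p.1, w[w.length - 1 - t]? = (w[t]?).map linv := by
    intro w
    by_cases h : Bad w
    · obtain ⟨i, s, h⟩ := h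
      exact ⟨(i, s), fun _ => h⟩
    · exact ⟨(0, 0), fun h' => absurd h' h⟩
  choose p hp using hB
  have hcard : ((Finset.range (k + 1) ×ˢ Finset.range (k + 1)) ×ˢ redWords m (k / 2)).card ≤
      (k + 1) ^ 2 * (2 * (2 * m - 1) ^ (k / 2)) := by
    rw [Finset.card_product, Finset.card_product, Finset.card_range, sq]
    exact Nat.mul_le_mul_left _ (card_redWords_le_pow hm _)
  refine le_trans (Finset.card_le_card_of_injOn (fun w => (p w, w.take (k / 2))) ?_ ?_) hcard
  · intro w hw
    simp only [Finset.coe_filter, Set.mem_ofPred_eq, mem_redWords] at hw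
    obtain ⟨h1, h2, -, -⟩ := hp w hw.2
    have : 2 * ((p w).1 + (p w).2) ≤ k := hw.1.1 ▸ h2
    simp only [Finset.coe_product, Set.mem_prod, Finset.mem_coe, Finset.mem_range, mem_redWords]
    refine ⟨⟨by omega, by omega⟩, ?_, hw.1.2.of_infix (List.take_prefix _ _).isInfix⟩
    rw [List.length_take, hw.1.1]
    omega
  · intro w hw w' hw' hww
    simp only [Finset.coe_filter, Set.mem_ofPred_eq, mem_redWords] at hw hw'
    simp only [Prod.mk.injEq] at hww
    obtain ⟨h1, h2, h3, h4⟩ := hp w hw.2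
    obtain ⟨h1', h2', h3', h4'⟩ := hp w' hw'.2
    rw [← hww.1] at h1' h2' h3' h4'
    rw [hw.1.1] at h2 h3 h4
    rw [hw'.1.1] at h2' h3' h4'
    have hsmall : ∀ t < k / 2, w[t]? = w'[t]? := by
      intro t ht
      have := congrArg (fun l => l[t]?) hww.2
      simpa [List.getElem?_take, ht] using this
    have hmid : ∀ t, t + (p w).1 < k → w[t]? = w'[t]? := by
      intro t
      induction t using Nat.strong_induction_on with
      | _ t ih =>
      intro ht
      rcases Nat.lt_or_ge t ((p w).1 + (p w).2) with h | h
      · exact hsmall t (by omega)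
      · rw [h3 t h ht, h3' t h ht, ih (t - (p w).2) (by omega) (by omega)]
    refine List.ext_getElem? fun t => ?_
    rcases Nat.lt_or_ge t k with h | h
    · rcases Nat.lt_or_ge (t + (p w).1) k with h5 | h5
      · exact hmid t h5
      · have e : k - 1 - (k - 1 - t) = t := by omega
        have a1 := h4 (k - 1 - t) (by omega)
        have a2 := h4' (k - 1 - t) (by omega)
        rw [e] at a1 a2
        rw [a1, a2, hsmall _ (by omega)]
    · rw [List.getElem?_eq_none (by omega), List.getElem?_eq_none (by omega)]

end Fix

open Polynomial

lemma exists_chebyshev_expansion (n : ℕ) (p : ℝ[X]) (hp : p.natDegree ≤ n) :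
    ∃ a : ℕ → ℝ, p = ∑ k ∈ Finset.range (n + 1), C (a k) * Chebyshev.T ℝ k := by
  induction n generalizing p with
  | zero =>
    refine ⟨fun _ => p.coeff 0, ?_⟩
    simpa using eq_C_of_natDegree_le_zero hp
  | succ n ih =>
    have hd : (Chebyshev.T ℝ ((n + 1 : ℕ) : ℤ)).natDegree = n + 1 := by
      rw [Chebyshev.natDegree_T]; rfl
    have hl : (Chebyshev.T ℝ ((n + 1 : ℕ) : ℤ)).coeff (n + 1) ≠ 0 := by
      have h := leadingCoeff_ne_zero.mpr (ne_zero_of_natDegree_gt (n := n) (by rw [hd]; omega :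
        n < (Chebyshev.T ℝ ((n + 1 : ℕ) : ℤ)).natDegree))
      rwa [leadingCoeff, hd] at h
    set t := Chebyshev.T ℝ ((n + 1 : ℕ) : ℤ)
    obtain ⟨a, ha⟩ := ih (p - C (p.coeff (n + 1) / t.coeff (n + 1)) * t) (by
      rw [natDegree_le_iff_coeff_eq_zero]
      intro j hj
      rw [coeff_sub, coeff_C_mul]
      have hd' : t.natDegree = n + 1 := hd
      rcases (by omega : j = n + 1 ∨ n + 1 < j) with rfl | hj
      · field_simp
        simp
      · rw [coeff_eq_zero_of_natDegree_lt (by omega),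
          coeff_eq_zero_of_natDegree_lt (p := t) (n := j) (by omega)]
        simp)
    refine ⟨Function.update a (n + 1) (p.coeff (n + 1) / t.coeff (n + 1)), ?_⟩
    rw [Finset.sum_range_succ, Function.update_self, ← sub_eq_iff_eq_add, ha]
    refine Finset.sum_congr rfl fun k hk => ?_
    rw [Function.update_of_ne (by simp at hk; omega)]

lemma abs_chebyshev_coeff_le {n : ℕ} {p : ℝ[X]} {a : ℕ → ℝ}
    (h : p = ∑ k ∈ Finset.range (n + 1), C (a k) * Chebyshev.T ℝ k) {M : ℝ}
    (hM : ∀ y, |y| ≤ 1 → |p.eval y| ≤ M) {k : ℕ} (hk : k ≤ n) : |a k| ≤ 2 * M := by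
  have h1 : ∫ x, p.eval x * (Chebyshev.T ℝ k).eval x ∂Chebyshev.measureT =
      a k * ∫ x, (Chebyshev.T ℝ k).eval x * (Chebyshev.T ℝ k).eval x ∂Chebyshev.measureT := by
    have e : ∀ x, p.eval x * (Chebyshev.T ℝ k).eval x = ∑ j ∈ Finset.range (n + 1),
        a j * ((Chebyshev.T ℝ j).eval x * (Chebyshev.T ℝ k).eval x) := by
      intro x
      rw [h, eval_finsetSum, Finset.sum_mul]
      refine Finset.sum_congr rfl fun j _ => ?_
      rw [eval_mul, eval_C]
      ring
    simp_rw [e]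
    rw [MeasureTheory.integral_finsetSum]
    · simp_rw [MeasureTheory.integral_const_mul]
      rw [Finset.sum_eq_single k]
      · intro j _ hj
        rw [Chebyshev.integral_eval_T_real_mul_eval_T_real_measureT_of_ne hj, mul_zero]
      · intro hk'
        simp at hk'
        omega
    · intro j _
      exact Chebyshev.integrable_measureT (by fun_prop)
  have h2 : Real.pi / 2 ≤
      ∫ x, (Chebyshev.T ℝ k).eval x * (Chebyshev.T ℝ k).eval x ∂Chebyshev.measureT := by
    rcases eq_or_ne k 0 with rfl | hk0
    · have := Chebyshev.integral_eval_T_real_mul_self_measureT_zero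
      rw [Nat.cast_zero, this]
      linarith [Real.pi_pos]
    · rw [Chebyshev.integral_T_real_mul_self_measureT_of_ne_zero hk0]
  have h3 : |∫ x, p.eval x * (Chebyshev.T ℝ k).eval x ∂Chebyshev.measureT| ≤ M * Real.pi := by
    rw [Chebyshev.integral_measureT_eq_integral_cos, ← Real.norm_eq_abs]
    refine (intervalIntegral.norm_integral_le_of_norm_le_const (C := M) fun θ _ => ?_).trans ?_
    · rw [Real.norm_eq_abs, abs_mul, Chebyshev.T_real_cos]
      have e1 := hM (Real.cos θ) (Real.abs_cos_le_one θ)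
      have e2 := Real.abs_cos_le_one ((k : ℤ) * θ)
      exact (mul_le_of_le_one_right (abs_nonneg _) e2).trans e1
    · rw [sub_zero, abs_of_pos Real.pi_pos]
  rw [h1, abs_mul] at h3
  have h4 := h2.trans (le_abs_self _)
  have h5 := mul_le_mul_of_nonneg_left h4 (abs_nonneg (a k))
  have hpi := Real.pi_pos
  nlinarith

section Expansion

variable {m : ℕ}

/-- The spectral radius of the universal cover divided by two. -/
noncomputable def rad (m : ℕ) : ℝ := Real.sqrt (2 * m - 1)

lemma one_le_rad (hm : 0 < m) : 1 ≤ rad m := by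
  rw [rad, Real.one_le_sqrt]
  have : (1 : ℝ) ≤ m := by exact_mod_cast hm
  linarith

lemma rad_sq (hm : 0 < m) : rad m ^ 2 = 2 * m - 1 := by
  have : (1 : ℝ) ≤ m := by exact_mod_cast hm
  rw [rad, Real.sq_sqrt (by linarith)]

/-- `h` of an adjacency matrix is a combination of the non-backtracking powers with coefficients
decaying like the powers of `rad m`. -/
def WordExpansion (m n : ℕ) (M : ℝ) (h : ℝ[X]) : Prop :=
  ∃ c : ℕ → ℝ, (∀ j, |c j| * rad m ^ j ≤ M) ∧
    ∀ (N : ℕ) (σ : Fin m → Equiv.Perm (Fin N)),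
      aeval (adjMat σ) h = ∑ j ∈ Finset.range (n + 1), c j • redSum σ j

lemma WordExpansion.zero (n : ℕ) : WordExpansion m n 0 0 := ⟨0, by simp, by simp⟩

lemma WordExpansion.add {n : ℕ} {M M' : ℝ} {h h' : ℝ[X]} (H : WordExpansion m n M h)
    (H' : WordExpansion m n M' h') : WordExpansion m n (M + M') (h + h') := by
  obtain ⟨c, hc, e⟩ := H
  obtain ⟨c', hc', e'⟩ := H'
  refine ⟨c + c', fun j => ?_, fun N σ => ?_⟩
  · have h0 : (0 : ℝ) ≤ rad m ^ j := pow_nonneg (Real.sqrt_nonneg _) _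
    calc |(c + c') j| * rad m ^ j ≤ (|c j| + |c' j|) * rad m ^ j := by
          gcongr
          exact abs_add_le _ _
      _ ≤ M + M' := by rw [add_mul]; exact add_le_add (hc j) (hc' j)
  · simp [e, e', add_smul, Finset.sum_add_distrib]

lemma WordExpansion.smul {n : ℕ} {M : ℝ} {h : ℝ[X]} (H : WordExpansion m n M h) (a : ℝ) :
    WordExpansion m n (|a| * M) (C a * h) := by
  obtain ⟨c, hc, e⟩ := H
  refine ⟨fun j => a * c j, fun j => ?_, fun N σ => ?_⟩
  · rw [abs_mul, mul_assoc]
    exact mul_le_mul_of_nonneg_left (hc j) (abs_nonneg a)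
  · rw [map_mul, e, aeval_C, Algebra.algebraMap_eq_smul_one, smul_one_mul, Finset.smul_sum]
    simp [smul_smul]

lemma WordExpansion.mono {n : ℕ} {M M' : ℝ} {h : ℝ[X]} (H : WordExpansion m n M h)
    (hM : M ≤ M') : WordExpansion m n M' h := by
  obtain ⟨c, hc, e⟩ := H
  exact ⟨c, fun j => (hc j).trans hM, e⟩

lemma wordExpansion_sum {ι : Type*} (s : Finset ι) {n : ℕ} {M : ι → ℝ} {h : ι → ℝ[X]}
    (H : ∀ i ∈ s, WordExpansion m n (M i) (h i)) :
    WordExpansion m n (∑ i ∈ s, M i) (∑ i ∈ s, h i) := by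
  induction s using Finset.induction_on with
  | empty => simpa using WordExpansion.zero n
  | insert i s hi ih =>
    rw [Finset.sum_insert hi, Finset.sum_insert hi]
    exact (H i (Finset.mem_insert_self _ _)).add
      (ih fun j hj => H j (Finset.mem_insert_of_mem hj))

lemma wordExpansion_treePoly (hm : 0 < m) {n k : ℕ} (hk : k ≤ n) :
    WordExpansion m n (rad m ^ k) (treePoly (rad m ^ 2) k) := by
  refine ⟨fun j => if j ≤ k ∧ j % 2 = k % 2 then 1 else 0, fun j => ?_, fun N σ => ?_⟩
  · have h1 := one_le_rad hm
    beta_reduce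
    split_ifs with h
    · rw [abs_one, one_mul]
      exact pow_le_pow_right₀ h1 h.1
    · simp only [abs_zero, zero_mul]
      positivity
  · induction k using Nat.twoStepInduction with
    | zero =>
      rw [Finset.sum_eq_single 0]
      · simp [treePoly, redSum_zero]
      · intro j _ hj
        simp [hj]
      · simp
    | one =>
      rw [Finset.sum_eq_single 1]
      · simp [treePoly, redSum_one]
      · intro j _ hj
        beta_reduce
        rw [if_neg (by omega), zero_smul]
      · simp; omega
    | more k h1 _ =>
      rw [aeval_treePoly_add_two σ hm (rad_sq hm), h1 (by omega)]
      have : ∀ j ∈ Finset.range (n + 1),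
          (if j ≤ k + 2 ∧ j % 2 = (k + 2) % 2 then (1 : ℝ) else 0) • redSum σ j =
          (if j = k + 2 then redSum σ (k + 2) else 0) +
          (if j ≤ k ∧ j % 2 = k % 2 then (1 : ℝ) else 0) • redSum σ j := by
        intro j _
        rcases eq_or_ne j (k + 2) with rfl | hj
        · rw [if_pos (by omega), if_pos rfl, if_neg (by omega)]
          simp
        · rw [if_neg hj, zero_add]
          congr 1
          refine if_congr ?_ rfl rfl
          omega
      rw [Finset.sum_congr rfl this, Finset.sum_add_distrib, Finset.sum_ite_eq',
        if_pos (by simp; omega)]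

lemma treePoly_eq_comp {r : ℝ} (hr : r ≠ 0) (k : ℕ) :
    treePoly (r ^ 2) k = C (r ^ k) * (Chebyshev.U ℝ k).comp (C (1 / (2 * r)) * X) := by
  refine Polynomial.funext fun x => ?_
  have h := eval_treePoly r k (1 / (2 * r) * x)
  rw [eval_mul, eval_C, eval_comp, eval_mul, eval_C, eval_X, ← h]
  congr 1
  field_simp

lemma wordExpansion_U (hm : 0 < m) {n k : ℕ} (hk : k ≤ n) :
    WordExpansion m n 1 ((Chebyshev.U ℝ k).comp (C (1 / (2 * rad m)) * X)) := by
  have hr : 0 < rad m := lt_of_lt_of_le one_pos (one_le_rad hm)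
  have h := (wordExpansion_treePoly hm hk).smul (1 / rad m ^ k)
  rw [treePoly_eq_comp hr.ne', ← mul_assoc, ← C_mul, one_div_mul_cancel (by positivity), C_1,
    one_mul, abs_of_pos (by positivity), one_div_mul_cancel (by positivity)] at h
  exact h

lemma wordExpansion_T (hm : 0 < m) {n k : ℕ} (hk : k ≤ n) :
    WordExpansion m n 1 ((Chebyshev.T ℝ k).comp (C (1 / (2 * rad m)) * X)) := by
  match k with
  | 0 =>
    have := wordExpansion_U hm (Nat.zero_le n)
    simpa using this
  | 1 =>
    have h := (wordExpansion_U hm hk).smul (1 / 2)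
    have e : (Chebyshev.T ℝ ((1 : ℕ) : ℤ)) = C (1 / 2) * Chebyshev.U ℝ ((1 : ℕ) : ℤ) := by
      have h3 : (C (1 / 2 : ℝ)) * 2 = 1 := by
        rw [← C_ofNat, ← C_mul]; norm_num
      simp only [Nat.cast_one, Chebyshev.T_one, Chebyshev.U_one]
      linear_combination -X * h3
    rw [e, mul_comp, C_comp]
    exact h.mono (by norm_num [abs_of_pos])
  | k + 2 =>
    have h := ((wordExpansion_U hm hk).smul (1 / 2)).add
      ((wordExpansion_U (m := m) hm (by omega : k ≤ n)).smul (-(1 / 2)))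
    have e : (Chebyshev.T ℝ ((k + 2 : ℕ) : ℤ)) = C (1 / 2) * Chebyshev.U ℝ ((k + 2 : ℕ) : ℤ) +
        C (-(1 / 2)) * Chebyshev.U ℝ (k : ℤ) := by
      have h2 := Chebyshev.two_mul_T_eq_U_sub_U ℝ (k : ℤ)
      have h3 : (C (1 / 2 : ℝ)) * 2 = 1 := by
        rw [← C_ofNat, ← C_mul]; norm_num
      rw [C_neg]
      push_cast
      linear_combination (C (1 / 2 : ℝ)) * h2 - (Chebyshev.T ℝ (k + 2)) * h3
    rw [e, add_comp, mul_comp, mul_comp, C_comp, C_comp]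
    refine h.mono ?_
    norm_num [abs_of_pos]

/-- Polynomials that are small on the spectrum of the tree have small expansions. -/
lemma wordExpansion_of_bound (hm : 0 < m) {n : ℕ} {h : ℝ[X]} (hn : h.natDegree ≤ n) {M : ℝ}
    (hM : ∀ x, |x| ≤ 2 * rad m → |h.eval x| ≤ M) :
    WordExpansion m n (2 * M * (n + 1)) h := by
  have hr : 0 < rad m := lt_of_lt_of_le one_pos (one_le_rad hm)
  set p := h.comp (C (2 * rad m) * X) with hp
  have hpd : p.natDegree ≤ n := by
    rw [hp, natDegree_comp, natDegree_C_mul_X _ (by positivity), mul_one]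
    exact hn
  obtain ⟨a, ha⟩ := exists_chebyshev_expansion n p hpd
  have hb : ∀ k ≤ n, |a k| ≤ 2 * M := fun k hk =>
    abs_chebyshev_coeff_le ha (fun y hy => by
      rw [hp, eval_comp, eval_mul, eval_C, eval_X]
      refine hM _ ?_
      rw [abs_mul, abs_of_pos (by positivity)]
      exact mul_le_of_le_one_right (by positivity) hy) hk
  have hh : h = ∑ k ∈ Finset.range (n + 1),
      C (a k) * (Chebyshev.T ℝ k).comp (C (1 / (2 * rad m)) * X) := by
    have h1 : h = p.comp (C (1 / (2 * rad m)) * X) := by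
      rw [hp, comp_assoc]
      simp only [mul_comp, C_comp, X_comp, ← mul_assoc, ← C_mul]
      rw [mul_one_div_cancel (by positivity), C_1, one_mul, comp_X]
    rw [h1, ha, Polynomial.sum_comp]
    simp [mul_comp]
  have := wordExpansion_sum (Finset.range (n + 1))
    (fun k hk => (wordExpansion_T hm (n := n) (k := k) (by simp at hk; omega)).smul (a k))
  rw [← hh] at this
  refine this.mono ?_
  refine (Finset.sum_le_card_nsmul _ _ (2 * M) fun k hk => ?_).trans ?_
  · rw [mul_one]
    exact hb k (by simp at hk; omega)
  · simp [mul_comm]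

end Expansion

open Polynomial Matrix

section Diagonalization

variable {V : Type*} [Fintype V] [DecidableEq V]

lemma exists_orthogonal_diagonalization {B : Matrix V V ℝ} (hB : B.IsHermitian) :
    ∃ (P : Matrix V V ℝ) (μ : V → ℝ), P * Pᵀ = 1 ∧ Pᵀ * P = 1 ∧ B = P * diagonal μ * Pᵀ := by
  have h := hB.spectral_theorem
  rw [Unitary.conjStarAlgAut_apply] at h
  refine ⟨hB.eigenvectorUnitary, hB.eigenvalues, ?_, ?_, ?_⟩
  · have := Unitary.coe_mul_star_self hB.eigenvectorUnitary
    rwa [Unitary.coe_star, star_eq_conjTranspose, conjTranspose_eq_transpose_of_trivial] at this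
  · have := Unitary.coe_star_mul_self hB.eigenvectorUnitary
    rwa [star_eq_conjTranspose, conjTranspose_eq_transpose_of_trivial] at this
  · rw [star_eq_conjTranspose, conjTranspose_eq_transpose_of_trivial] at h
    exact h

lemma aeval_conj_diagonal {P : Matrix V V ℝ} {μ : V → ℝ} (h1 : P * Pᵀ = 1) (h2 : Pᵀ * P = 1)
    (h : ℝ[X]) :
    aeval (P * diagonal μ * Pᵀ) h = P * diagonal (fun i => h.eval (μ i)) * Pᵀ := by
  have hpow : ∀ k : ℕ, (P * diagonal μ * Pᵀ) ^ k = P * diagonal (fun i => μ i ^ k) * Pᵀ := by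
    intro k
    induction k with
    | zero => simp [h1]
    | succ k ih =>
      rw [pow_succ, ih]
      calc P * diagonal (fun i => μ i ^ k) * Pᵀ * (P * diagonal μ * Pᵀ)
          = P * diagonal (fun i => μ i ^ k) * (Pᵀ * P) * diagonal μ * Pᵀ := by
            simp only [Matrix.mul_assoc]
        _ = _ := by
            rw [h2, Matrix.mul_one, Matrix.mul_assoc P, diagonal_mul_diagonal]
            simp only [pow_succ]
  induction h using Polynomial.induction_on' with
  | add p q hp hq =>
    rw [map_add, hp, hq, ← Matrix.add_mul, ← Matrix.mul_add, diagonal_add]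
    simp
  | monomial k a =>
    rw [aeval_monomial, hpow, Algebra.algebraMap_eq_smul_one, smul_one_mul, ← Matrix.smul_mul,
      ← Matrix.mul_smul, ← diagonal_smul]
    simp only [eval_monomial]
    rfl

lemma trace_aeval_conj_diagonal {P : Matrix V V ℝ} {μ : V → ℝ} (h1 : P * Pᵀ = 1)
    (h2 : Pᵀ * P = 1) (h : ℝ[X]) :
    trace (aeval (P * diagonal μ * Pᵀ) h) = ∑ i, h.eval (μ i) := by
  rw [aeval_conj_diagonal h1 h2, trace_mul_comm, ← Matrix.mul_assoc, h2, Matrix.one_mul,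
    trace_diagonal]

lemma dotProduct_conj_diagonal_mulVec (P : Matrix V V ℝ) (μ : V → ℝ) (f : V → ℝ) :
    f ⬝ᵥ (P * diagonal μ * Pᵀ) *ᵥ f = ∑ i, μ i * (Pᵀ *ᵥ f) i ^ 2 := by
  rw [← mulVec_mulVec, ← mulVec_mulVec, dotProduct_mulVec, ← mulVec_transpose, dotProduct]
  refine Finset.sum_congr rfl fun i _ => ?_
  rw [mulVec_diagonal]
  ring

lemma sum_sq_transpose_mulVec {P : Matrix V V ℝ} (h1 : P * Pᵀ = 1) (f : V → ℝ) :
    ∑ i, (Pᵀ *ᵥ f) i ^ 2 = ∑ v, f v ^ 2 := by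
  have := dotProduct_conj_diagonal_mulVec P (fun _ => 1) f
  simp only [diagonal_one, Matrix.mul_one, h1, one_mulVec, one_mul] at this
  rw [← this, dotProduct]
  simp [sq]

end Diagonalization

section Centered

variable {m N : ℕ} (σ : Fin m → Equiv.Perm (Fin N))

/-- The nontrivial eigenvalues of the adjacency matrix are at most `ρ` in absolute value. -/
def SpecBound (ρ : ℝ) : Prop :=
  ∀ f : Fin N → ℝ, ∑ v, f v = 0 → |f ⬝ᵥ adjMat σ *ᵥ f| ≤ ρ * ∑ v, f v ^ 2

lemma sum_step_sq (a : Letter m) (f : Fin N → ℝ) : ∑ v, f (step σ a v) ^ 2 = ∑ v, f v ^ 2 :=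
  Equiv.sum_comp (step σ a) (fun v => f v ^ 2)

lemma specBound_degree : SpecBound σ (2 * m) := by
  intro f _
  have h : f ⬝ᵥ adjMat σ *ᵥ f = ∑ a : Letter m, ∑ v, f v * f (step σ a v) := by
    simp only [dotProduct, adjMat_mulVec, Finset.mul_sum]
    rw [Finset.sum_comm]
  rw [h]
  refine (Finset.abs_sum_le_sum_abs _ _).trans ?_
  have h2 : ∀ a : Letter m, |∑ v, f v * f (step σ a v)| ≤ ∑ v, f v ^ 2 := by
    intro a
    have e1 : ∑ v, |f v * f (step σ a v)| ≤ ∑ v, (f v ^ 2 + f (step σ a v) ^ 2) / 2 := by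
      refine Finset.sum_le_sum fun v _ => ?_
      rw [abs_mul]
      nlinarith [sq_nonneg (|f v| - |f (step σ a v)|), sq_abs (f v), sq_abs (f (step σ a v))]
    refine (Finset.abs_sum_le_sum_abs _ _).trans (e1.trans ?_)
    rw [← Finset.sum_div, Finset.sum_add_distrib, sum_step_sq]
    linarith
  refine (Finset.sum_le_sum fun a _ => h2 a).trans ?_
  simp [mul_comm]

/-- The adjacency matrix with its trivial eigenvalue removed. -/
noncomputable def centMat : Matrix (Fin N) (Fin N) ℝ :=
  adjMat σ - (2 * m / N : ℝ) • of (fun _ _ => 1)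

lemma of_one_mul_of_one : (of (fun _ _ => 1) : Matrix (Fin N) (Fin N) ℝ) * of (fun _ _ => 1) =
    (N : ℝ) • of (fun _ _ => 1) := by
  ext
  simp [mul_apply]

lemma wordMat_mul_of_one (w : List (Letter m)) :
    wordMat σ w * of (fun _ _ => 1) = of (fun _ _ => (1 : ℝ)) := by
  ext u v
  simp [wordMat, mul_apply]

lemma adjMat_mul_of_one :
    adjMat σ * of (fun _ _ => 1) = (2 * m : ℝ) • of (fun _ _ => (1 : ℝ)) := by
  rw [adjMat, Finset.sum_mul, Finset.sum_congr rfl fun a _ => wordMat_mul_of_one σ [a]]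
  ext
  simp [mul_comm, Matrix.sum_apply]

lemma of_one_isHermitian : (of (fun _ _ => (1 : ℝ)) : Matrix (Fin N) (Fin N) ℝ).IsHermitian := by
  ext
  simp

lemma of_one_mul_adjMat :
    of (fun _ _ => 1) * adjMat σ = (2 * m : ℝ) • of (fun _ _ => (1 : ℝ)) := by
  have h := congrArg transpose (adjMat_mul_of_one σ)
  have h1 := adjMat_isHermitian σ
  have h2 := of_one_isHermitian (N := N)
  unfold IsHermitian at h1 h2
  rw [conjTranspose_eq_transpose_of_trivial] at h1 h2
  rwa [transpose_mul, transpose_smul, h1, h2] at h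

lemma centMat_isHermitian : (centMat σ).IsHermitian := by
  refine (adjMat_isHermitian σ).sub ?_
  ext
  simp

lemma centMat_mul_of_one (hN : 0 < N) : centMat σ * of (fun _ _ => 1) = 0 := by
  have : (N : ℝ) ≠ 0 := by positivity
  rw [centMat, Matrix.sub_mul, adjMat_mul_of_one, Matrix.smul_mul, of_one_mul_of_one, smul_smul,
    div_mul_cancel₀ _ this, sub_self]

lemma of_one_mul_centMat (hN : 0 < N) : of (fun _ _ => 1) * centMat σ = 0 := by
  have : (N : ℝ) ≠ 0 := by positivity
  rw [centMat, Matrix.mul_sub, of_one_mul_adjMat, Matrix.mul_smul, of_one_mul_of_one, smul_smul,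
    div_mul_cancel₀ _ this, sub_self]

lemma adjMat_pow_succ (hN : 0 < N) (k : ℕ) : adjMat σ ^ (k + 1) =
    centMat σ ^ (k + 1) + ((2 * m) ^ (k + 1) / N : ℝ) • of (fun _ _ => 1) := by
  have hN' : (N : ℝ) ≠ 0 := by positivity
  have hA : adjMat σ = centMat σ + (2 * m / N : ℝ) • of (fun _ _ => 1) := by
    rw [centMat, sub_add_cancel]
  induction k with
  | zero => simpa using hA
  | succ k ih =>
    rw [pow_succ, ih, Matrix.add_mul]
    have h1 : centMat σ ^ (k + 1) * adjMat σ = centMat σ ^ (k + 2) := by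
      rw [hA, Matrix.mul_add, Matrix.mul_smul, pow_succ _ k, Matrix.mul_assoc _ _ (of _),
        centMat_mul_of_one σ hN, Matrix.mul_zero, smul_zero, add_zero, ← pow_succ, ← pow_succ]
    rw [h1, Matrix.smul_mul, of_one_mul_adjMat, smul_smul]
    congr 2
    ring

lemma trace_aeval_adjMat (hN : 0 < N) (h : ℝ[X]) :
    trace (aeval (adjMat σ) h) = trace (aeval (centMat σ) h) + h.eval (2 * m : ℝ) - h.eval 0 := by
  have hN' : (N : ℝ) ≠ 0 := by positivity
  induction h using Polynomial.induction_on' with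
  | add p q hp hq =>
    simp only [map_add, trace_add, hp, hq, eval_add]
    ring
  | monomial k a =>
    rw [aeval_monomial, aeval_monomial, Algebra.algebraMap_eq_smul_one, smul_one_mul,
      smul_one_mul, trace_smul, trace_smul, eval_monomial, eval_monomial]
    rcases k with _ | k
    · simp
    · have : trace (of (fun _ _ => 1) : Matrix (Fin N) (Fin N) ℝ) = N := by simp [trace]
      rw [adjMat_pow_succ σ hN, trace_add, trace_smul, this]
      simp only [smul_eq_mul]
      field_simp
      simp

lemma dotProduct_centMat_mulVec (hN : 0 < N) (f : Fin N → ℝ) :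
    ∃ g : Fin N → ℝ, ∑ v, g v = 0 ∧ ∑ v, g v ^ 2 ≤ ∑ v, f v ^ 2 ∧
      f ⬝ᵥ centMat σ *ᵥ f = g ⬝ᵥ adjMat σ *ᵥ g := by
  have hN' : (N : ℝ) ≠ 0 := by positivity
  set t := (∑ v, f v) / N with ht
  have hts : ∑ v, f v = N * t := by rw [ht]; field_simp
  have hsum : ∑ v, (f v - t) = 0 := by
    rw [Finset.sum_sub_distrib, hts]; simp
  refine ⟨fun v => f v - t, hsum, ?_, ?_⟩
  · have : ∑ v, (f v - t) ^ 2 = ∑ v, f v ^ 2 - N * t ^ 2 := by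
      calc ∑ v, (f v - t) ^ 2 = ∑ v, (f v ^ 2 - 2 * t * f v + t ^ 2) :=
            Finset.sum_congr rfl fun v _ => by ring
        _ = _ := by
            rw [Finset.sum_add_distrib, Finset.sum_sub_distrib, ← Finset.mul_sum, hts]
            simp
            ring
    rw [this]
    have : 0 ≤ N * t ^ 2 := by positivity
    linarith
  · have h1 : centMat σ *ᵥ f = adjMat σ *ᵥ fun v => f v - t := by
      funext v
      rw [centMat, sub_mulVec, Pi.sub_apply, adjMat_mulVec, adjMat_mulVec,
        Finset.sum_sub_distrib, smul_mulVec]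
      simp only [mulVec, dotProduct, of_apply, one_mul, Pi.smul_apply, smul_eq_mul, hts]
      simp
      field_simp
    have h2 : ∑ v, (adjMat σ *ᵥ fun v => f v - t) v = 0 := by
      simp_rw [adjMat_mulVec]
      rw [Finset.sum_comm]
      refine Finset.sum_eq_zero fun a _ => ?_
      rw [Equiv.sum_comp (step σ a) (fun v => f v - t), hsum]
    rw [h1]
    simp only [dotProduct, sub_mul, Finset.sum_sub_distrib, ← Finset.mul_sum, h2]
    simp

lemma SpecBound.centMat (hN : 0 < N) {ρ : ℝ} (hρ : 0 ≤ ρ) (h : SpecBound σ ρ) (f : Fin N → ℝ) :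
    |f ⬝ᵥ centMat σ *ᵥ f| ≤ ρ * ∑ v, f v ^ 2 := by
  obtain ⟨g, h1, h2, h3⟩ := dotProduct_centMat_mulVec σ hN f
  rw [h3]
  exact (h g h1).trans (mul_le_mul_of_nonneg_left h2 hρ)

lemma exists_eigenvalues (hN : 0 < N) : ∃ μ : Fin N → ℝ, (∀ i, |μ i| ≤ 2 * m) ∧
    (∀ h : ℝ[X], h.eval 0 = 0 →
      trace (aeval (adjMat σ) h) - h.eval (2 * m : ℝ) = ∑ i, h.eval (μ i)) ∧
    ∀ ρ : ℝ, (∀ i, |μ i| ≤ ρ) → SpecBound σ ρ := by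
  obtain ⟨P, μ, h1, h2, h3⟩ := exists_orthogonal_diagonalization (centMat_isHermitian σ)
  refine ⟨μ, fun i => ?_, fun h h0 => ?_, fun ρ hρ f hf => ?_⟩
  · have h4 := (specBound_degree σ).centMat σ hN (by positivity) (P *ᵥ Pi.single i 1)
    rw [h3, dotProduct_conj_diagonal_mulVec, ← sum_sq_transpose_mulVec h1, mulVec_mulVec, h2,
      one_mulVec] at h4
    simpa [Pi.single_apply] using h4
  · rw [trace_aeval_adjMat σ hN, h0, h3, trace_aeval_conj_diagonal h1 h2]
    ring
  · have h4 : f ⬝ᵥ adjMat σ *ᵥ f = f ⬝ᵥ centMat σ *ᵥ f := by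
      have : (of (fun _ _ => (1 : ℝ)) : Matrix (Fin N) (Fin N) ℝ) *ᵥ f = 0 := by
        funext v
        simpa [mulVec, dotProduct] using hf
      rw [centMat, sub_mulVec, smul_mulVec, this, smul_zero, sub_zero]
    rw [h4, h3, dotProduct_conj_diagonal_mulVec, ← sum_sq_transpose_mulVec h1, Finset.mul_sum]
    refine (Finset.abs_sum_le_sum_abs _ _).trans (Finset.sum_le_sum fun i _ => ?_)
    rw [abs_mul, abs_of_nonneg (sq_nonneg ((Pᵀ *ᵥ f) i))]
    exact mul_le_mul_of_nonneg_right (hρ i) (sq_nonneg _)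

lemma abs_trace_sub_le (hN : 0 < N) {h : ℝ[X]} (h0 : h.eval 0 = 0) {H : ℝ}
    (hH : ∀ x : ℝ, |x| ≤ 2 * m → |h.eval x| ≤ H) :
    |trace (aeval (adjMat σ) h) - h.eval (2 * m : ℝ)| ≤ N * H := by
  obtain ⟨μ, h1, h2, -⟩ := exists_eigenvalues σ hN
  rw [h2 h h0]
  refine (Finset.abs_sum_le_sum_abs _ _).trans ?_
  refine (Finset.sum_le_sum fun i _ => hH _ (h1 i)).trans ?_
  simp

lemma trace_sub_nonneg (hN : 0 < N) {h : ℝ[X]} (h0 : h.eval 0 = 0)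
    (hpos : ∀ x : ℝ, |x| ≤ 2 * m → 0 ≤ h.eval x) :
    0 ≤ trace (aeval (adjMat σ) h) - h.eval (2 * m : ℝ) := by
  obtain ⟨μ, h1, h2, -⟩ := exists_eigenvalues σ hN
  rw [h2 h h0]
  exact Finset.sum_nonneg fun i _ => hpos _ (h1 i)

lemma le_trace_sub_of_not_specBound (hN : 0 < N) {h : ℝ[X]} (h0 : h.eval 0 = 0)
    (hpos : ∀ x : ℝ, |x| ≤ 2 * m → 0 ≤ h.eval x) {ρ t : ℝ}
    (ht : ∀ x : ℝ, ρ ≤ |x| → |x| ≤ 2 * m → t ≤ h.eval x) (hσ : ¬ SpecBound σ ρ) :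
    t ≤ trace (aeval (adjMat σ) h) - h.eval (2 * m : ℝ) := by
  obtain ⟨μ, h1, h2, h3⟩ := exists_eigenvalues σ hN
  obtain ⟨i, hi⟩ : ∃ i, ρ < |μ i| := by
    by_contra! hcon
    exact hσ (h3 ρ hcon)
  rw [h2 h h0]
  exact (ht _ hi.le (h1 i)).trans
    (Finset.single_le_sum (f := fun i => h.eval (μ i)) (fun i _ => hpos _ (h1 i))
      (Finset.mem_univ i))

end Centered

open Polynomial Matrix

section FallEstimates

lemma abs_derivative_fallPoly_le (n : ℕ) :
    |(fallPoly 0 n).derivative.eval 0| ≤ (n : ℝ) ^ 2 := by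
  induction n with
  | zero => simp [fallPoly]
  | succ n ih =>
    have h : fallPoly 0 (n + 1) = fallPoly 0 n * (1 - C (n : ℝ) * X) := by
      rw [fallPoly, fallPoly, Finset.prod_Ico_succ_top (Nat.zero_le n)]
    have e : (fallPoly 0 (n + 1)).derivative.eval 0 = (fallPoly 0 n).derivative.eval 0 - n := by
      rw [h]
      simp [derivative_mul]
      ring
    rw [e]
    refine (abs_sub _ _).trans ?_
    rw [Nat.abs_cast]
    push_cast
    nlinarith [(Nat.cast_nonneg n : (0 : ℝ) ≤ n)]

lemma eval_inv_fallPoly_mem (n : ℕ) {N : ℕ} (hn : n ≤ N) (hN : 0 < N) :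
    1 - (n : ℝ) ^ 2 / N ≤ (fallPoly 0 n).eval (1 / (N : ℝ)) ∧
      0 ≤ (fallPoly 0 n).eval (1 / (N : ℝ)) ∧ (fallPoly 0 n).eval (1 / (N : ℝ)) ≤ 1 := by
  have hN' : (0 : ℝ) < N := by exact_mod_cast hN
  induction n with
  | zero => simp [fallPoly]
  | succ n ih =>
    obtain ⟨h1, h2, h3⟩ := ih (by omega)
    have h : fallPoly 0 (n + 1) = fallPoly 0 n * (1 - C (n : ℝ) * X) := by
      rw [fallPoly, fallPoly, Finset.prod_Ico_succ_top (Nat.zero_le n)]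
    have h4 : (n : ℝ) / N ≤ 1 := by
      rw [div_le_one hN']
      exact_mod_cast (by omega : n ≤ N)
    have h5 : 0 ≤ (n : ℝ) / N := by positivity
    rw [h, eval_mul]
    set F := (fallPoly 0 n).eval (1 / (N : ℝ))
    have e : eval (1 / (N : ℝ)) (1 - C (n : ℝ) * X) = 1 - n / N := by
      simp [div_eq_mul_inv]
    rw [e]
    refine ⟨?_, mul_nonneg h2 (by linarith), by nlinarith⟩
    have h6 : ((n + 1 : ℕ) : ℝ) ^ 2 / N = (n : ℝ) ^ 2 / N + 2 * (n / N) + 1 / N := by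
      push_cast
      field_simp
      ring
    have h7 : 0 ≤ 1 / (N : ℝ) := by positivity
    rw [h6]
    nlinarith

lemma half_le_eval_inv_fallPoly_pow {m n N : ℕ} (hn : n ≤ N) (hN : 0 < N)
    (h : 2 * m * n ^ 2 ≤ N) : 1 / 2 ≤ ((fallPoly 0 n) ^ m).eval (1 / (N : ℝ)) ∧
      ((fallPoly 0 n) ^ m).eval (1 / (N : ℝ)) ≤ 1 := by
  obtain ⟨h1, h2, h3⟩ := eval_inv_fallPoly_mem n hn hN
  rw [eval_pow]
  refine ⟨?_, pow_le_one₀ h2 h3⟩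
  have h4 := one_add_mul_le_pow (a := (fallPoly 0 n).eval (1 / (N : ℝ)) - 1) (by linarith) m
  rw [add_sub_cancel] at h4
  refine le_trans ?_ h4
  have hN' : (0 : ℝ) < N := by exact_mod_cast hN
  have h5 : (m : ℝ) * (n ^ 2 / N) ≤ 1 / 2 := by
    rw [← mul_div_assoc, div_le_iff₀ hN']
    have : (2 * m * n ^ 2 : ℝ) ≤ N := by exact_mod_cast h
    linarith
  nlinarith [(Nat.cast_nonneg m : (0 : ℝ) ≤ m)]

end FallEstimates

section TracePoly

variable {m : ℕ}

lemma trace_wordMat {N : ℕ} (σ : Fin m → Equiv.Perm (Fin N)) (w : List (Letter m)) :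
    trace (wordMat σ w) = fixCount σ w := by
  simp [trace, wordMat, fixCount]

lemma trace_redSum {N : ℕ} (σ : Fin m → Equiv.Perm (Fin N)) (j : ℕ) :
    trace (redSum σ j) = ∑ w ∈ redWords m j, (fixCount σ w : ℝ) := by
  simp only [redSum, trace_sum, trace_wordMat]

lemma eval_degree_of_expansion {n : ℕ} {h : ℝ[X]} {c : ℕ → ℝ}
    (hc : ∀ (N : ℕ) (σ : Fin m → Equiv.Perm (Fin N)),
      aeval (adjMat σ) h = ∑ j ∈ Finset.range (n + 1), c j • redSum σ j) :
    h.eval (2 * m : ℝ) = ∑ j ∈ Finset.range (n + 1), c j * (redWords m j).card := by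
  have h1 := hc 1 (fun _ => 1)
  have hA : adjMat (V := Fin 1) (fun _ : Fin m => 1) =
      algebraMap ℝ (Matrix (Fin 1) (Fin 1) ℝ) (2 * m : ℝ) := by
    ext u v
    have : u = v := Subsingleton.elim _ _
    subst this
    simp [adjMat, Matrix.sum_apply, wordMat, Matrix.algebraMap_matrix_apply,
      eq_iff_true_of_subsingleton]
    ring
  rw [hA, aeval_algebraMap_apply] at h1
  have h2 := congrFun (congrFun h1 0) 0
  simpa [Matrix.algebraMap_matrix_apply, Matrix.sum_apply, redSum, wordMat,
    eq_iff_true_of_subsingleton, coe_aeval_eq_eval] using h2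

lemma fixCount_nil {N : ℕ} (σ : Fin m → Equiv.Perm (Fin N)) : fixCount σ [] = N := by
  simp [fixCount]

/-- A family of polynomials encoding the expected numbers of fixed points of reduced words. -/
lemma exists_fixPoly_family (m n : ℕ) : ∃ f : List (Letter m) → ℝ[X],
    (∀ w, Reduced w → w.length ≤ n → (f w).natDegree ≤ m * n + 1 ∧
      (∀ N, n ≤ N → 0 < N → (f w).eval (1 / (N : ℝ)) =
        (∑ σ : Fin m → Equiv.Perm (Fin N), (fixCount σ w : ℝ)) / (N * (N.factorial : ℝ) ^ m) *
          ((fallPoly 0 n) ^ m).eval (1 / (N : ℝ)))) ∧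
    (∀ w, Reduced w → w.length ≤ n → w ≠ [] → (f w).eval 0 = 0 ∧
      |(f w).derivative.eval 0 - 1| ≤ n ∧ (¬ Bad w → (f w).derivative.eval 0 = 1)) ∧
    f [] = (fallPoly 0 n) ^ m := by
  have key : ∀ w : List (Letter m), ∃ f : ℝ[X], (Reduced w →
      w.length ≤ n → f.natDegree ≤ m * n + 1 ∧
      (∀ N, n ≤ N → 0 < N → f.eval (1 / (N : ℝ)) =
        (∑ σ : Fin m → Equiv.Perm (Fin N), (fixCount σ w : ℝ)) / (N * (N.factorial : ℝ) ^ m) *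
          ((fallPoly 0 n) ^ m).eval (1 / (N : ℝ)))) ∧
      (Reduced w → w.length ≤ n → w ≠ [] → f.eval 0 = 0 ∧
      |f.derivative.eval 0 - 1| ≤ n ∧ (¬ Bad w → f.derivative.eval 0 = 1)) ∧
      (w = [] → f = (fallPoly 0 n) ^ m) := by
    intro w
    by_cases hw : w = []
    · subst hw
      refine ⟨(fallPoly 0 n) ^ m, fun _ _ => ⟨?_, fun N hN hpos => ?_⟩, by simp, fun _ => rfl⟩
      · refine natDegree_pow_le.trans ((Nat.mul_le_mul_left m (natDegree_fallPoly_le 0 n)).trans ?_)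
        simp
      · simp only [fixCount_nil, Finset.sum_const, Finset.card_univ, Fintype.card_pi,
          Fintype.card_perm, Fintype.card_fin, Finset.prod_const, nsmul_eq_mul]
        have : (N : ℝ) ≠ 0 := by positivity
        have : (N.factorial : ℝ) ≠ 0 := by positivity
        push_cast
        field_simp
    · by_cases hr : Reduced w ∧ w.length ≤ n
      · obtain ⟨f, h1, h2, h3, h4, h5⟩ := exists_fixPoly w hr.1 hw hr.2
        exact ⟨f, fun _ _ => ⟨h1, h5⟩, fun _ _ _ => ⟨h2, h3, h4⟩, fun h => absurd h hw⟩
      · exact ⟨0, fun a b => absurd ⟨a, b⟩ hr, fun a b => absurd ⟨a, b⟩ hr, fun h => absurd h hw⟩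
  choose f hf using key
  exact ⟨f, fun w => (hf w).1, fun w => (hf w).2.1, (hf []).2.2 rfl⟩

lemma abs_sum_bad_le (hm : 0 < m) {n j : ℕ} (hj : j ≤ n) {F : List (Letter m) → ℝ}
    (h1 : ∀ w ∈ redWords m j, |F w| ≤ n) (h2 : ∀ w ∈ redWords m j, ¬ Bad w → F w = 0) :
    |∑ w ∈ redWords m j, F w| ≤ 2 * n * (n + 1) ^ 2 * rad m ^ j := by
  have e : ∑ w ∈ redWords m j, F w = ∑ w ∈ (redWords m j).filter Bad, F w := by
    rw [Finset.sum_filter]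
    refine Finset.sum_congr rfl fun w hw => ?_
    split_ifs with hb
    · rfl
    · exact h2 w hw hb
  rw [e]
  refine (Finset.abs_sum_le_sum_abs _ _).trans ?_
  refine (Finset.sum_le_card_nsmul _ _ (n : ℝ)
    fun w hw => h1 w (Finset.mem_filter.1 hw).1).trans ?_
  rw [nsmul_eq_mul]
  have hb : (((redWords m j).filter Bad).card : ℝ) ≤
      (j + 1) ^ 2 * (2 * (2 * m - 1 : ℝ) ^ (j / 2)) := by
    have := card_bad_le hm j
    have h3 : ((2 * m - 1 : ℕ) : ℝ) = 2 * m - 1 := by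
      rw [Nat.cast_sub (by omega)]; simp
    rw [← h3]
    exact_mod_cast this
  have hr : (2 * m - 1 : ℝ) ^ (j / 2) ≤ rad m ^ j := by
    rw [← rad_sq hm, ← pow_mul]
    exact pow_le_pow_right₀ (one_le_rad hm) (by omega)
  have hr0 : 0 ≤ (2 * m - 1 : ℝ) ^ (j / 2) := by
    rw [← rad_sq hm]; positivity
  have hjn : ((j : ℝ) + 1) ^ 2 ≤ (n + 1) ^ 2 := by
    gcongr
  calc _ ≤ ((j + 1) ^ 2 * (2 * (2 * m - 1 : ℝ) ^ (j / 2))) * n := by gcongr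
    _ ≤ ((n + 1) ^ 2 * (2 * rad m ^ j)) * n := by gcongr
    _ = _ := by ring

/-- The expected trace of a polynomial of the adjacency matrix is a polynomial in `1 / N`. -/
lemma exists_tracePoly (hm : 0 < m) {n : ℕ} {M : ℝ} {h : ℝ[X]} (hh : WordExpansion m n M h) :
    ∃ f : ℝ[X], f.natDegree ≤ m * n + 1 ∧ |f.eval 0| ≤ M ∧
      |f.derivative.eval 0| ≤ (m + 3) * (n + 1) ^ 4 * M ∧
      ∀ N, n ≤ N → 0 < N → f.eval (1 / (N : ℝ)) =
        (∑ σ : Fin m → Equiv.Perm (Fin N), (trace (aeval (adjMat σ) h) - h.eval (2 * m : ℝ))) /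
          (N * (N.factorial : ℝ) ^ m) * ((fallPoly 0 n) ^ m).eval (1 / (N : ℝ)) := by
  obtain ⟨c, hc, hexp⟩ := hh
  obtain ⟨f, hf1, hf2, hf3⟩ := exists_fixPoly_family m n
  have hdeg := eval_degree_of_expansion hexp
  have hc0 : |c 0| ≤ M := by simpa using hc 0
  have hM : 0 ≤ M := (abs_nonneg _).trans hc0
  have hred : ∀ {j}, j ∈ Finset.range (n + 1) → ∀ w ∈ redWords m j, Reduced w ∧ w.length ≤ n := by
    intro j hj w hw
    rw [mem_redWords] at hw
    rw [Finset.mem_range] at hj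
    exact ⟨hw.2, by omega⟩
  have hne : ∀ {j}, ∀ w ∈ redWords m (j + 1), w ≠ [] := by
    rintro j w hw rfl
    rw [mem_redWords] at hw
    simp at hw
  refine ⟨∑ j ∈ Finset.range (n + 1), C (c j) * ∑ w ∈ redWords m j, f w -
    C (h.eval (2 * m : ℝ)) * X * (fallPoly 0 n) ^ m, ?_, ?_, ?_, ?_⟩
  · refine (natDegree_sub_le _ _).trans (max_le ?_ ?_)
    · refine natDegree_sum_le_of_forall_le _ _ fun j hj => ?_
      refine (natDegree_C_mul_le _ _).trans (natDegree_sum_le_of_forall_le _ _ fun w hw => ?_)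
      exact (hf1 w (hred hj w hw).1 (hred hj w hw).2).1
    · rw [mul_assoc]
      refine (natDegree_C_mul_le _ _).trans (natDegree_mul_le.trans ?_)
      rw [natDegree_X]
      have := natDegree_pow_le.trans (Nat.mul_le_mul_left m (natDegree_fallPoly_le 0 n))
      simp at this ⊢
      omega
  · rw [eval_sub, eval_finsetSum, Finset.sum_range_succ']
    rw [Finset.sum_eq_zero]
    · simp [redWords_zero, hf3, hc0]
    · intro j hj
      rw [eval_mul, eval_finsetSum, Finset.sum_eq_zero, mul_zero]
      intro w hw
      have := hred (by simp at hj ⊢; omega : j + 1 ∈ Finset.range (n + 1)) w hw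
      exact (hf2 w this.1 this.2 (hne w hw)).1
  · have e : eval 0 (derivative (∑ j ∈ Finset.range (n + 1), C (c j) * ∑ w ∈ redWords m j, f w -
        C (h.eval (2 * m : ℝ)) * X * (fallPoly 0 n) ^ m)) =
        ∑ j ∈ Finset.range (n + 1), c j * ∑ w ∈ redWords m j, ((f w).derivative.eval 0 - 1) := by
      simp only [derivative_sub, derivative_sum, derivative_mul, derivative_C, zero_mul, zero_add,
        eval_sub, eval_finsetSum, eval_mul, eval_C, eval_add, derivative_X, mul_one, eval_X,
        mul_zero, add_zero, eval_pow, eval_zero_fallPoly, one_pow, Finset.sum_sub_distrib,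
        Finset.sum_const, nsmul_eq_mul, mul_sub, hdeg]
    rw [e]
    refine (Finset.abs_sum_le_sum_abs _ _).trans ?_
    have hn0 : (0 : ℝ) ≤ n := Nat.cast_nonneg n
    have hm0 : (0 : ℝ) ≤ m := Nat.cast_nonneg m
    refine (Finset.sum_le_card_nsmul _ _ ((m + 3) * (n + 1) ^ 3 * M) fun j hj => ?_).trans
      (le_of_eq ?_)
    · rw [abs_mul]
      rcases j with _ | j
      · simp only [redWords_zero, Finset.sum_singleton, hf3]
        have e2 : ((fallPoly 0 n) ^ m).derivative.eval 0 =
            m * (fallPoly 0 n).derivative.eval 0 := by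
          simp [derivative_pow]
        rw [e2]
        have h3 : |(m : ℝ) * (fallPoly 0 n).derivative.eval 0 - 1| ≤ m * n ^ 2 + 1 := by
          refine (abs_sub _ _).trans ?_
          rw [abs_mul, Nat.abs_cast, abs_one]
          gcongr
          exact abs_derivative_fallPoly_le n
        calc _ ≤ M * (m * n ^ 2 + 1) := by gcongr
          _ ≤ M * ((m + 3) * (n + 1) ^ 3) := by
            gcongr
            nlinarith [mul_nonneg hm0 hn0, mul_nonneg hm0 (pow_nonneg hn0 2),
              mul_nonneg hm0 (pow_nonneg hn0 3), pow_nonneg hn0 2, pow_nonneg hn0 3]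
          _ = _ := by ring
      · have h3 := abs_sum_bad_le hm (n := n) (j := j + 1) (by simp at hj; omega)
          (F := fun w => (f w).derivative.eval 0 - 1)
          (fun w hw => (hf2 w (hred hj w hw).1 (hred hj w hw).2 (hne w hw)).2.1)
          (fun w hw hb => by
            rw [(hf2 w (hred hj w hw).1 (hred hj w hw).2 (hne w hw)).2.2 hb, sub_self])
        calc _ ≤ |c (j + 1)| * (2 * n * (n + 1) ^ 2 * rad m ^ (j + 1)) := by gcongr
          _ = (|c (j + 1)| * rad m ^ (j + 1)) * (2 * n * (n + 1) ^ 2) := by ring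
          _ ≤ M * (2 * n * (n + 1) ^ 2) := by
            gcongr
            exact hc _
          _ ≤ M * ((m + 3) * (n + 1) ^ 3) := by
            refine mul_le_mul_of_nonneg_left ?_ hM
            have h5 : 2 * (n : ℝ) ≤ (m + 3) * (n + 1) := by nlinarith
            calc 2 * (n : ℝ) * (n + 1) ^ 2 ≤ (m + 3) * (n + 1) * (n + 1) ^ 2 := by gcongr
              _ = _ := by ring
          _ = _ := by ring
    · simp
      ring
  · intro N hnN hN
    have hN' : (N : ℝ) ≠ 0 := by positivity
    have hF : (N.factorial : ℝ) ≠ 0 := by positivity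
    rw [eval_sub, eval_finsetSum]
    have e1 : ∑ j ∈ Finset.range (n + 1), eval (1 / (N : ℝ)) (C (c j) * ∑ w ∈ redWords m j, f w) =
        (∑ σ : Fin m → Equiv.Perm (Fin N), trace (aeval (adjMat σ) h)) /
          (N * (N.factorial : ℝ) ^ m) * ((fallPoly 0 n) ^ m).eval (1 / (N : ℝ)) := by
      simp_rw [hexp, trace_sum, trace_smul, trace_redSum]
      rw [Finset.sum_comm, Finset.sum_div, Finset.sum_mul]
      refine Finset.sum_congr rfl fun j hj => ?_
      rw [eval_mul, eval_C, eval_finsetSum, ← Finset.smul_sum, Finset.sum_comm, smul_eq_mul,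
        mul_div_assoc, mul_assoc, Finset.sum_div, Finset.sum_mul]
      congr 1
      exact Finset.sum_congr rfl fun w hw =>
        (hf1 w (hred hj w hw).1 (hred hj w hw).2).2 N hnN hN
    rw [e1, Finset.sum_sub_distrib]
    simp only [Finset.sum_const, Finset.card_univ, Fintype.card_pi,
          Fintype.card_perm, Fintype.card_fin, Finset.prod_const, nsmul_eq_mul, eval_mul, eval_C,
          eval_X]
    push_cast
    field_simp

/-- The expected trace of a polynomial of the adjacency matrix, with the trivial eigenvalue
removed, is controlled by the size of the polynomial on the spectrum of the tree. -/
lemma abs_sum_trace_le (hm : 0 < m) {n : ℕ} {M H : ℝ} {h : ℝ[X]} (hn : h.natDegree ≤ n)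
    (h0 : h.eval 0 = 0) (hM : ∀ x, |x| ≤ 2 * rad m → |h.eval x| ≤ M)
    (hH : ∀ x : ℝ, |x| ≤ 2 * m → |h.eval x| ≤ H) {N : ℕ} (hN : 8 * (m * n + 1) ^ 2 ≤ N) :
    |(∑ σ : Fin m → Equiv.Perm (Fin N), (trace (aeval (adjMat σ) h) - h.eval (2 * m : ℝ))) /
      (N.factorial : ℝ) ^ m| ≤
      4 * (m + 4) * (n + 1) ^ 5 * M * N + 4096 * (m * n + 1) ^ 8 * H / N := by
  obtain ⟨f, h1, h2, h3, h4⟩ := exists_tracePoly hm (wordExpansion_of_bound hm hn hM)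
  have hM0 : 0 ≤ M := (abs_nonneg _).trans (hM 0 (by
    simpa using (by linarith [one_le_rad hm] : 0 ≤ rad m)))
  have hsize : ∀ {N : ℕ}, 8 * (m * n + 1) ^ 2 ≤ N → n ≤ N ∧ 0 < N ∧ 2 * m * n ^ 2 ≤ N := by
    intro N hN
    have a1 : n ≤ m * n := Nat.le_mul_of_pos_left n hm
    have a2 : m * n ^ 2 ≤ (m * n) ^ 2 := by
      rw [mul_pow]
      exact Nat.mul_le_mul_right _ (Nat.le_self_pow (by norm_num) m)
    refine ⟨by nlinarith, by nlinarith, by nlinarith⟩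
  have hB : ∀ N : ℕ, 8 * (m * n + 1) ^ 2 ≤ N → |f.eval (1 / (N : ℝ))| ≤ H := by
    intro N hN
    obtain ⟨s1, s2, s3⟩ := hsize hN
    have hN' : (0 : ℝ) < N := by exact_mod_cast s2
    obtain ⟨g1, g2⟩ := half_le_eval_inv_fallPoly_pow s1 s2 s3
    rw [h4 N s1 s2, abs_mul,
      abs_of_nonneg (by linarith : 0 ≤ eval (1 / (N : ℝ)) (fallPoly 0 n ^ m))]
    have b :
        |(∑ σ : Fin m → Equiv.Perm (Fin N), (trace (aeval (adjMat σ) h) - h.eval (2 * m : ℝ))) /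
          (N * (N.factorial : ℝ) ^ m)| ≤ H := by
      rw [abs_div, abs_of_pos (by positivity : (0 : ℝ) < N * (N.factorial : ℝ) ^ m),
        div_le_iff₀ (by positivity)]
      refine (Finset.abs_sum_le_sum_abs _ _).trans ?_
      refine (Finset.sum_le_card_nsmul _ _ _ fun σ _ => abs_trace_sub_le σ s2 h0 hH).trans ?_
      simp [Fintype.card_perm]
      apply le_of_eq
      ring
    have := abs_nonneg ((∑ σ : Fin m → Equiv.Perm (Fin N),
      (trace (aeval (adjMat σ) h) - h.eval (2 * m : ℝ))) / (N * (N.factorial : ℝ) ^ m))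
    nlinarith
  obtain ⟨s1, s2, s3⟩ := hsize hN
  have hN' : (0 : ℝ) < N := by exact_mod_cast s2
  have hN1 : (1 : ℝ) ≤ N := by exact_mod_cast s2
  obtain ⟨g1, g2⟩ := half_le_eval_inv_fallPoly_pow s1 s2 s3
  have key := abs_eval_inv_le_taylor h1 le_rfl (by positivity) hB hN
  have hv := h4 N s1 s2
  have hE : (∑ σ : Fin m → Equiv.Perm (Fin N), (trace (aeval (adjMat σ) h) - h.eval (2 * m : ℝ))) /
      (N.factorial : ℝ) ^ m * eval (1 / (N : ℝ)) (fallPoly 0 n ^ m) = N * f.eval (1 / (N : ℝ)) := by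
    rw [hv]
    field_simp
  set E := (∑ σ : Fin m → Equiv.Perm (Fin N), (trace (aeval (adjMat σ) h) - h.eval (2 * m : ℝ))) /
      (N.factorial : ℝ) ^ m
  have hE2 : |E| ≤ 2 * (N * |f.eval (1 / (N : ℝ))|) := by
    have := congrArg abs hE
    rw [abs_mul, abs_mul, Nat.abs_cast, abs_of_nonneg (by linarith :
      0 ≤ eval (1 / (N : ℝ)) (fallPoly 0 n ^ m))] at this
    nlinarith [abs_nonneg E]
  refine hE2.trans ?_
  have hn0 : (0 : ℝ) ≤ n := Nat.cast_nonneg n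
  have hm0 : (0 : ℝ) ≤ m := Nat.cast_nonneg m
  have k2 : |f.derivative.eval 0| / N ≤ (m + 3) * (n + 1) ^ 4 * (2 * M * (n + 1)) := by
    refine (div_le_self (abs_nonneg _) hN1).trans h3
  have k3 : 2 * M * (n + 1) ≤ 1 * (n + 1) ^ 4 * (2 * M * (n + 1)) := by
    rw [one_mul]
    refine le_mul_of_one_le_left (by positivity) (one_le_pow₀ (by linarith))
  have k4 : |f.eval (1 / (N : ℝ))| ≤ 2 * (m + 4) * (n + 1) ^ 5 * M +
      2048 * (m * n + 1) ^ 8 * H / N ^ 2 := by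
    refine key.trans ?_
    have e :
        (32 : ℝ) * ((m * n + 1 : ℕ) : ℝ) ^ 4 * ((8 * (m * n + 1) ^ 2 : ℕ) : ℝ) ^ 2 * H / N ^ 2 =
        2048 * (m * n + 1) ^ 8 * H / N ^ 2 := by
      push_cast
      ring
    rw [e]
    nlinarith
  calc 2 * (N * |f.eval (1 / (N : ℝ))|) ≤ 2 * (N * (2 * (m + 4) * (n + 1) ^ 5 * M +
      2048 * (m * n + 1) ^ 8 * H / N ^ 2)) := by gcongr
    _ = _ := by
      field_simp
      ring

end TracePoly

open Polynomial Matrix Filter Topology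

/-- A polynomial separating the tree spectrum from a neighbourhood of the degree. -/
lemma exists_cutoff_poly {r ρ d : ℝ} (hr : r < ρ) :
    ∃ s : ℝ[X], (∀ x, |x| ≤ d → 0 ≤ s.eval x ∧ s.eval x ≤ 1) ∧
      (∀ x, |x| ≤ d → |x| ≤ r → s.eval x ≤ 1 / 16) ∧
      ∀ x, |x| ≤ d → ρ ≤ |x| → 1 / 2 ≤ s.eval x := by
  set φ : ℝ → ℝ := fun x => max (1 / 32) (min (31 / 32) ((|x| - r) / (ρ - r)))
  have hφ : ContinuousOn φ (Set.Icc (-d) d) := by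
    apply Continuous.continuousOn
    fun_prop
  obtain ⟨s, hs⟩ := exists_polynomial_near_of_continuousOn (-d) d φ hφ (1 / 32) (by norm_num)
  have hpos : 0 < ρ - r := by linarith
  refine ⟨s, fun x hx => ?_, fun x hx hxr => ?_, fun x hx hxr => ?_⟩
  all_goals
    have h := abs_lt.1 (hs x (abs_le.1 hx))
  · have h1 : 1 / 32 ≤ φ x := le_max_left _ _
    have h2 : φ x ≤ 31 / 32 := max_le (by norm_num) (min_le_left _ _)
    constructor <;> linarith
  · have h1 : φ x ≤ 1 / 32 := by
      refine max_le le_rfl ((min_le_right _ _).trans ?_)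
      exact (div_nonpos_of_nonpos_of_nonneg (by linarith) hpos.le).trans (by norm_num)
    linarith
  · have h1 : 31 / 32 ≤ φ x := by
      refine le_max_of_le_right (le_min le_rfl ?_)
      rw [le_div_iff₀ hpos]
      linarith
    linarith

variable {m : ℕ}

/-- The fraction of permutation tuples on `N` points that satisfy `P`. -/
noncomputable def prob (m N : ℕ) (P : (Fin m → Equiv.Perm (Fin N)) → Prop) : ℝ :=
  ((Finset.univ.filter P).card : ℝ) / (N.factorial : ℝ) ^ m

lemma rad_le (hm : 0 < m) : rad m ≤ m := by
  have h1 : (1 : ℝ) ≤ m := by exact_mod_cast hm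
  rw [rad, Real.sqrt_le_left (by linarith)]
  nlinarith [sq_nonneg ((m : ℝ) - 1)]

lemma prob_not_specBound_le (hm : 0 < m) {ρ : ℝ} (hρ : 2 * rad m < ρ) :
    ∃ e : ℕ, ∀ p : ℕ, 8 * (m * (2 + p * e) + 1) ^ 2 ≤ 4 ^ p →
      prob m (4 ^ p) (fun σ => ¬ SpecBound σ ρ) * ((ρ / (2 * m)) ^ 2 * (1 / 2) ^ p) ≤
        4 * (m + 4) * ((2 + p * e : ℕ) + 1) ^ 5 * (1 / 16) ^ p * 4 ^ p +
          4096 * (m * (2 + p * e : ℕ) + 1) ^ 8 / 4 ^ p := by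
  obtain ⟨s, hs1, hs2, hs3⟩ := exists_cutoff_poly (d := 2 * m) hρ
  have hm' : (0 : ℝ) < m := by exact_mod_cast hm
  have hrad := one_le_rad hm
  have hrad2 := rad_le hm
  refine ⟨s.natDegree, fun p hp => ?_⟩
  set h : ℝ[X] := (C (1 / (2 * m : ℝ)) * X) ^ 2 * s ^ p with hh
  have hev : ∀ x, h.eval x = (x / (2 * m)) ^ 2 * s.eval x ^ p := by
    intro x
    rw [hh, eval_mul, eval_pow, eval_pow, eval_mul, eval_C, eval_X]
    ring
  have hx1 : ∀ x : ℝ, |x| ≤ 2 * m → (x / (2 * m)) ^ 2 ≤ 1 := by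
    intro x hx
    rw [sq_le_one_iff_abs_le_one, abs_div, abs_of_pos (by positivity : (0 : ℝ) < 2 * m)]
    exact div_le_one_of_le₀ hx (by positivity)
  have h0 : h.eval 0 = 0 := by simp [hev]
  have hdeg : h.natDegree ≤ 2 + p * s.natDegree := by
    refine natDegree_mul_le.trans (add_le_add ?_ natDegree_pow_le)
    refine natDegree_pow_le.trans ?_
    have := (natDegree_C_mul_le (1 / (2 * m : ℝ)) X).trans natDegree_X_le
    omega
  have hnn : ∀ x : ℝ, |x| ≤ 2 * m → 0 ≤ h.eval x := by
    intro x hx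
    rw [hev]
    exact mul_nonneg (sq_nonneg _) (pow_nonneg (hs1 x hx).1 _)
  have hM : ∀ x, |x| ≤ 2 * rad m → |h.eval x| ≤ (1 / 16) ^ p := by
    intro x hx
    have hx' : |x| ≤ 2 * m := by linarith
    rw [abs_of_nonneg (hnn x hx'), hev, ← one_mul ((1 / 16 : ℝ) ^ p)]
    have a := (hs1 x hx').1
    exact mul_le_mul (hx1 x hx') (pow_le_pow_left₀ a (hs2 x hx' hx) _) (pow_nonneg a _)
      zero_le_one
  have hH : ∀ x : ℝ, |x| ≤ 2 * m → |h.eval x| ≤ 1 := by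
    intro x hx
    rw [abs_of_nonneg (hnn x hx), hev]
    have a := (hs1 x hx).1
    exact mul_le_one₀ (hx1 x hx) (pow_nonneg a _) (pow_le_one₀ a (hs1 x hx).2)
  have ht : ∀ x : ℝ, ρ ≤ |x| → |x| ≤ 2 * m → (ρ / (2 * m)) ^ 2 * (1 / 2) ^ p ≤ h.eval x := by
    intro x hx hxm
    rw [hev]
    refine mul_le_mul ?_ (pow_le_pow_left₀ (by norm_num) (hs3 x hxm hx) _) (by positivity)
      (sq_nonneg _)
    rw [div_pow, div_pow, ← sq_abs x]
    gcongr
    linarith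
  have key := abs_sum_trace_le hm hdeg h0 hM hH (N := 4 ^ p) hp
  have hN : 0 < 4 ^ p := by positivity
  have hsum : ((Finset.univ.filter fun σ : Fin m → Equiv.Perm (Fin (4 ^ p)) =>
      ¬ SpecBound σ ρ).card : ℝ) * ((ρ / (2 * m)) ^ 2 * (1 / 2) ^ p) ≤
      ∑ σ : Fin m → Equiv.Perm (Fin (4 ^ p)),
        (trace (aeval (adjMat σ) h) - h.eval (2 * m : ℝ)) := by
    rw [← nsmul_eq_mul, ← Finset.sum_const]
    refine (Finset.sum_le_sum fun σ hσ => ?_).trans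
      (Finset.sum_le_sum_of_subset_of_nonneg (Finset.filter_subset _ _)
        fun σ _ _ => trace_sub_nonneg σ hN h0 hnn)
    exact le_trace_sub_of_not_specBound σ hN h0 hnn ht (Finset.mem_filter.1 hσ).2
  rw [prob, div_mul_eq_mul_div]
  have hF : (0 : ℝ) ≤ ((4 ^ p).factorial : ℝ) ^ m := pow_nonneg (Nat.cast_nonneg _) _
  have hdiv := (div_le_div_of_nonneg_right hsum hF).trans (le_abs_self _)
  refine le_trans (le_of_eq ?_) (hdiv.trans ?_)
  · congr!
  refine key.trans (le_of_eq ?_)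
  push_cast
  ring

lemma tendsto_poly_mul_pow (k : ℕ) {r : ℝ} (h0 : 0 ≤ r) (h1 : r < 1) :
    Tendsto (fun p : ℕ => ((p : ℝ) + 1) ^ k * r ^ p) atTop (𝓝 0) := by
  have := tendsto_pow_const_mul_const_pow_of_lt_one k h0 h1
  rcases h0.eq_or_lt with rfl | hpos
  · refine Tendsto.congr' ?_ tendsto_const_nhds
    filter_upwards [eventually_gt_atTop 0] with p hp
    rw [zero_pow (by omega), mul_zero]
  · have h2 := ((tendsto_add_atTop_iff_nat 1).2 this).const_mul (1 / r)
    rw [mul_zero] at h2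
    refine h2.congr fun p => ?_
    push_cast
    field_simp
    ring

/-- Random tuples of permutations have almost optimal spectral gap with high probability. -/
theorem tendsto_prob_not_specBound (hm : 0 < m) {ρ : ℝ} (hρ : 2 * rad m < ρ) :
    Tendsto (fun p : ℕ => prob m (4 ^ p) (fun σ => ¬ SpecBound σ ρ)) atTop (𝓝 0) := by
  obtain ⟨e, he⟩ := prob_not_specBound_le hm hρ
  have hm' : (0 : ℝ) < m := by exact_mod_cast hm
  have hρ0 : 0 < ρ := by linarith [one_le_rad hm]
  set c := (ρ / (2 * m)) ^ 2 with hc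
  have hcpos : 0 < c := by positivity
  set K : ℝ := (m + 1) * (e + 3) with hK
  have hn : ∀ p : ℕ, (m : ℝ) * (2 + p * e : ℕ) + 1 ≤ K * (p + 1) := by
    intro p
    rw [hK]
    push_cast
    have : (0 : ℝ) ≤ m * p := by positivity
    have : (0 : ℝ) ≤ p * e := by positivity
    nlinarith [(Nat.cast_nonneg p : (0 : ℝ) ≤ p), (Nat.cast_nonneg e : (0 : ℝ) ≤ e),
      mul_nonneg hm'.le (Nat.cast_nonneg e : (0 : ℝ) ≤ e)]
  have hn2 : ∀ p : ℕ, ((2 + p * e : ℕ) : ℝ) + 1 ≤ K * (p + 1) := by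
    intro p
    rw [hK]
    push_cast
    have : (0 : ℝ) ≤ m * p := by positivity
    have : (0 : ℝ) ≤ m * (p * e) := by positivity
    nlinarith [(Nat.cast_nonneg p : (0 : ℝ) ≤ p), (Nat.cast_nonneg e : (0 : ℝ) ≤ e),
      mul_nonneg hm'.le (Nat.cast_nonneg e : (0 : ℝ) ≤ e)]
  have hev : ∀ᶠ p : ℕ in atTop, 8 * (m * (2 + p * e) + 1) ^ 2 ≤ 4 ^ p := by
    have := (tendsto_poly_mul_pow 2 (r := 1 / 4) (by norm_num) (by norm_num)).const_mul
      (8 * K ^ 2)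
    rw [mul_zero] at this
    filter_upwards [this.eventually (gt_mem_nhds one_pos)] with p hp
    have h4 : (0 : ℝ) < 4 ^ p := by positivity
    have h5 : 8 * ((m : ℝ) * (2 + p * e : ℕ) + 1) ^ 2 ≤ 4 ^ p := by
      calc 8 * ((m : ℝ) * (2 + p * e : ℕ) + 1) ^ 2 ≤ 8 * (K * (p + 1)) ^ 2 := by
            gcongr
            exact hn p
        _ = 8 * K ^ 2 * ((p + 1) ^ 2 * (1 / 4) ^ p) * 4 ^ p := by
            rw [one_div, inv_pow]
            field_simp
        _ ≤ 1 * 4 ^ p := by gcongr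
        _ = _ := one_mul _
    exact_mod_cast h5
  have hlim : Tendsto (fun p : ℕ => (4 * (m + 4) * K ^ 5 / c) * (((p : ℝ) + 1) ^ 5 * (1 / 2) ^ p) +
      (4096 * K ^ 8 / c) * (((p : ℝ) + 1) ^ 8 * (1 / 2) ^ p)) atTop (𝓝 0) := by
    have a := (tendsto_poly_mul_pow 5 (r := 1 / 2) (by norm_num) (by norm_num)).const_mul
      (4 * (m + 4) * K ^ 5 / c)
    have b := (tendsto_poly_mul_pow 8 (r := 1 / 2) (by norm_num) (by norm_num)).const_mul
      (4096 * K ^ 8 / c)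
    simpa using a.add b
  refine squeeze_zero' (Eventually.of_forall fun p => ?_) ?_ hlim
  · unfold prob
    positivity
  filter_upwards [hev] with p hp
  have h := he p hp
  have h2 : (0 : ℝ) < (1 / 2) ^ p := by positivity
  rw [← le_div_iff₀ (by positivity)] at h
  refine h.trans ?_
  rw [div_le_iff₀ (by positivity)]
  have e16 : (1 / 16 : ℝ) ^ p * 4 ^ p = (1 / 2) ^ p * (1 / 2) ^ p := by
    rw [← mul_pow, ← mul_pow]; norm_num
  have e4 : (1 : ℝ) / 4 ^ p = (1 / 2) ^ p * (1 / 2) ^ p := by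
    rw [← mul_pow, one_div, ← inv_pow]; norm_num
  calc _ = 4 * (m + 4) * ((2 + p * e : ℕ) + 1 : ℝ) ^ 5 * ((1 / 16) ^ p * 4 ^ p) +
          4096 * (m * (2 + p * e : ℕ) + 1 : ℝ) ^ 8 * (1 / 4 ^ p) := by ring
    _ ≤ 4 * (m + 4) * (K * (p + 1)) ^ 5 * ((1 / 2) ^ p * (1 / 2) ^ p) +
          4096 * (K * (p + 1)) ^ 8 * ((1 / 2) ^ p * (1 / 2) ^ p) := by
        rw [e16, e4]
        gcongr
        · exact hn2 p
        · exact hn p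
    _ = _ := by
        field_simp

section Coincidence

variable {m : ℕ} {V : Type*}

/-- The labelled directed edge `(i, x, y)`, meaning `σ i x = y`, traversed when the letter `a` leads
from `v` to `y`. -/
def mkFact (a : Letter m) (v y : V) : Fin m × V × V := if a.2 then (a.1, v, y) else (a.1, y, v)

lemma holds_mkFact (σ : Fin m → Equiv.Perm V) (a : Letter m) (v y : V) :
    σ (mkFact a v y).1 (mkFact a v y).2.1 = (mkFact a v y).2.2 ↔ step σ a v = y := by
  rcases a with ⟨i, _ | _⟩
  · simp only [mkFact, step, Bool.false_eq_true, if_false]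
    rw [Equiv.Perm.inv_eq_iff_eq, eq_comm]
  · simp [mkFact, step]

lemma mkFact_injective {a : Letter m} {v y v' y' : V} (h : mkFact a v y = mkFact a v' y') :
    v = v' ∧ y = y' := by
  rcases a with ⟨i, _ | _⟩ <;> simp_all [mkFact]

lemma exists_eq_mkFact (a : Letter m) (t : Fin m × V × V) (h : t.1 = a.1) :
    ∃ x z, t = mkFact a x z := by
  obtain ⟨i', x, y⟩ := t
  obtain rfl : i' = a.1 := h
  rcases a with ⟨i, _ | _⟩
  · exact ⟨y, x, by simp [mkFact]⟩
  · exact ⟨x, y, by simp [mkFact]⟩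

variable [DecidableEq V]

/-- The number of coincidences of a walk: steps along an edge outside the known edges `S`, and not
traversed before, that lead to the visited vertices `T` or to a vertex visited before. -/
def coinc (σ : Fin m → Equiv.Perm V) :
    Finset (Fin m × V × V) → Finset V → List (Letter m) → V → ℕ
  | _, _, [], _ => 0
  | S, T, a :: w, v =>
    (if mkFact a v (step σ a v) ∉ S ∧ step σ a v ∈ T then 1 else 0) +
      coinc σ (insert (mkFact a v (step σ a v)) S) (insert (step σ a v) T) w (step σ a v)

variable [Fintype V]

/-- The permutation tuples compatible with a set of known edges. -/
noncomputable def compat (S : Finset (Fin m × V × V)) : Finset (Fin m → Equiv.Perm V) :=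
  Finset.univ.filter fun σ => ∀ t ∈ S, σ t.1 t.2.1 = t.2.2

lemma mem_compat {S : Finset (Fin m × V × V)} {σ : Fin m → Equiv.Perm V} :
    σ ∈ compat S ↔ ∀ t ∈ S, σ t.1 t.2.1 = t.2.2 := by simp [compat]

lemma mem_compat_insert {S : Finset (Fin m × V × V)} {σ : Fin m → Equiv.Perm V} {a : Letter m}
    {v y : V} : σ ∈ compat (insert (mkFact a v y) S) ↔ step σ a v = y ∧ σ ∈ compat S := by
  rw [mem_compat, Finset.forall_mem_insert, holds_mkFact, mem_compat]

/-- Exchanging two free images of a letter preserves the number of compatible tuples. -/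
lemma card_compat_insert_le {S : Finset (Fin m × V × V)} {a : Letter m} {v y y' : V}
    (hv : ∀ z, mkFact a v z ∉ S) (hy : ∀ x, mkFact a x y ∉ S) (hy' : ∀ x, mkFact a x y' ∉ S) :
    (compat (insert (mkFact a v y) S)).card ≤ (compat (insert (mkFact a v y') S)).card := by
  refine Finset.card_le_card_of_injOn (fun σ => Function.update σ a.1
    (if a.2 then Equiv.swap y y' * σ a.1 else σ a.1 * Equiv.swap y y')) ?_ ?_
  · intro σ hσ
    rw [Finset.mem_coe, mem_compat_insert] at hσ ⊢
    obtain ⟨h1, h2⟩ := hσ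
    rw [mem_compat] at h2
    constructor
    · rw [← holds_mkFact] at h1 ⊢
      rcases a with ⟨i, _ | _⟩
      · simpa [mkFact] using h1
      · simp only [mkFact, if_true] at h1
        simp [mkFact, h1]
    · rw [mem_compat]
      intro t ht
      have h3 := h2 t ht
      by_cases hi : t.1 = a.1
      · obtain ⟨x, z, rfl⟩ := exists_eq_mkFact a t hi
        have hz : z ≠ y := by rintro rfl; exact hy x ht
        have hz' : z ≠ y' := by rintro rfl; exact hy' x ht
        rcases a with ⟨i, _ | _⟩
        · simp only [mkFact, Bool.false_eq_true, if_false] at h3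
          simp [mkFact, Equiv.swap_apply_of_ne_of_ne hz hz', h3]
        · simp only [mkFact, if_true] at h3
          simp [mkFact, Equiv.swap_apply_of_ne_of_ne hz hz', h3]
      · beta_reduce
        rw [Function.update_of_ne hi]
        exact h3
  · intro σ _ σ' _ h
    beta_reduce at h
    funext i
    by_cases hi : i = a.1
    · subst hi
      have := congrFun h a.1
      simp only [Function.update_self] at this
      split_ifs at this
      · exact mul_left_cancel this
      · exact mul_right_cancel this
    · have := congrFun h i
      rwa [Function.update_of_ne hi, Function.update_of_ne hi] at this

lemma sum_card_compat_insert (S : Finset (Fin m × V × V)) (a : Letter m) (v : V) :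
    ∑ y, (compat (insert (mkFact a v y) S)).card = (compat S).card := by
  rw [Finset.card_eq_sum_card_fiberwise (f := fun σ => step σ a v) (t := Finset.univ)
    (fun _ _ => Finset.mem_coe.2 (Finset.mem_univ _))]
  refine Finset.sum_congr rfl fun y _ => ?_
  congr 1
  ext σ
  rw [mem_compat_insert, Finset.mem_filter, and_comm]

lemma mul_card_compat_insert_le {S : Finset (Fin m × V × V)} {a : Letter m} {v : V}
    (hv : ∀ z, mkFact a v z ∉ S) (y : V) :
    (Fintype.card V - S.card) * (compat (insert (mkFact a v y) S)).card ≤ (compat S).card := by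
  by_cases hy : ∀ x, mkFact a x y ∉ S
  · set B : Finset V := Finset.univ.filter fun z => ∃ x, mkFact a x z ∈ S with hB
    have hcard : B.card ≤ S.card := by
      refine Finset.card_le_card_of_injOn (fun z => if h : ∃ x, mkFact a x z ∈ S then
        mkFact a h.choose z else (a.1, v, v)) ?_ ?_
      · intro z hz
        have hz' : ∃ x, mkFact a x z ∈ S := by simpa [hB] using hz
        beta_reduce
        rw [dif_pos hz']
        exact hz'.choose_spec
      · intro z hz z' hz' h
        have h1 : ∃ x, mkFact a x z ∈ S := by simpa [hB] using hz
        have h2 : ∃ x, mkFact a x z' ∈ S := by simpa [hB] using hz'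
        beta_reduce at h
        rw [dif_pos h1, dif_pos h2] at h
        exact (mkFact_injective h).2
    calc _ ≤ Bᶜ.card * (compat (insert (mkFact a v y) S)).card := by
          rw [Finset.card_compl]
          gcongr
      _ = ∑ z ∈ Bᶜ, (compat (insert (mkFact a v y) S)).card := by
          rw [Finset.sum_const, smul_eq_mul]
      _ ≤ ∑ z ∈ Bᶜ, (compat (insert (mkFact a v z) S)).card := by
          refine Finset.sum_le_sum fun z hz => card_compat_insert_le hv hy fun x hx => ?_
          simp only [hB, Finset.mem_compl, Finset.mem_filter, Finset.mem_univ, true_and,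
            not_exists] at hz
          exact hz x hx
      _ ≤ ∑ z, (compat (insert (mkFact a v z) S)).card :=
          Finset.sum_le_sum_of_subset (Finset.subset_univ _)
      _ = _ := sum_card_compat_insert S a v
  · push Not at hy
    obtain ⟨x, hx⟩ := hy
    have hxv : x ≠ v := by rintro rfl; exact hv y hx
    have : compat (insert (mkFact a v y) S) = ∅ := by
      ext σ
      rw [mem_compat_insert, mem_compat]
      simp only [Finset.notMem_empty, iff_false, not_and]
      intro h1 h2
      exact hxv ((step σ a).injective (((holds_mkFact σ a x y).1 (h2 _ hx)).trans h1.symm))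
    simp [this]

/-- Walks in random permutations rarely have many coincidences. -/
lemma card_coinc_le {M : ℕ} (hM : M < Fintype.card V) (w : List (Letter m)) :
    ∀ (S : Finset (Fin m × V × V)) (T : Finset V) (v : V) (t : ℕ), S.card + w.length ≤ M →
      T.card + w.length ≤ M + 1 →
      (((compat S).filter fun σ => t ≤ coinc σ S T w v).card : ℝ) ≤
        w.length.choose t * ((M + 1) / (Fintype.card V - M) : ℝ) ^ t * (compat S).card := by
  have hpos : (0 : ℝ) < Fintype.card V - M := by
    rw [sub_pos]; exact_mod_cast hM
  set ε : ℝ := (M + 1) / (Fintype.card V - M) with hε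
  have hε0 : 0 ≤ ε := by positivity
  induction w with
  | nil =>
    intro S T v t _ _
    rcases t with _ | t
    · simp
    · simp [coinc]
  | cons a w ih =>
    intro S T v t hS hT
    rw [List.length_cons] at hS hT ⊢
    by_cases hknown : ∃ z, mkFact a v z ∈ S
    · obtain ⟨z, hz⟩ := hknown
      have hstep : ∀ σ ∈ compat S, step σ a v = z := fun σ hσ =>
        (holds_mkFact σ a v z).1 (mem_compat.1 hσ _ hz)
      have e : (compat S).filter (fun σ => t ≤ coinc σ S T (a :: w) v) =
          (compat S).filter (fun σ => t ≤ coinc σ S (insert z T) w z) := by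
        refine Finset.filter_congr fun σ hσ => ?_
        rw [coinc, hstep σ hσ, Finset.insert_eq_of_mem hz]
        simp [hz]
      rw [e]
      refine (ih S (insert z T) z t (by omega) ?_).trans ?_
      · have := Finset.card_insert_le z T
        omega
      · gcongr
        omega
    · push Not at hknown
      rcases t with _ | t
      · simp only [zero_le, Finset.filter_true, Nat.choose_zero_right, Nat.cast_one, pow_zero,
          one_mul, le_refl]
      have e : (((compat S).filter fun σ => t + 1 ≤ coinc σ S T (a :: w) v).card : ℝ) =
          ∑ y, (((compat (insert (mkFact a v y) S)).filter fun σ => t + 1 ≤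
            (if y ∈ T then 1 else 0) +
              coinc σ (insert (mkFact a v y) S) (insert y T) w y).card : ℝ) := by
        rw [← Nat.cast_sum, Finset.card_eq_sum_card_fiberwise (f := fun σ => step σ a v)
          (t := Finset.univ) (fun _ _ => Finset.mem_coe.2 (Finset.mem_univ _))]
        congr 1
        refine Finset.sum_congr rfl fun y _ => ?_
        congr 1
        ext σ
        simp only [Finset.mem_filter, mem_compat_insert]
        constructor
        · rintro ⟨⟨h1, h2⟩, rfl⟩
          refine ⟨⟨rfl, h1⟩, ?_⟩
          simpa [coinc, hknown] using h2
        · rintro ⟨⟨rfl, h1⟩, h2⟩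
          refine ⟨⟨h1, ?_⟩, rfl⟩
          simpa [coinc, hknown] using h2
      rw [e]
      have hb : ∀ y, (((compat (insert (mkFact a v y) S)).filter fun σ => t + 1 ≤
            (if y ∈ T then 1 else 0) +
              coinc σ (insert (mkFact a v y) S) (insert y T) w y).card : ℝ) ≤
          w.length.choose (t + 1) * ε ^ (t + 1) * (compat (insert (mkFact a v y) S)).card +
          if y ∈ T then w.length.choose t * ε ^ t * ((compat S).card / (Fintype.card V - M))
            else 0 := by
        intro y
        have c1 := Finset.card_insert_le (mkFact a v y) S
        have c2 := Finset.card_insert_le y T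
        by_cases hy : y ∈ T
        · simp only [hy, if_true]
          have e2 : ((compat (insert (mkFact a v y) S)).filter fun σ => t + 1 ≤
              1 + coinc σ (insert (mkFact a v y) S) (insert y T) w y) =
              ((compat (insert (mkFact a v y) S)).filter fun σ => t ≤
              coinc σ (insert (mkFact a v y) S) (insert y T) w y) :=
            Finset.filter_congr fun σ _ => by omega
          rw [e2]
          refine (ih _ _ y t (by omega) (by omega)).trans ?_
          refine le_trans ?_ (le_add_of_nonneg_left (by positivity))
          gcongr
          rw [le_div_iff₀ hpos, mul_comm]
          have h3 := mul_card_compat_insert_le hknown y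
          have h4 : (Fintype.card V - M : ℝ) ≤ ((Fintype.card V - S.card : ℕ) : ℝ) := by
            rw [Nat.cast_sub (by omega)]
            have : (S.card : ℝ) ≤ M := by exact_mod_cast (by omega : S.card ≤ M)
            linarith
          calc _ ≤ ((Fintype.card V - S.card : ℕ) : ℝ) *
                (compat (insert (mkFact a v y) S)).card := by gcongr
            _ ≤ _ := by exact_mod_cast h3
        · simp only [hy, if_false, zero_add, add_zero]
          exact ih _ _ y (t + 1) (by omega) (by omega)
      refine (Finset.sum_le_sum fun y _ => hb y).trans ?_
      rw [Finset.sum_add_distrib, ← Finset.mul_sum, ← Nat.cast_sum, sum_card_compat_insert,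
        Finset.sum_ite_mem, Finset.univ_inter, Finset.sum_const, nsmul_eq_mul]
      have hTM : (T.card : ℝ) ≤ M + 1 := by exact_mod_cast (by omega : T.card ≤ M + 1)
      calc _ ≤ w.length.choose (t + 1) * ε ^ (t + 1) * (compat S).card +
            (M + 1) * (w.length.choose t * ε ^ t * ((compat S).card / (Fintype.card V - M))) := by
            gcongr
        _ = _ := by
            rw [Nat.choose_succ_succ', Nat.cast_add, pow_succ, hε]
            ring

end Coincidence

section Edges

variable {m : ℕ} {V : Type*} (σ : Fin m → Equiv.Perm V)

/-- The labelled edge traversed when the letter `a` is followed from `v`. -/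
def edge (a : Letter m) (v : V) : Fin m × V × V := mkFact a v (step σ a v)

lemma edge_linv (a : Letter m) (v : V) : edge σ (linv a) (step σ a v) = edge σ a v := by
  rw [edge, step_linv_step]
  rcases a with ⟨i, _ | _⟩ <;> simp [edge, mkFact, linv]

lemma edge_eq_edge {a b : Letter m} {u v : V} (h : edge σ a u = edge σ b v) :
    a = b ∧ u = v ∨ a = linv b ∧ u = step σ b v := by
  rcases a with ⟨i, _ | _⟩ <;> rcases b with ⟨j, _ | _⟩ <;>
    simp only [edge, mkFact, Bool.false_eq_true, if_false, if_true, Prod.mk.injEq] at h <;>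
    simp [linv, h]

/-- The edges traversed by a walk. -/
def edges : List (Letter m) → V → List (Fin m × V × V)
  | [], _ => []
  | a :: w, v => edge σ a v :: edges w (step σ a v)

/-- The vertices visited by a walk after its start. -/
def verts : List (Letter m) → V → List V
  | [], _ => []
  | a :: w, v => step σ a v :: verts w (step σ a v)

lemma edges_append (w w' : List (Letter m)) (v : V) :
    edges σ (w ++ w') v = edges σ w v ++ edges σ w' (run σ w v) := by
  induction w generalizing v with
  | nil => rfl
  | cons a w ih => simp [edges, ih]

lemma verts_append (w w' : List (Letter m)) (v : V) :
    verts σ (w ++ w') v = verts σ w v ++ verts σ w' (run σ w v) := by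
  induction w generalizing v with
  | nil => rfl
  | cons a w ih => simp [verts, ih]

lemma run_mem_verts {w : List (Letter m)} (hw : w ≠ []) (v : V) : run σ w v ∈ verts σ w v := by
  induction w generalizing v with
  | nil => exact absurd rfl hw
  | cons a w ih =>
    rcases w with _ | ⟨b, w⟩
    · simp [verts]
    · rw [verts, run_cons]
      exact List.mem_cons_of_mem _ (ih (by simp) _)

lemma exists_of_mem_edges {w : List (Letter m)} {v : V} {e : Fin m × V × V}
    (h : e ∈ edges σ w v) : ∃ s a t, w = s ++ a :: t ∧ e = edge σ a (run σ s v) := by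
  induction w generalizing v with
  | nil => simp [edges] at h
  | cons a w ih =>
    rw [edges, List.mem_cons] at h
    rcases h with rfl | h
    · exact ⟨[], a, w, rfl, rfl⟩
    · obtain ⟨s, b, t, rfl, rfl⟩ := ih h
      exact ⟨a :: s, b, t, rfl, rfl⟩

lemma mem_edges_winv {w : List (Letter m)} {v : V} {e : Fin m × V × V} :
    e ∈ edges σ (winv w) (run σ w v) ↔ e ∈ edges σ w v := by
  induction w generalizing v with
  | nil => rfl
  | cons a w ih =>
    rw [winv_cons, edges_append, run_cons, List.mem_append, ih, run_winv_run]
    simp only [edges, edge_linv, List.mem_cons, List.not_mem_nil, or_false]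
    exact or_comm

variable [DecidableEq V]

lemma coinc_append (w w' : List (Letter m)) (S : Finset (Fin m × V × V)) (T : Finset V) (v : V) :
    coinc σ S T (w ++ w') v = coinc σ S T w v +
      coinc σ (S ∪ (edges σ w v).toFinset) (T ∪ (verts σ w v).toFinset) w' (run σ w v) := by
  induction w generalizing S T v with
  | nil => simp [coinc, edges, verts]
  | cons a w ih =>
    rw [List.cons_append, coinc, ih, coinc, edges, verts, run_cons, List.toFinset_cons,
      List.toFinset_cons, ← Finset.insert_union_comm, ← Finset.insert_union_comm, add_assoc]
    rfl

lemma one_le_coinc {w : List (Letter m)} {a : Letter m} {S : Finset (Fin m × V × V)}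
    {T : Finset V} {v : V} (h1 : edge σ a (run σ w v) ∉ S)
    (h2 : edge σ a (run σ w v) ∉ edges σ w v)
    (h3 : step σ a (run σ w v) ∈ T ∨ step σ a (run σ w v) ∈ verts σ w v) :
    1 ≤ coinc σ S T (w ++ [a]) v := by
  rw [coinc_append]
  refine le_add_left ?_
  rw [coinc, if_pos]
  · exact le_add_right le_rfl
  · change edge σ a (run σ w v) ∉ _ ∧ _
    simp [h1, h2, h3]

end Edges

section Spots

variable {m : ℕ} {V : Type*} (σ : Fin m → Equiv.Perm V)

/-- The edge from `v` along `a` lies on a short cycle. -/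
def IsSpot (L : ℕ) (a : Letter m) (v : V) : Prop :=
  ∃ b : List (Letter m), b.length ≤ L ∧ run σ b (step σ a v) = v ∧
    edge σ a v ∉ edges σ b (step σ a v)

variable {σ}

lemma IsSpot.linv {L : ℕ} {a : Letter m} {v : V} (h : IsSpot σ L a v) :
    IsSpot σ L (linv a) (step σ a v) := by
  obtain ⟨b, h1, h2, h3⟩ := h
  refine ⟨winv b, by simpa using h1, ?_, ?_⟩
  · rw [step_linv_step]
    conv_lhs => rw [← h2]
    rw [run_winv_run]
  · rw [step_linv_step, edge_linv]
    rw [← mem_edges_winv, h2] at h3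
    exact h3

/-- A closed reduced word contains a cycle whose first edge is not used again. -/
lemma exists_cycle_of_closed (n : ℕ) : ∀ (w : List (Letter m)) (v : V), w.length ≤ n → Reduced w →
    w ≠ [] → run σ w v = v → ∃ s c b t, w = s ++ (c :: b) ++ t ∧
      run σ b (step σ c (run σ s v)) = run σ s v ∧
      edge σ c (run σ s v) ∉ edges σ b (step σ c (run σ s v)) := by
  induction n with
  | zero =>
    intro w v hn _ hne
    exact absurd (List.length_eq_zero_iff.1 (by omega)) hne
  | succ n ih =>
    intro w v hn hr hne hclosed
    obtain ⟨c, b, rfl⟩ := List.exists_cons_of_ne_nil hne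
    by_cases hmem : edge σ c v ∈ edges σ b (step σ c v)
    · obtain ⟨s, x, t, rfl, hx⟩ := exists_of_mem_edges σ hmem
      have lift : ∀ (s' w' t' : List (Letter m)), c :: (s ++ x :: t) = s' ++ w' ++ t' →
          w'.length ≤ n → w' ≠ [] → run σ w' (run σ s' v) = run σ s' v →
          ∃ s₁ c₁ b₁ t₁, c :: (s ++ x :: t) = s₁ ++ (c₁ :: b₁) ++ t₁ ∧
            run σ b₁ (step σ c₁ (run σ s₁ v)) = run σ s₁ v ∧
            edge σ c₁ (run σ s₁ v) ∉ edges σ b₁ (step σ c₁ (run σ s₁ v)) := by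
        intro s' w' t' h1 h2 h3 h4
        obtain ⟨s₁, c₁, b₁, t₁, e1, e2, e3⟩ := ih w' (run σ s' v) h2
          (hr.of_infix ⟨s', t', h1.symm⟩) h3 h4
        refine ⟨s' ++ s₁, c₁, b₁, t₁ ++ t', ?_, ?_, ?_⟩
        · rw [h1, e1]
          simp
        · rw [run_append, e2]
        · rwa [run_append]
      have hlen : s.length + 1 ≤ n := by simp at hn; omega
      rcases edge_eq_edge σ hx with ⟨h1, h2⟩ | ⟨h1, h2⟩
      · exact lift [] (c :: s) (x :: t) (by simp) (by simpa using hlen) (by simp) h2.symm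
      · rcases s with _ | ⟨y, s⟩
        · rw [List.nil_append, reduced_cons_cons] at hr
          exact absurd (by rw [h1, linv_linv]) hr.1
        · refine lift [c] (y :: s) (x :: t) (by simp) (by simp at hlen ⊢; omega) (by simp) ?_
          rw [h1] at h2
          have := congrArg (step σ (linv x)) h2
          rw [step_linv_step] at this
          rw [run_cons σ c, run_nil, h1]
          exact this.symm
    · refine ⟨[], c, b, [], by simp, hclosed, hmem⟩

variable [DecidableEq V]

lemma one_le_coinc_of_cycle {a : Letter m} {v : V} {b : List (Letter m)}
    (h1 : run σ b (step σ a v) = v) (h2 : edge σ a v ∉ edges σ b (step σ a v)) :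
    1 ≤ coinc σ ∅ {step σ a v} (b ++ [a]) (step σ a v) := by
  refine one_le_coinc σ (by simp) (by rwa [h1]) (Or.inl (by rw [h1]; simp))

variable (σ) in
/-- No short walk has two coincidences. -/
def TangleFree (M : ℕ) : Prop := ∀ v w, w.length ≤ M → coinc σ ∅ {v} w v ≤ 1

lemma not_tangleFree_of_path {L D : ℕ} {a a' : Letter m} {v v' : V} {b p : List (Letter m)}
    (hb : b.length ≤ L) (h1 : run σ b (step σ a v) = v)
    (h2 : edge σ a v ∉ edges σ b (step σ a v)) (h3 : edge σ a' v' ∉ edges σ b (step σ a v))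
    (h4 : edge σ a' v' ≠ edge σ a v) (h5 : IsSpot σ L a' v') (hp : p.length ≤ D)
    (h6 : run σ p (step σ a v) = step σ a' v') (h7 : edge σ a' v' ∉ edges σ p (step σ a v)) :
    ¬ TangleFree σ (2 * L + D + 2) := by
  intro htf
  obtain ⟨b', g1, g2, g3⟩ := h5
  have hrun : run σ (b ++ [a]) (step σ a v) = step σ a v := by rw [run_append, h1]; rfl
  have hrun2 : run σ (p ++ b') (step σ a v) = v' := by rw [run_append, h6, g2]
  have := htf (step σ a v) ((b ++ [a]) ++ ((p ++ b') ++ [a'])) (by simp; omega)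
  rw [coinc_append] at this
  have c1 := one_le_coinc_of_cycle h1 h2
  have c2 : 1 ≤ coinc σ (∅ ∪ (edges σ (b ++ [a]) (step σ a v)).toFinset)
      ({step σ a v} ∪ (verts σ (b ++ [a]) (step σ a v)).toFinset) ((p ++ b') ++ [a'])
      (run σ (b ++ [a]) (step σ a v)) := by
    rw [hrun]
    refine one_le_coinc σ ?_ ?_ ?_
    · rw [hrun2, edges_append, h1]
      simp [edges, h3, h4]
    · rw [hrun2, edges_append, h6]
      simp [h7, g3]
    · rw [hrun2]
      rcases p with _ | ⟨x, p⟩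
      · left
        rw [← h6]
        simp
      · right
        rw [verts_append, List.mem_append, ← h6]
        exact Or.inl (run_mem_verts σ (by simp) _)
  omega

/-- In a tangle-free graph, two distinct short cycles are far apart. -/
lemma not_tangleFree_of_near {L D : ℕ} {a a' : Letter m} {v v' : V} {b p : List (Letter m)}
    (hb : b.length ≤ L) (h1 : run σ b (step σ a v) = v)
    (h2 : edge σ a v ∉ edges σ b (step σ a v)) (h3 : edge σ a' v' ∉ edges σ b (step σ a v))
    (h4 : edge σ a' v' ≠ edge σ a v) (h5 : IsSpot σ L a' v') (hp : p.length ≤ D)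
    (h6 : run σ p (step σ a v) = v') : ¬ TangleFree σ (2 * L + D + 2) := by
  have hex : ∃ n, ∃ q : List (Letter m), q.length = n ∧
      (run σ q (step σ a v) = v' ∨ run σ q (step σ a v) = step σ a' v') :=
    ⟨_, p, rfl, Or.inl h6⟩
  obtain ⟨q, hq1, hq2⟩ := Nat.find_spec hex
  have hqD : q.length ≤ D := by
    rw [hq1]
    exact (Nat.find_min' hex ⟨p, rfl, Or.inl h6⟩).trans hp
  have hq3 : edge σ a' v' ∉ edges σ q (step σ a v) := by
    intro hmem
    obtain ⟨s, x, t, rfl, hx⟩ := exists_of_mem_edges σ hmem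
    refine Nat.find_min hex (m := s.length) ?_ ⟨s, rfl, ?_⟩
    · rw [← hq1]
      simp
    · rcases edge_eq_edge σ hx.symm with ⟨-, h⟩ | ⟨-, h⟩
      · exact Or.inl h
      · exact Or.inr h
  rcases hq2 with hq2 | hq2
  · refine not_tangleFree_of_path (a' := linv a') (v' := step σ a' v') hb h1 h2 ?_ ?_ h5.linv hqD
      ?_ ?_
    · rwa [edge_linv]
    · rwa [edge_linv]
    · rw [hq2, step_linv_step]
    · rwa [edge_linv]
  · exact not_tangleFree_of_path hb h1 h2 h3 h4 h5 hqD hq2 hq3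

end Spots

section Far

variable {m : ℕ} {V : Type*} {σ : Fin m → Equiv.Perm V}

variable (σ) in
/-- No walk of length at most `D` leads from `p` to `q`. -/
def Far (D : ℕ) (p q : V) : Prop := ∀ w : List (Letter m), w.length ≤ D → run σ w p ≠ q

lemma Far.symm {D : ℕ} {p q : V} (h : Far σ D p q) : Far σ D q p := by
  intro w hw hrun
  refine h (winv w) (by simpa using hw) ?_
  rw [← hrun, run_winv_run]

lemma Far.mono {D D' : ℕ} (hD : D' ≤ D) {p q : V} (h : Far σ D p q) : Far σ D' p q :=
  fun w hw => h w (hw.trans hD)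

variable [DecidableEq V] [Fintype V]

/-- The short cycles of a tangle-free graph all meet a well-separated set of edges. -/
lemma exists_spots (L D : ℕ) (htf : TangleFree σ (2 * L + (D + 1) + 2)) :
    ∃ F : Finset (Fin m × V), (∀ e ∈ F, IsSpot σ L (e.1, true) e.2) ∧
      (∀ e ∈ F, ∀ e' ∈ F, e ≠ e' → Far σ D e.2 e'.2) ∧
      ∀ (w : List (Letter m)) (v : V), w.length ≤ L → Reduced w → w ≠ [] → run σ w v = v →
        ∃ e ∈ F, edge σ (e.1, true) e.2 ∈ edges σ w v := by
  set P : Finset (Finset (Fin m × V)) := Finset.univ.filter fun F =>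
    (∀ e ∈ F, IsSpot σ L (e.1, true) e.2) ∧
      (∀ e ∈ F, ∀ e' ∈ F, e ≠ e' → Far σ D e.2 e'.2) with hP
  have hne : P.Nonempty := ⟨∅, by simp [hP]⟩
  obtain ⟨F, hF, hmax⟩ := Finset.exists_max_image P Finset.card hne
  have hF' := hF
  simp only [hP, Finset.mem_filter, Finset.mem_univ, true_and] at hF'
  refine ⟨F, hF'.1, hF'.2, fun w v hw hr hne hclosed => ?_⟩
  by_contra! hcon
  obtain ⟨s, c, b, t, rfl, hb1, hb2⟩ := exists_cycle_of_closed _ w v le_rfl hr hne hclosed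
  set v₀ := run σ s v
  have hbL : b.length + 1 ≤ L := by simp at hw; omega
  have hspot : IsSpot σ L c v₀ := ⟨b, by omega, hb1, hb2⟩
  have hsub : ∀ e ∈ F, edge σ (e.1, true) e.2 ≠ edge σ c v₀ ∧
      edge σ (e.1, true) e.2 ∉ edges σ b (step σ c v₀) := by
    intro e he
    have h := hcon e he
    rw [edges_append, edges_append, List.mem_append, List.mem_append, edges, List.mem_cons] at h
    push Not at h
    exact h.1.2
  obtain ⟨i, u, hspot', hedge, q, hq, hqu⟩ : ∃ i u, IsSpot σ L (i, true) u ∧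
      edge σ (i, true) u = edge σ c v₀ ∧
      ∃ q : List (Letter m), q.length ≤ 1 ∧ run σ q (step σ c v₀) = u := by
    rcases c with ⟨i, _ | _⟩
    · refine ⟨i, step σ (i, false) v₀, hspot.linv, edge_linv σ (i, false) v₀, [], by simp, rfl⟩
    · exact ⟨i, v₀, hspot, rfl, [linv (i, true)], by simp, by simp⟩
  have hnotin : (i, u) ∉ F := fun h => (hsub _ h).1 hedge
  have hins : insert (i, u) F ∉ P := by
    intro h
    have := hmax _ h
    rw [Finset.card_insert_of_notMem hnotin] at this
    omega
  obtain ⟨e, he, hnf⟩ : ∃ e ∈ F, ¬ Far σ D u e.2 := by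
    by_contra! hall
    refine hins ?_
    simp only [hP, Finset.mem_filter, Finset.mem_univ, true_and, Finset.mem_insert]
    refine ⟨?_, ?_⟩
    · rintro e (rfl | he)
      · exact hspot'
      · exact hF'.1 e he
    · rintro e (rfl | he) e' (rfl | he') hne'
      · exact absurd rfl hne'
      · exact hall e' he'
      · exact (hall e he).symm
      · exact hF'.2 e he e' he' hne'
  simp only [Far, not_forall, not_not] at hnf
  obtain ⟨p, hp, hpe⟩ := hnf
  refine not_tangleFree_of_near (L := L) (D := D + 1) (b := b) (p := q ++ p) (by omega) hb1 hb2
    (hsub e he).2 (hsub e he).1 (hF'.1 e he) ?_ ?_ htf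
  · simp
    omega
  · rw [run_append, hqu, hpe]

end Far

section Surgery

variable {m : ℕ} {V : Type*}

/-- A well-separated family of pairs of edges, indexed by `J`. The edges `mark j false` meet all
short cycles, while the edges `mark j true` lie in regions without short cycles. -/
structure Marking (σ : Fin m → Equiv.Perm V) (L D : ℕ) (J : Type*) where
  /-- The common label of the edges of a pair. -/
  lab : J → Fin m
  /-- The sources of the edges of a pair. -/
  mark : J → Bool → V
  far : ∀ i s j t, (i, s) ≠ (j, t) → Far σ D (mark i s) (mark j t)
  free : ∀ j w, w.length ≤ L + 1 → Reduced w → w ≠ [] → run σ w (mark j true) ≠ mark j true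
  free_target : ∀ j w, w.length ≤ L + 1 → Reduced w → w ≠ [] →
    run σ w (step σ (lab j, true) (mark j true)) ≠ step σ (lab j, true) (mark j true)
  meets : ∀ w v, w.length ≤ L → Reduced w → w ≠ [] → run σ w v = v →
    ∃ j, edge σ (lab j, true) (mark j false) ∈ edges σ w v

namespace Marking

variable {σ : Fin m → Equiv.Perm V} {L D : ℕ} {J : Type*} (K : Marking σ L D J)

/-- The start of the walk along an edge of a pair in a given direction. -/
def pt (j : J) (s e : Bool) : V := if e then K.mark j s else step σ (K.lab j, true) (K.mark j s)

lemma step_pt (j : J) (s e : Bool) : step σ (K.lab j, e) (K.pt j s e) = K.pt j s (!e) := by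
  cases e
  · exact step_linv_step σ (K.lab j, true) (K.mark j s)
  · rfl

lemma exists_run_mark (j : J) (s e : Bool) : ∃ q : List (Letter m), q.length ≤ 1 ∧
    run σ q (K.mark j s) = K.pt j s e := by
  cases e
  · exact ⟨[(K.lab j, true)], le_rfl, rfl⟩
  · exact ⟨[], by simp, rfl⟩

lemma eq_of_run_mark {i j : J} {s t : Bool} {w : List (Letter m)} (hw : w.length ≤ D)
    (h : run σ w (K.mark i s) = K.mark j t) : (i, s) = (j, t) := by
  by_contra hne
  exact K.far i s j t hne w hw h

lemma eq_of_run_mark_pt {i j : J} {s t e : Bool} {w : List (Letter m)} (hw : w.length + 1 ≤ D)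
    (h : run σ w (K.mark i s) = K.pt j t e) : (i, s) = (j, t) := by
  obtain ⟨q, hq, hq'⟩ := K.exists_run_mark j t e
  refine K.eq_of_run_mark (w := w ++ winv q) ?_ ?_
  · simp
    omega
  · rw [run_append, h, ← hq', run_winv_run]

lemma eq_of_run_pt {i j : J} {s t e e' : Bool} {w : List (Letter m)} (hw : w.length + 2 ≤ D)
    (h : run σ w (K.pt i s e) = K.pt j t e') : (i, s) = (j, t) := by
  obtain ⟨q, hq, hq'⟩ := K.exists_run_mark i s e
  refine K.eq_of_run_mark_pt (e := e') (w := q ++ w) ?_ ?_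
  · simp
    omega
  · rw [run_append, hq', h]

lemma mark_injective {i j : J} {s t : Bool} (h : K.mark i s = K.mark j t) : (i, s) = (j, t) :=
  K.eq_of_run_mark (w := []) (Nat.zero_le _) h

/-- Exchanges the sources of the pairs with a given label. -/
noncomputable def exchange (i : Fin m) (v : V) : V :=
  if h : ∃ p : J × Bool, K.lab p.1 = i ∧ K.mark p.1 p.2 = v then
    K.mark h.choose.1 (!h.choose.2) else v

lemma exchange_mark (j : J) (s : Bool) : K.exchange (K.lab j) (K.mark j s) = K.mark j (!s) := by
  have h : ∃ p : J × Bool, K.lab p.1 = K.lab j ∧ K.mark p.1 p.2 = K.mark j s := ⟨(j, s), rfl, rfl⟩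
  rw [exchange, dif_pos h]
  have h2 : h.choose = (j, s) := K.mark_injective h.choose_spec.2
  rw [h2]

lemma exchange_of_not {i : Fin m} {v : V} (h : ∀ j s, K.lab j = i → K.mark j s ≠ v) :
    K.exchange i v = v := by
  rw [exchange, dif_neg]
  rintro ⟨p, h1, h2⟩
  exact h p.1 p.2 h1 h2

lemma exchange_involutive (i : Fin m) : Function.Involutive (K.exchange i) := by
  intro v
  by_cases h : ∃ j s, K.lab j = i ∧ K.mark j s = v
  · obtain ⟨j, s, rfl, rfl⟩ := h
    rw [exchange_mark, exchange_mark, Bool.not_not]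
  · push Not at h
    rw [K.exchange_of_not h, K.exchange_of_not h]

/-- The graph obtained by exchanging the sources of the two edges of every pair. -/
noncomputable def surgery (i : Fin m) : Equiv.Perm V := σ i * (K.exchange_involutive i).toPerm

/-- The edge traversed from `v` along `a` belongs to one of the pairs. -/
def Moved (a : Letter m) (v : V) : Prop := ∃ j s, a.1 = K.lab j ∧ v = K.pt j s a.2

lemma step_surgery_true (i : Fin m) (v : V) :
    step K.surgery (i, true) v = step σ (i, true) (K.exchange i v) := rfl

lemma step_surgery_pt (j : J) (s e : Bool) :
    step K.surgery (K.lab j, e) (K.pt j s e) = K.pt j (!s) (!e) := by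
  have key : ∀ s, step K.surgery (K.lab j, true) (K.pt j s true) = K.pt j (!s) false := by
    intro s
    rw [step_surgery_true]
    change step σ _ (K.exchange _ (K.mark j s)) = _
    rw [exchange_mark]
    rfl
  cases e
  · have := key (!s)
    rw [Bool.not_not] at this
    rw [← this]
    exact step_linv_step K.surgery (K.lab j, true) _
  · exact key s

lemma step_surgery_of_not_moved {a : Letter m} {v : V} (h : ¬ K.Moved a v) :
    step K.surgery a v = step σ a v := by
  rcases a with ⟨i, _ | _⟩
  · have h1 : K.exchange i (step σ (i, false) v) = step σ (i, false) v := by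
      refine K.exchange_of_not ?_
      rintro j s rfl hv
      refine h ⟨j, s, rfl, ?_⟩
      have := congrArg (step σ (K.lab j, true)) hv
      rw [show (K.lab j, false) = linv (K.lab j, true) from rfl, step_step_linv] at this
      exact this.symm
    have h2 : step K.surgery (i, true) (step σ (i, false) v) = v := by
      rw [step_surgery_true, h1]
      exact step_step_linv σ (i, true) v
    conv_lhs => rw [← h2]
    exact step_linv_step K.surgery (i, true) _
  · rw [step_surgery_true, K.exchange_of_not]
    rintro j s rfl hv
    exact h ⟨j, s, rfl, hv.symm⟩

/-- A walk agrees with the original one up to the first time that it uses a moved edge. -/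
lemma exists_first_moved (w : List (Letter m)) (v : V) :
    (∃ s b t, w = s ++ b :: t ∧ run K.surgery s v = run σ s v ∧ K.Moved b (run σ s v)) ∨
      (run K.surgery w v = run σ w v ∧ ∀ s b t, w = s ++ b :: t → ¬ K.Moved b (run σ s v)) := by
  induction w generalizing v with
  | nil => exact Or.inr ⟨rfl, by simp⟩
  | cons a w ih =>
    by_cases ha : K.Moved a v
    · exact Or.inl ⟨[], a, w, rfl, rfl, ha⟩
    have hstep := K.step_surgery_of_not_moved ha
    rcases ih (step σ a v) with ⟨s, b, t, rfl, h1, h2⟩ | ⟨h1, h2⟩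
    · exact Or.inl ⟨a :: s, b, t, rfl, by rw [run_cons, hstep, h1, run_cons], h2⟩
    · refine Or.inr ⟨by rw [run_cons, hstep, h1, run_cons], fun s b t h => ?_⟩
      rcases s with _ | ⟨c, s⟩
      · simp only [List.nil_append, List.cons.injEq] at h
        rwa [← h.1]
      · simp only [List.cons_append, List.cons.injEq] at h
        rw [← h.1]
        exact h2 s b t h.2

lemma free_pt (j : J) (e : Bool) {w : List (Letter m)} (hw : w.length ≤ L + 1) (hr : Reduced w)
    (hne : w ≠ []) : run σ w (K.pt j true e) ≠ K.pt j true e := by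
  cases e
  · exact K.free_target j w hw hr hne
  · exact K.free j w hw hr hne

/-- After an exchanged edge has been used to enter a region without short cycles, no exchanged edge
can be used for a long time. -/
lemma not_moved_of_entering (hD : L + 2 ≤ D) {j : J} {e : Bool} {s : List (Letter m)}
    {b : Letter m} (hs : s.length ≤ L) (hr : Reduced ((K.lab j, e) :: s ++ [b])) :
    ¬ K.Moved b (run σ s (K.pt j true (!e))) := by
  rintro ⟨j', t, hb, hrun⟩
  have hjt := K.eq_of_run_pt (by omega) hrun
  obtain ⟨rfl, rfl⟩ : j = j' ∧ true = t := by simpa using hjt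
  have hcase : b.2 = e ∨ b.2 = !e := by cases b.2 <;> cases e <;> simp
  rcases hcase with he | he
  · refine K.free_pt j e (w := (K.lab j, e) :: s) (by simpa using hs)
      (hr.of_infix (List.prefix_append _ _).isInfix) (by simp) ?_
    rw [run_cons, step_pt, hrun, he]
  · have hb' : b = linv (K.lab j, e) := Prod.ext hb he
    rcases s with _ | ⟨c, s⟩
    · exact (reduced_cons_cons.1 hr).1 hb'
    · refine K.free_pt j (!e) (w := c :: s) (by omega)
        (hr.of_infix ⟨[(K.lab j, e)], [b], by simp⟩) (by simp) ?_
      rw [hrun, he]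

lemma surgery_not_closed_of_entering (hD : L + 2 ≤ D) {j : J} {e : Bool} {w : List (Letter m)}
    (hw : w.length ≤ L) (hr : Reduced ((K.lab j, e) :: w ++ [(K.lab j, e)])) :
    run K.surgery ((K.lab j, e) :: w) (K.pt j false e) ≠ K.pt j false e := by
  intro hrun
  rw [run_cons, step_surgery_pt, Bool.not_false] at hrun
  rcases K.exists_first_moved w (K.pt j true !e) with ⟨s, b, t, rfl, h1, h2⟩ | ⟨h1, -⟩
  · refine K.not_moved_of_entering hD (s := s) (b := b) (by simp at hw; omega) ?_ h2
    exact hr.of_infix ⟨[], t ++ [(K.lab j, e)], by simp⟩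
  · refine K.not_moved_of_entering hD hw hr ⟨j, false, rfl, ?_⟩
    rw [← h1, hrun]

lemma surgery_not_closed_of_moved (hD : L + 2 ≤ D) {a : Letter m} {v : V} {w : List (Letter m)}
    (hw : w.length ≤ L) (hr : Reduced (a :: w ++ [a])) (ha : K.Moved a v) :
    run K.surgery (a :: w) v ≠ v := by
  intro hrun
  obtain ⟨j, s, h1, rfl⟩ := ha
  obtain ⟨i, e⟩ := a
  obtain rfl : i = K.lab j := h1
  cases s
  · exact K.surgery_not_closed_of_entering hD hw hr hrun
  · have hstep := K.step_surgery_pt j true e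
    rw [run_cons, hstep] at hrun
    refine K.surgery_not_closed_of_entering hD (j := j) (e := !e) (w := winv w) (by simpa using hw)
      ?_ ?_
    · have := hr.winv
      rw [List.cons_append, winv_cons] at this
      simpa [winv, linv] using this
    · have h2 := K.step_surgery_pt j false (!e)
      rw [run_cons, h2, Bool.not_false, Bool.not_not]
      conv_lhs => rw [← hrun]
      rw [run_winv_run]
      rfl

/-- The surgery destroys all short cycles. -/
theorem surgery_not_closed (hD : L + 2 ≤ D) {w : List (Letter m)} (hw : w.length ≤ L)
    (hne : w ≠ []) (hr : Reduced (w ++ w)) (v : V) : run K.surgery w v ≠ v := by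
  intro hrun
  rcases K.exists_first_moved w v with ⟨s, a, t, rfl, h1, h2⟩ | ⟨h1, h2⟩
  · refine K.surgery_not_closed_of_moved hD (a := a) (v := run σ s v) (w := t ++ s) ?_ ?_ h2 ?_
    · simp at hw ⊢
      omega
    · exact hr.of_infix ⟨s, t, by simp⟩
    · rw [← h1, ← List.cons_append, run_append, ← run_append K.surgery s (a :: t), hrun]
  · rw [hrun] at h1
    obtain ⟨j, hj⟩ := K.meets w v hw (hr.of_infix (List.prefix_append _ _).isInfix) hne h1.symm
    obtain ⟨s, a, t, rfl, he⟩ := exists_of_mem_edges σ hj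
    refine h2 s a t rfl ?_
    rcases edge_eq_edge σ he.symm with ⟨rfl, h⟩ | ⟨rfl, h⟩
    · exact ⟨j, false, rfl, h⟩
    · exact ⟨j, false, rfl, h⟩

end Marking

end Surgery

/-- A graph without short closed cyclically reduced words has no short closed reduced words. -/
lemma eq_nil_of_closed {m : ℕ} {V : Type*} {σ : Fin m → Equiv.Perm V} {L : ℕ}
    (h : ∀ w : List (Letter m), w.length ≤ L → w ≠ [] → Reduced (w ++ w) → ∀ v, run σ w v ≠ v) :
    ∀ (n : ℕ) (w : List (Letter m)) (v : V), w.length ≤ n → n ≤ L → Reduced w → run σ w v = v →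
      w = [] := by
  intro n
  induction n using Nat.strong_induction_on with
  | _ n ih =>
    intro w v hw hn hr hrun
    by_contra hne
    by_cases hcyc : Reduced (w ++ w)
    · exact h w (by omega) hne hcyc v hrun
    obtain ⟨a, w, rfl⟩ := List.exists_cons_of_ne_nil hne
    rcases List.eq_nil_or_concat w with rfl | ⟨t, b, rfl⟩
    · exact hcyc (reduced_cons_cons.2 ⟨(linv_ne a).symm, Reduced.singleton a⟩)
    · rw [List.concat_eq_append] at *
      have hb : b = linv a := by
        by_contra hb
        refine hcyc (List.isChain_append.2 ⟨hr, hr, ?_⟩)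
        intro x hx y hy
        simp only [List.head?_cons, Option.mem_def, Option.some.injEq] at hy
        rw [← List.cons_append, List.getLast?_concat, Option.mem_def, Option.some.injEq] at hx
        subst hx hy
        exact ne_linv_comm.1 hb
      subst hb
      have ht : t = [] := by
        refine ih (n - 1) (by simp at hw; omega) t (step σ a v) (by simp at hw; omega) (by omega)
          (hr.of_infix ⟨[a], [linv a], by simp⟩) ?_
        rw [run_cons, run_append, run_cons, run_nil] at hrun
        have := congrArg (step σ a) hrun
        rwa [step_step_linv] at this
      subst ht
      exact (reduced_cons_cons.1 hr).1 rfl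

/-- Reduced words are determined by their endpoint if there are no short closed ones. -/
lemma eq_of_run_eq {m : ℕ} {V : Type*} {σ : Fin m → Equiv.Perm V} {L : ℕ}
    (h : ∀ (w : List (Letter m)) (v : V), w.length ≤ L → Reduced w → run σ w v = v → w = [])
    {w w' : List (Letter m)} (hr : Reduced w) (hr' : Reduced w') (hL : w.length + w'.length ≤ L)
    {v : V} (hrun : run σ w v = run σ w' v) : w = w' := by
  induction w using List.reverseRecOn generalizing w' with
  | nil => exact (h w' v (by simpa using hL) hr' hrun.symm).symm
  | append_singleton s a ih =>
    rcases List.eq_nil_or_concat w' with rfl | ⟨t, b, rfl⟩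
    · exact h _ v (by simpa using hL) hr hrun
    rw [List.concat_eq_append] at *
    by_cases hab : a = b
    · subst hab
      rw [run_append, run_append] at hrun
      rw [ih (hr.of_infix (List.prefix_append _ _).isInfix)
        (hr'.of_infix (List.prefix_append _ _).isInfix)
        (by simp at hL; omega) (run_injective σ [a] hrun)]
    · exfalso
      have := h ((s ++ [a]) ++ winv (t ++ [b])) v (by simp at hL ⊢; omega) ?_ ?_
      · simp at this
      · refine List.isChain_append.2 ⟨hr, hr'.winv, ?_⟩
        intro x hx y hy
        rw [List.getLast?_concat, Option.mem_def, Option.some.injEq] at hx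
        simp only [winv, List.map_append, List.map_cons, List.map_nil, List.reverse_append,
          List.reverse_singleton, List.singleton_append, List.head?_cons, Option.mem_def,
          Option.some.injEq] at hy
        subst hx hy
        exact fun hcon => hab (linv_injective hcon).symm
      · rw [run_append, hrun, run_winv_run]

open Polynomial Matrix

section Eigenvectors

variable {m N : ℕ} (σ : Fin m → Equiv.Perm (Fin N))

lemma specBound_of_eigenvector (hN : 0 < N) {ρ : ℝ} (hρ : 0 ≤ ρ)
    (h : ∀ (μ : ℝ) (f : Fin N → ℝ), ∑ v, f v = 0 → ∑ v, f v ^ 2 = 1 → adjMat σ *ᵥ f = μ • f →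
      |μ| ≤ ρ) : SpecBound σ ρ := by
  obtain ⟨P, μ, h1, h2, h3⟩ := exists_orthogonal_diagonalization (centMat_isHermitian σ)
  have hcent : ∀ g : Fin N → ℝ, ∑ v, g v = 0 → centMat σ *ᵥ g = adjMat σ *ᵥ g := by
    intro g hg
    ext v
    simp [centMat, mulVec, dotProduct, sub_mul, ← Finset.mul_sum, hg]
  have hμ : ∀ i, |μ i| ≤ ρ := by
    intro i
    by_contra! hcon
    have hμ0 : μ i ≠ 0 := by
      intro h0
      rw [h0, abs_zero] at hcon
      linarith
    set f : Fin N → ℝ := fun v => P v i with hf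
    have hPf : Pᵀ *ᵥ f = Pi.single i 1 := by
      ext j
      have := congrFun (congrFun h2 j) i
      rw [mul_apply, one_apply] at this
      simp only [mulVec, dotProduct, hf, Pi.single_apply]
      exact this
    have hsq : ∑ v, f v ^ 2 = 1 := by
      have := congrFun (congrFun h2 i) i
      rw [mul_apply, one_apply_eq] at this
      rw [← this]
      exact Finset.sum_congr rfl fun v _ => by simp [hf, sq]
    have heig : centMat σ *ᵥ f = μ i • f := by
      rw [h3, ← mulVec_mulVec, ← mulVec_mulVec, hPf]
      ext v
      simp [hf, mul_comm]
    have hsum : ∑ v, f v = 0 := by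
      have h4 := congrArg (fun M : Matrix (Fin N) (Fin N) ℝ => (M *ᵥ f) ⟨0, hN⟩)
        (of_one_mul_centMat σ hN)
      simp only [← mulVec_mulVec, heig] at h4
      simp only [mulVec_smul, zero_mulVec, Pi.smul_apply, Pi.zero_apply, smul_eq_mul,
        mul_eq_zero, hμ0, false_or] at h4
      simpa [mulVec, dotProduct] using h4
    rw [hcent f hsum] at heig
    exact absurd (h (μ i) f hsum hsq heig) (not_le.2 hcon)
  intro g hg
  rw [← hcent g hg, h3, dotProduct_conj_diagonal_mulVec, ← sum_sq_transpose_mulVec h1 g,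
    Finset.mul_sum]
  refine (Finset.abs_sum_le_sum_abs _ _).trans (Finset.sum_le_sum fun i _ => ?_)
  rw [abs_mul, abs_of_nonneg (sq_nonneg ((Pᵀ *ᵥ g) i))]
  exact mul_le_mul_of_nonneg_right (hμ i) (sq_nonneg _)

variable {σ}

lemma aeval_adjMat_mulVec {μ : ℝ} {f : Fin N → ℝ} (hf : adjMat σ *ᵥ f = μ • f) (p : ℝ[X]) :
    aeval (adjMat σ) p *ᵥ f = p.eval μ • f := by
  induction p using Polynomial.induction_on' with
  | add p q hp hq => rw [map_add, add_mulVec, hp, hq, eval_add, add_smul]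
  | monomial n a =>
    rw [aeval_monomial, eval_monomial, Algebra.algebraMap_eq_smul_one, smul_one_mul, smul_mulVec,
      mul_smul]
    congr 1
    induction n with
    | zero => simp
    | succ n ih => rw [pow_succ, ← mulVec_mulVec, hf, mulVec_smul, ih, smul_smul, pow_succ']

/-- An eigenvector outside the tree spectrum grows along the tree. -/
lemma sq_mul_le_sum_redWords (hm : 2 ≤ m) {μ : ℝ} {f : Fin N → ℝ} (hf : adjMat σ *ᵥ f = μ • f)
    (hμ : 2 * rad m ≤ |μ|) (R : ℕ) (v : Fin N) :
    f v ^ 2 * (R + 1) ^ 2 ≤ 4 * m ^ 2 * ∑ w ∈ redWords m (R + 2), f (run σ w v) ^ 2 := by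
  have hm0 : 0 < m := by omega
  have hm' : (2 : ℝ) ≤ m := by exact_mod_cast hm
  have hr : 0 < rad m := lt_of_lt_of_le one_pos (one_le_rad hm0)
  have hr2 := rad_sq hm0
  have h1 : ((treePoly (rad m ^ 2) (R + 2)).eval μ - (treePoly (rad m ^ 2) R).eval μ) * f v =
      ∑ w ∈ redWords m (R + 2), f (run σ w v) := by
    have h := congrFun (congrArg (fun M => M *ᵥ f) (aeval_treePoly_add_two σ hm0 hr2 R)) v
    simp only [add_mulVec, aeval_adjMat_mulVec hf, Pi.add_apply, Pi.smul_apply, smul_eq_mul] at h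
    rw [sub_mul, h, add_sub_cancel_right, redSum, Matrix.sum_mulVec, Finset.sum_apply]
    exact Finset.sum_congr rfl fun w _ => wordMat_mulVec σ w f v
  have h2 := le_abs_eval_treePoly_sub hr (by rw [hr2]; linarith) hμ R
  set T := (treePoly (rad m ^ 2) (R + 2)).eval μ - (treePoly (rad m ^ 2) R).eval μ
  have h3 : (rad m ^ R * (R + 1)) ^ 2 ≤ T ^ 2 := by
    rw [← sq_abs T]
    exact pow_le_pow_left₀ (by positivity) h2 2
  have h4 : (T * f v) ^ 2 ≤ (redWords m (R + 2)).card * ∑ w ∈ redWords m (R + 2),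
      f (run σ w v) ^ 2 := by
    rw [h1]
    exact sq_sum_le_card_mul_sum_sq
  have h5 : ((redWords m (R + 2)).card : ℝ) = 2 * m * rad m ^ 2 * (rad m ^ R) ^ 2 := by
    rw [card_redWords_le]
    push_cast [Nat.cast_sub (show 1 ≤ 2 * m by omega)]
    rw [← hr2]
    ring
  set S := ∑ w ∈ redWords m (R + 2), f (run σ w v) ^ 2
  have hS : 0 ≤ S := Finset.sum_nonneg fun _ _ => sq_nonneg _
  have h6 : 0 < (rad m ^ R) ^ 2 := by positivity
  refine le_of_mul_le_mul_left ?_ h6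
  calc (rad m ^ R) ^ 2 * (f v ^ 2 * (R + 1) ^ 2) = (rad m ^ R * (R + 1)) ^ 2 * f v ^ 2 := by ring
    _ ≤ T ^ 2 * f v ^ 2 := by gcongr
    _ = (T * f v) ^ 2 := by ring
    _ ≤ 2 * m * rad m ^ 2 * (rad m ^ R) ^ 2 * S := by rw [← h5]; exact h4
    _ ≤ 2 * m * (2 * m) * (rad m ^ R) ^ 2 * S := by
      gcongr
      rw [hr2]
      linarith
    _ = _ := by ring

end Eigenvectors

namespace Marking

section Clusters

variable {m : ℕ} {V : Type*} {σ : Fin m → Equiv.Perm V} {L D : ℕ} {J : Type*}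
  (K : Marking σ L D J)

/-- Walks of the new graph that start near a pair of edges remain near that pair. -/
lemma exists_run_mark_of_surgery (j : J) (s e : Bool) (w : List (Letter m))
    (hw : w.length + 1 ≤ D) : ∃ (t : Bool) (q : List (Letter m)), q.length ≤ w.length + 1 ∧
      run σ q (K.mark j t) = run K.surgery w (K.pt j s e) := by
  induction w using List.reverseRecOn with
  | nil =>
    obtain ⟨q, h1, h2⟩ := K.exists_run_mark j s e
    exact ⟨s, q, by simpa using h1, h2⟩
  | append_singleton w a ih =>
    rw [List.length_append, List.length_singleton] at hw
    obtain ⟨t, q, h1, h2⟩ := ih (by omega)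
    by_cases ha : K.Moved a (run K.surgery w (K.pt j s e))
    · obtain ⟨j', s', h3, h4⟩ := ha
      have h5 := K.eq_of_run_mark_pt (by omega) (h2.trans h4)
      obtain ⟨rfl, rfl⟩ : j = j' ∧ t = s' := by simpa using h5
      obtain ⟨i, e'⟩ := a
      obtain rfl : i = K.lab j := h3
      obtain ⟨q', h6, h7⟩ := K.exists_run_mark j (!t) (!e')
      refine ⟨!t, q', by simp; omega, ?_⟩
      rw [run_append, h4, h7]
      exact (K.step_surgery_pt j t e').symm
    · refine ⟨t, q ++ [a], by simp; omega, ?_⟩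
      rw [run_append, run_append, h2, run_cons, run_nil, run_cons, run_nil,
        K.step_surgery_of_not_moved ha]

lemma eq_of_surgery_run {i j : J} {s e : Bool} {R : ℕ} (hR : 2 * R + 2 ≤ D)
    {w w' : List (Letter m)} (hw : w.length ≤ R) (hw' : w'.length ≤ R)
    (h : run K.surgery w (K.pt i s e) = run K.surgery w' (K.pt j s e)) : i = j := by
  obtain ⟨t, q, h1, h2⟩ := K.exists_run_mark_of_surgery i s e w (by omega)
  obtain ⟨t', q', h1', h2'⟩ := K.exists_run_mark_of_surgery j s e w' (by omega)
  have h3 : run σ (q ++ winv q') (K.mark i t) = K.mark j t' := by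
    rw [run_append, h2, h, ← h2', run_winv_run]
  have := K.eq_of_run_mark (by simp; omega) h3
  simp_all

lemma surgery_eq_nil (hD : L + 2 ≤ D) (w : List (Letter m)) (v : V) (hw : w.length ≤ L)
    (hr : Reduced w) (h : run K.surgery w v = v) : w = [] :=
  eq_nil_of_closed (fun _ hw hne hr v => K.surgery_not_closed hD hw hne hr v) L w v hw le_rfl hr h

lemma sum_surgery_run_le [Fintype V] [Fintype J] (hD : L + 2 ≤ D) {R : ℕ} (hR : 2 * R ≤ L)
    (s e : Bool) (f : V → ℝ) :
    ∑ j, ∑ w ∈ redWords m R, f (run K.surgery w (K.pt j s e)) ^ 2 ≤ ∑ v, f v ^ 2 := by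
  rw [← Finset.sum_product' (f := fun j w => f (run K.surgery w (K.pt j s e)) ^ 2)]
  rw [← Finset.sum_image (g := fun p : J × List (Letter m) => run K.surgery p.2 (K.pt p.1 s e))
    (f := fun v => f v ^ 2)]
  · exact Finset.sum_le_univ_sum_of_nonneg fun _ => sq_nonneg _
  · rintro ⟨i, w⟩ hw ⟨j, w'⟩ hw' h
    simp only [Finset.coe_product, Finset.coe_univ, Set.mem_prod, Set.mem_univ, true_and,
      Finset.mem_coe, mem_redWords] at hw hw'
    obtain rfl : i = j := K.eq_of_surgery_run (R := R) (by omega) hw.1.le hw'.1.le h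
    rw [eq_of_run_eq (K.surgery_eq_nil hD) hw.2 hw'.2 (by omega) h]

end Clusters

section Spectrum

variable {m N : ℕ} {σ : Fin m → Equiv.Perm (Fin N)} {L D : ℕ} {J : Type*} [Fintype J]
  (K : Marking σ L D J)

lemma abs_surgery_sub_le (f : Fin N → ℝ) (hD : 2 ≤ D) :
    |f ⬝ᵥ adjMat K.surgery *ᵥ f - f ⬝ᵥ adjMat σ *ᵥ f| ≤
      2 * ∑ j, ∑ s : Bool, ∑ e : Bool, f (K.pt j s e) ^ 2 := by
  have h1 : f ⬝ᵥ adjMat K.surgery *ᵥ f - f ⬝ᵥ adjMat σ *ᵥ f =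
      ∑ p : Letter m × Fin N, f p.2 * (f (step K.surgery p.1 p.2) - f (step σ p.1 p.2)) := by
    simp only [dotProduct, adjMat_mulVec, ← Finset.sum_sub_distrib, ← mul_sub]
    rw [Fintype.sum_prod_type_right]
    simp only [Finset.mul_sum]
  have h2 : ∑ p : Letter m × Fin N, f p.2 * (f (step K.surgery p.1 p.2) - f (step σ p.1 p.2)) =
      ∑ p : J × Bool × Bool, f (K.pt p.1 p.2.1 p.2.2) *
        (f (K.pt p.1 (!p.2.1) (!p.2.2)) - f (K.pt p.1 p.2.1 (!p.2.2))) := by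
    symm
    refine Fintype.sum_of_injective
      (fun p => ((K.lab p.1, p.2.2), K.pt p.1 p.2.1 p.2.2)) ?_ _ _ ?_ ?_
    · rintro ⟨i, s, e⟩ ⟨j, t, e'⟩ h
      simp only [Prod.mk.injEq] at h
      have := K.eq_of_run_pt (w := []) (by simpa using hD) h.2
      simp_all
    · rintro ⟨a, v⟩ hp
      rw [K.step_surgery_of_not_moved, sub_self, mul_zero]
      rintro ⟨j, s, h3, h4⟩
      exact hp ⟨(j, s, a.2), Prod.ext (Prod.ext h3.symm rfl) h4.symm⟩
    · rintro ⟨j, s, e⟩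
      simp only [K.step_surgery_pt, K.step_pt]
  rw [h1, h2, Fintype.sum_prod_type]
  refine (Finset.abs_sum_le_sum_abs _ _).trans ?_
  rw [Finset.mul_sum]
  refine Finset.sum_le_sum fun j _ => ?_
  rw [Fintype.sum_prod_type]
  simp only [Fintype.sum_bool, Bool.not_true, Bool.not_false]
  set a := f (K.pt j true true)
  set b := f (K.pt j true false)
  set c := f (K.pt j false true)
  set d := f (K.pt j false false)
  rw [abs_le]
  constructor <;>
  nlinarith [sq_nonneg (a + b), sq_nonneg (a - b), sq_nonneg (c + d), sq_nonneg (c - d),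
    sq_nonneg (a + d), sq_nonneg (a - d), sq_nonneg (c + b), sq_nonneg (c - b)]

/-- The surgery hardly changes the spectral gap. -/
theorem specBound_surgery (hN : 0 < N) (hm : 2 ≤ m) (hD : L + 2 ≤ D) {R : ℕ}
    (hR : 2 * (R + 2) ≤ L) {ρ₁ ρ : ℝ} (hσ : SpecBound σ ρ₁) (hρ : 2 * rad m ≤ ρ)
    (hρ₁ : ρ₁ + 32 * m ^ 2 / (R + 1) ^ 2 ≤ ρ) : SpecBound K.surgery ρ := by
  have hrad := one_le_rad (m := m) (by omega)
  refine specBound_of_eigenvector _ hN (by linarith) fun μ f hsum hsq heig => ?_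
  by_contra! hcon
  have h1 : ∀ s e, (∑ j, f (K.pt j s e) ^ 2) * (R + 1) ^ 2 ≤ 4 * m ^ 2 := by
    intro s e
    calc (∑ j, f (K.pt j s e) ^ 2) * (R + 1) ^ 2
        ≤ ∑ j, 4 * m ^ 2 * ∑ w ∈ redWords m (R + 2), f (run K.surgery w (K.pt j s e)) ^ 2 := by
          rw [Finset.sum_mul]
          exact Finset.sum_le_sum fun j _ => sq_mul_le_sum_redWords hm heig (by linarith) R _
      _ ≤ 4 * m ^ 2 * 1 := by
          rw [← Finset.mul_sum, ← hsq]
          gcongr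
          exact K.sum_surgery_run_le hD hR s e f
      _ = _ := mul_one _
  have h2 : ∑ j, ∑ s : Bool, ∑ e : Bool, f (K.pt j s e) ^ 2 ≤ 16 * m ^ 2 / (R + 1) ^ 2 := by
    rw [le_div_iff₀ (by positivity)]
    simp only [Fintype.sum_bool, Finset.sum_add_distrib]
    linarith [h1 true true, h1 true false, h1 false true, h1 false false]
  have h3 := K.abs_surgery_sub_le f (by omega)
  have h4 := hσ f hsum
  have h5 : f ⬝ᵥ adjMat K.surgery *ᵥ f = μ := by
    rw [heig, dotProduct_smul, smul_eq_mul]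
    have : f ⬝ᵥ f = 1 := by
      rw [← hsq]
      simp [dotProduct, sq]
    rw [this, mul_one]
  rw [h5] at h3
  rw [hsq, mul_one] at h4
  have h6 : |μ| ≤ |μ - f ⬝ᵥ adjMat σ *ᵥ f| + |f ⬝ᵥ adjMat σ *ᵥ f| := by
    simpa using abs_add_le (μ - f ⬝ᵥ adjMat σ *ᵥ f) (f ⬝ᵥ adjMat σ *ᵥ f)
  have h7 : 32 * (m : ℝ) ^ 2 / (R + 1) ^ 2 = 2 * (16 * m ^ 2 / (R + 1) ^ 2) := by ring
  linarith

end Spectrum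

end Marking

open Polynomial Matrix

section Diameter

variable {m N : ℕ} {σ : Fin m → Equiv.Perm (Fin N)}

lemma SpecBound.abs_centMat_pow_le (hN : 0 < N) {ρ : ℝ} (hρ : 0 ≤ ρ) (h : SpecBound σ ρ) (t : ℕ)
    (u v : Fin N) : |(RamanujanGraph.centMat σ ^ t) u v| ≤ ρ ^ t := by
  obtain ⟨P, μ, h1, h2, h3⟩ := exists_orthogonal_diagonalization (centMat_isHermitian σ)
  have hμ : ∀ i, |μ i| ≤ ρ := by
    intro i
    have h4 := h.centMat σ hN hρ (P *ᵥ Pi.single i 1)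
    rw [h3, dotProduct_conj_diagonal_mulVec, ← sum_sq_transpose_mulVec h1, mulVec_mulVec, h2,
      one_mulVec] at h4
    simpa [Pi.single_apply] using h4
  have hpow : RamanujanGraph.centMat σ ^ t = P * diagonal (fun i => μ i ^ t) * Pᵀ := by
    have := aeval_conj_diagonal (μ := μ) h1 h2 (X ^ t)
    rw [← h3, map_pow, aeval_X] at this
    simpa using this
  have hrow : ∀ u, ∑ i, P u i ^ 2 = 1 := by
    intro u
    have := congrFun (congrFun h1 u) u
    rw [mul_apply, one_apply_eq] at this
    rw [← this]
    exact Finset.sum_congr rfl fun v _ => by simp [sq]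
  have hentry : (P * diagonal (fun i => μ i ^ t) * Pᵀ) u v = ∑ i, P u i * μ i ^ t * P v i := by
    rw [mul_apply]
    exact Finset.sum_congr rfl fun i _ => by rw [mul_diagonal, transpose_apply]
  rw [hpow, hentry]
  calc |∑ i, P u i * μ i ^ t * P v i| ≤ ∑ i, |P u i * μ i ^ t * P v i| :=
        Finset.abs_sum_le_sum_abs _ _
    _ ≤ ∑ i, ρ ^ t * ((P u i ^ 2 + P v i ^ 2) / 2) := by
        refine Finset.sum_le_sum fun i _ => ?_
        rw [abs_mul, abs_mul, abs_pow, mul_right_comm, mul_comm]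
        refine mul_le_mul (pow_le_pow_left₀ (abs_nonneg _) (hμ i) t) ?_ (by positivity)
          (by positivity)
        rw [← sq_abs (P u i), ← sq_abs (P v i)]
        linarith [two_mul_le_add_sq |P u i| |P v i|]
    _ = ρ ^ t := by
        rw [← Finset.mul_sum, ← Finset.sum_div, Finset.sum_add_distrib, hrow, hrow]
        norm_num

lemma exists_run_of_adjMat_pow_ne_zero (t : ℕ) (u v : Fin N) (h : (adjMat σ ^ t) u v ≠ 0) :
    ∃ w : List (Letter m), w.length = t ∧ run σ w u = v := by
  induction t generalizing u with
  | zero =>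
    rw [pow_zero, one_apply] at h
    exact ⟨[], rfl, by simpa using h⟩
  | succ t ih =>
    rw [pow_succ', mul_apply] at h
    obtain ⟨x, -, hx⟩ := Finset.exists_ne_zero_of_sum_ne_zero h
    obtain ⟨w, h1, h2⟩ := ih x (right_ne_zero_of_mul hx)
    have h3 := left_ne_zero_of_mul hx
    rw [adjMat, Matrix.sum_apply] at h3
    obtain ⟨a, -, ha⟩ := Finset.exists_ne_zero_of_sum_ne_zero h3
    have ha' : step σ a u = x := by
      by_contra hne
      exact ha (by simp [wordMat, hne])
    exact ⟨a :: w, by simp [h1], by rw [run_cons, ha', h2]⟩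

/-- A spectral gap yields short walks between any two vertices. -/
lemma SpecBound.exists_run (hN : 0 < N) {ρ : ℝ} (hρ : 0 ≤ ρ) (h : SpecBound σ ρ) {t : ℕ}
    (ht : ρ ^ (t + 1) * N < (2 * m) ^ (t + 1)) (u v : Fin N) :
    ∃ w : List (Letter m), w.length = t + 1 ∧ run σ w u = v := by
  refine exists_run_of_adjMat_pow_ne_zero _ u v (ne_of_gt ?_)
  have hN' : (0 : ℝ) < N := by positivity
  have h1 := (abs_le.1 (h.abs_centMat_pow_le hN hρ (t + 1) u v)).1
  rw [adjMat_pow_succ σ hN]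
  have h2 : ρ ^ (t + 1) < (2 * m) ^ (t + 1) / N := by rwa [lt_div_iff₀ hN']
  simp only [Matrix.add_apply, Matrix.smul_apply, of_apply, smul_eq_mul, mul_one]
  linarith

end Diameter

section Graph

variable {m : ℕ} {V : Type*} (σ : Fin m → Equiv.Perm V)

/-- The simple graph underlying the Schreier graph of a tuple of permutations. -/
def schreierGraph : SimpleGraph V where
  Adj u v := u ≠ v ∧ ∃ a, step σ a u = v
  symm := ⟨by
    rintro u v ⟨h, a, rfl⟩
    exact ⟨h.symm, linv a, step_linv_step σ a u⟩⟩
  loopless := ⟨fun _ h => h.1 rfl⟩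

variable {σ}

lemma exists_walk_schreierGraph {w : List (Letter m)} {u v : V} (h : run σ w u = v) :
    ∃ p : (schreierGraph σ).Walk u v, p.length ≤ w.length := by
  induction w generalizing u with
  | nil =>
    obtain rfl : u = v := h
    exact ⟨SimpleGraph.Walk.nil, le_rfl⟩
  | cons a w ih =>
    by_cases ha : step σ a u = u
    · rw [run_cons, ha] at h
      obtain ⟨p, hp⟩ := ih h
      exact ⟨p, hp.trans (by simp)⟩
    · obtain ⟨p, hp⟩ := ih h
      have hadj : (schreierGraph σ).Adj u (step σ a u) := ⟨Ne.symm ha, a, rfl⟩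
      refine ⟨SimpleGraph.Walk.cons hadj p, ?_⟩
      rw [SimpleGraph.Walk.length_cons, List.length_cons]
      omega

/-- A path is traced out by a reduced word. -/
lemma exists_reduced_of_isPath {u v : V} (p : (schreierGraph σ).Walk u v) (hp : p.IsPath) :
    ∃ w : List (Letter m), Reduced w ∧ w.length = p.length ∧ run σ w u = v ∧
      ∀ a t, w = a :: t → step σ a u ∈ p.support := by
  induction p with
  | nil => exact ⟨[], Reduced.nil, rfl, rfl, by simp⟩
  | @cons u x v h p ih =>
    rw [SimpleGraph.Walk.cons_isPath_iff] at hp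
    obtain ⟨w, h1, h2, h3, h4⟩ := ih hp.1
    obtain ⟨a, rfl⟩ := h.2
    refine ⟨a :: w, ?_, by simp [h2], h3, ?_⟩
    · rcases w with _ | ⟨b, w⟩
      · exact Reduced.singleton a
      · refine reduced_cons_cons.2 ⟨?_, h1⟩
        rintro rfl
        have := h4 _ _ rfl
        rw [step_linv_step] at this
        exact hp.2 this
    · intro b t hb
      simp only [List.cons.injEq] at hb
      rw [← hb.1]
      simp

lemma lt_length_of_isCycle {L : ℕ}
    (hfree : ∀ (w : List (Letter m)) (v : V), w.length ≤ L → Reduced w → run σ w v = v → w = [])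
    {u : V} (p : (schreierGraph σ).Walk u u) (hp : p.IsCycle) : L < p.length := by
  by_contra! hcon
  have h3 := hp.three_le_length
  cases p with
  | nil => simp at h3
  | @cons _ x _ h p =>
    rw [SimpleGraph.Walk.cons_isCycle_iff] at hp
    obtain ⟨w, h1, h2, h4, -⟩ := exists_reduced_of_isPath p.reverse hp.1.reverse
    obtain ⟨a, ha⟩ := h.2
    rw [SimpleGraph.Walk.length_reverse] at h2
    rw [SimpleGraph.Walk.length_cons] at hcon h3
    have := eq_of_run_eq hfree (w := w) (w' := [a]) h1 (Reduced.singleton a)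
      (by simp; omega) (v := u) (by rw [h4, run_cons, run_nil, ha])
    rw [this] at h2
    simp at h2
    omega

end Graph

section Regular

variable {m N : ℕ} {σ : Fin m → Equiv.Perm (Fin N)} {L : ℕ}

lemma schreierGraph_adj (hL : 2 ≤ L)
    (hfree : ∀ (w : List (Letter m)) (v : Fin N), w.length ≤ L → Reduced w → run σ w v = v →
      w = []) (u v : Fin N) : (schreierGraph σ).Adj u v ↔ ∃ a, step σ a u = v := by
  refine ⟨And.right, fun h => ⟨?_, h⟩⟩
  rintro rfl
  obtain ⟨a, ha⟩ := h
  have := hfree [a] u (by simp; omega) (Reduced.singleton a) ha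
  simp at this

lemma step_left_injective (hL : 2 ≤ L)
    (hfree : ∀ (w : List (Letter m)) (v : Fin N), w.length ≤ L → Reduced w → run σ w v = v →
      w = []) (u : Fin N) : Function.Injective fun a : Letter m => step σ a u := by
  intro a b h
  have := eq_of_run_eq hfree (Reduced.singleton a) (Reduced.singleton b) (by simpa using hL)
    (v := u) h
  simpa using this

/-- Sums over the neighbours of a vertex are sums over letters. -/
lemma sum_schreierGraph_adj (hL : 2 ≤ L)
    (hfree : ∀ (w : List (Letter m)) (v : Fin N), w.length ≤ L → Reduced w → run σ w v = v →
      w = []) (u : Fin N) (F : Fin N → ℝ) :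
    ∑ v, (if (schreierGraph σ).Adj u v then F v else 0) = ∑ a : Letter m, F (step σ a u) := by
  symm
  refine Fintype.sum_of_injective _ (step_left_injective hL hfree u) _ _ ?_ ?_
  · intro v hv
    rw [if_neg]
    rwa [schreierGraph_adj hL hfree]
  · intro a
    rw [if_pos ((schreierGraph_adj hL hfree _ _).2 ⟨a, rfl⟩)]

lemma card_schreierGraph_adj (hL : 2 ≤ L)
    (hfree : ∀ (w : List (Letter m)) (v : Fin N), w.length ≤ L → Reduced w → run σ w v = v →
      w = []) (u : Fin N) :
    (Finset.univ.filter fun v => (schreierGraph σ).Adj u v).card = 2 * m := by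
  have h := sum_schreierGraph_adj hL hfree u fun _ => 1
  rw [Finset.sum_boole, Finset.sum_const, Finset.card_univ, Fintype.card_prod, Fintype.card_fin,
    Fintype.card_bool, nsmul_eq_mul, mul_one] at h
  rw [mul_comm 2 m]
  exact_mod_cast h

/-- A tuple of permutations without short closed words and with a spectral gap yields a regular
expander of large girth and small diameter. -/
theorem schreierGraph_properties {p : ℕ} {σ : Fin m → Equiv.Perm (Fin (4 ^ p))} (hm : 8 ≤ m)
    (hp : 0 < p) (hL : 2 ≤ L)
    (hfree : ∀ (w : List (Letter m)) (v : Fin (4 ^ p)), w.length ≤ L → Reduced w →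
      run σ w v = v → w = []) (hspec : SpecBound σ (2 * √(2 * m))) :
    (∀ v, (Finset.univ.filter fun w => (schreierGraph σ).Adj v w).card = 2 * m) ∧
      (∀ x : Fin (4 ^ p) → ℝ, ∑ v, x v = 0 →
        |∑ v, ∑ w, if (schreierGraph σ).Adj v w then x v * x w else 0| ≤
          2 * √(2 * m) * ∑ v, x v ^ 2) ∧
      L < (schreierGraph σ).girth ∧ ∀ u v, (schreierGraph σ).dist u v ≤ 2 * p + 1 := by
  have hm' : (8 : ℝ) ≤ m := by exact_mod_cast hm
  have hdeg := card_schreierGraph_adj hL hfree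
  have hwalk : ∀ u v, ∃ w : (schreierGraph σ).Walk u v, w.length ≤ 2 * p + 1 := by
    intro u v
    have hsqrt : √(2 * m) ^ 2 = 2 * m := Real.sq_sqrt (by positivity)
    have hsqrt4 : 4 ≤ √(2 * m) := Real.le_sqrt_of_sq_le (by norm_num; linarith)
    obtain ⟨w, h1, h2⟩ := hspec.exists_run (by positivity) (by positivity) (t := 2 * p) (by
      have h1 : (2 * √(2 * m)) ^ (2 * p + 1) * 2 ^ (2 * p + 1) ≤ ((2 * m : ℝ)) ^ (2 * p + 1) := by
        rw [← mul_pow]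
        refine pow_le_pow_left₀ (by positivity) ?_ _
        nlinarith
      refine lt_of_lt_of_le ?_ h1
      have h2 : (0 : ℝ) < (2 * √(2 * m)) ^ (2 * p + 1) := by positivity
      refine mul_lt_mul_of_pos_left ?_ h2
      push_cast
      rw [pow_succ, pow_mul]
      norm_num) u v
    obtain ⟨q, hq⟩ := exists_walk_schreierGraph h2
    exact ⟨q, by omega⟩
  refine ⟨hdeg, fun x hx => ?_, ?_, fun u v => ?_⟩
  · have h := hspec x hx
    simp only [dotProduct, adjMat_mulVec] at h
    have h2 : ∀ v, ∑ w, (if (schreierGraph σ).Adj v w then x v * x w else 0) =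
        x v * ∑ a : Letter m, x (step σ a v) := by
      intro v
      rw [sum_schreierGraph_adj hL hfree v fun w => x v * x w, Finset.mul_sum]
    simp only [h2]
    exact h
  · have hcyc : ¬ (schreierGraph σ).IsAcyclic := by
      intro hac
      have : Nontrivial (Fin (4 ^ p)) := Fin.nontrivial_iff_two_le.2 (by
        calc 2 ≤ 4 ^ 1 := by norm_num
          _ ≤ 4 ^ p := Nat.pow_le_pow_right (by norm_num) hp)
      have htree : (schreierGraph σ).IsTree :=
        ⟨⟨fun u v => ⟨(hwalk u v).choose⟩⟩, hac⟩
      obtain ⟨v, hv⟩ := htree.exists_vert_degree_one_of_nontrivial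
      have := hdeg v
      rw [← SimpleGraph.card_neighborFinset_eq_degree,
        SimpleGraph.neighborFinset_eq_filter] at hv
      rw [hv] at this
      omega
    obtain ⟨u, w, hw, hlen⟩ := SimpleGraph.exists_girth_eq_length.2 hcyc
    rw [hlen]
    exact lt_length_of_isCycle hfree w hw
  · obtain ⟨w, hw⟩ := hwalk u v
    exact (SimpleGraph.dist_le w).trans hw

end Regular

section Selection

variable {m : ℕ}

/-- The words of length at most `k`. -/
noncomputable def words (m : ℕ) : ℕ → Finset (List (Letter m))
  | 0 => {[]}
  | k + 1 => insert [] ((Finset.univ ×ˢ words m k).image fun q => q.1 :: q.2)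

lemma mem_words {k : ℕ} {w : List (Letter m)} : w ∈ words m k ↔ w.length ≤ k := by
  induction k generalizing w with
  | zero => simp [words]
  | succ k ih =>
    rcases w with _ | ⟨a, w⟩
    · simp [words]
    · simp [words, ih]

lemma card_words_le (k : ℕ) : (words m k).card ≤ (2 * m + 1) ^ k := by
  induction k with
  | zero => simp [words]
  | succ k ih =>
    have h1 : (words m (k + 1)).card ≤ 2 * m * (words m k).card + 1 := by
      refine (Finset.card_insert_le _ _).trans (Nat.add_le_add_right ?_ 1)
      refine Finset.card_image_le.trans (le_of_eq ?_)
      rw [Finset.card_product]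
      simp [mul_comm]
    have h2 : 1 ≤ (2 * m + 1) ^ k := Nat.one_le_pow _ _ (by omega)
    calc _ ≤ 2 * m * (words m k).card + 1 := h1
      _ ≤ 2 * m * (2 * m + 1) ^ k + (2 * m + 1) ^ k := by gcongr
      _ = _ := by ring

variable {V : Type*}

/-- If `V` is large, there are vertices, indexed by `F`, far from each other and from `Y`. -/
lemma exists_far [Fintype V] (σ : Fin m → Equiv.Perm V) {E : Type*} (D : ℕ) (Y : Finset V)
    (F : Finset E) (h : (2 * m + 1) ^ D * (Y.card + F.card) < Fintype.card V) :
    ∃ x : E → V, ∀ e ∈ F, (∀ y ∈ Y, Far σ D y (x e)) ∧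
      ∀ e' ∈ F, e ≠ e' → Far σ D (x e) (x e') := by
  induction F using Finset.induction_on with
  | empty =>
    have hV : 0 < Fintype.card V := by omega
    obtain ⟨v⟩ := Fintype.card_pos_iff.1 hV
    exact ⟨fun _ => v, by simp⟩
  | insert e F he ih =>
    rw [Finset.card_insert_of_notMem he] at h
    obtain ⟨x, hx⟩ := ih (lt_of_le_of_lt (Nat.mul_le_mul_left _ (by omega)) h)
    set B : Finset V := (words m D ×ˢ (Y ∪ F.image x)).image fun q => run σ q.1 q.2 with hB
    have hcard : B.card < Fintype.card V := by
      refine lt_of_le_of_lt (Finset.card_image_le.trans ?_) h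
      rw [Finset.card_product]
      refine Nat.mul_le_mul (card_words_le D) ((Finset.card_union_le _ _).trans ?_)
      have := Finset.card_image_le (s := F) (f := x)
      omega
    obtain ⟨z, hz⟩ : ∃ z, z ∉ B := by
      by_contra! hall
      rw [Finset.eq_univ_of_forall hall, Finset.card_univ] at hcard
      exact lt_irrefl _ hcard
    have hfar : ∀ y ∈ Y ∪ F.image x, Far σ D y z := by
      intro y hy w hw hr
      exact hz (Finset.mem_image.2 ⟨(w, y), Finset.mem_product.2 ⟨mem_words.2 hw, hy⟩, hr⟩)
    have hfarY : ∀ y ∈ Y, Far σ D y z := fun y hy => hfar y (Finset.mem_union_left _ hy)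
    have hfarF : ∀ e' ∈ F, Far σ D (x e') z := fun e' he' =>
      hfar _ (Finset.mem_union_right _ (Finset.mem_image_of_mem x he'))
    have hne : ∀ e' ∈ F, e' ≠ e := by
      rintro e' he' rfl
      exact he he'
    refine ⟨Function.update x e z, fun e₁ he₁ => ?_⟩
    rcases Finset.mem_insert.1 he₁ with rfl | he₁F
    · rw [Function.update_self]
      refine ⟨hfarY, fun e' he' hee' => ?_⟩
      have he'F := Finset.mem_of_mem_insert_of_ne he' hee'.symm
      rw [Function.update_of_ne hee'.symm]
      exact (hfarF e' he'F).symm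
    · rw [Function.update_of_ne (hne e₁ he₁F)]
      refine ⟨(hx e₁ he₁F).1, fun e' he' hee' => ?_⟩
      rcases Finset.mem_insert.1 he' with rfl | he'
      · rw [Function.update_self]
        exact hfarF e₁ he₁F
      · rw [Function.update_of_ne (hne e' he')]
        exact (hx e₁ he₁F).2 e' he' hee'

variable [DecidableEq V]

/-- The vertices at which some walk of length at most `M` has `t` coincidences. -/
noncomputable def coincVerts [Fintype V] (σ : Fin m → Equiv.Perm V) (t M : ℕ) : Finset V :=
  Finset.univ.filter fun v => ∃ w ∈ words m M, t ≤ coinc σ ∅ {v} w v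

lemma step_mem_coincVerts [Fintype V] {σ : Fin m → Equiv.Perm V} {a : Letter m} {v : V}
    {b : List (Letter m)} {M : ℕ} (hb : b.length + 1 ≤ M) (h1 : run σ b (step σ a v) = v)
    (h2 : edge σ a v ∉ edges σ b (step σ a v)) : step σ a v ∈ coincVerts σ 1 M := by
  refine Finset.mem_filter.2 ⟨Finset.mem_univ _, b ++ [a], mem_words.2 (by simpa using hb), ?_⟩
  exact one_le_coinc_of_cycle h1 h2

/-- A short closed reduced walk passes through a vertex with a coincidence. -/
lemma exists_run_mem_coincVerts [Fintype V] {σ : Fin m → Equiv.Perm V} {M : ℕ}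
    {w : List (Letter m)} {v : V} (hw : w.length ≤ M) (hr : Reduced w) (h0 : w ≠ [])
    (h : run σ w v = v) : ∃ q : List (Letter m), q.length ≤ M ∧ run σ q v ∈ coincVerts σ 1 M := by
  obtain ⟨s, c, b, t, rfl, h1, h2⟩ := exists_cycle_of_closed _ w v le_rfl hr h0 h
  have hlen : s.length + (b.length + 1) + t.length ≤ M := by
    simp only [List.length_append, List.length_cons] at hw
    omega
  refine ⟨s ++ [c], by simp; omega, ?_⟩
  rw [run_append]
  exact step_mem_coincVerts (by omega) h1 h2

/-- If there are few short cycles and no tangles, there is a marking. -/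
theorem exists_marking [Fintype V] {σ : Fin m → Equiv.Perm V} {L : ℕ}
    (htf : TangleFree σ (3 * L + 5))
    (hY : (2 * m + 1) ^ (L + 3) * (2 * (coincVerts σ 1 (L + 1)).card) < Fintype.card V) :
    ∃ F : Finset (Fin m × V), Nonempty (Marking σ L (L + 2) {e // e ∈ F}) := by
  obtain ⟨F, hspot, hfar, hmeets⟩ := exists_spots (σ := σ) L (L + 2) (by convert htf using 1; ring)
  have hmem : ∀ e ∈ F, step σ (e.1, true) e.2 ∈ coincVerts σ 1 (L + 1) := by
    intro e he
    obtain ⟨b, hb, h1, h2⟩ := hspot e he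
    exact step_mem_coincVerts (by omega) h1 h2
  have hcard : F.card ≤ (coincVerts σ 1 (L + 1)).card := by
    refine Finset.card_le_card_of_injOn (fun e => step σ (e.1, true) e.2) hmem ?_
    intro e he e' he' hee
    by_contra hne
    refine hfar e he e' he' hne [(e.1, true), linv (e'.1, true)] (by simp) ?_
    have hee' : step σ (e.1, true) e.2 = step σ (e'.1, true) e'.2 := hee
    rw [run_cons, hee', run_cons, step_linv_step, run_nil]
  obtain ⟨x, hx⟩ := exists_far σ (L + 3) (coincVerts σ 1 (L + 1)) F
    (lt_of_le_of_lt (Nat.mul_le_mul_left _ (by omega)) hY)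
  have hmixed : ∀ e ∈ F, ∀ e' ∈ F, Far σ (L + 2) e.2 (x e') := by
    intro e he e' he' w hw hr
    refine (hx e' he').1 _ (hmem e he) (linv (e.1, true) :: w) (by simpa using hw) ?_
    rw [run_cons, step_linv_step, hr]
  have hnear : ∀ e ∈ F, ∀ q : List (Letter m), q.length ≤ L + 3 →
      run σ q (x e) ∉ coincVerts σ 1 (L + 1) := fun e he q hq hmem =>
    ((hx e he).1 _ hmem).symm q hq rfl
  refine ⟨F, ⟨⟨fun e => e.1.1, fun e s => if s then x e.1 else e.1.2, ?_, ?_, ?_, ?_⟩⟩⟩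
  · rintro ⟨e, he⟩ (_ | _) ⟨e', he'⟩ (_ | _) hne
    · exact hfar e he e' he' fun h => hne (by subst h; rfl)
    · exact hmixed e he e' he'
    · exact (hmixed e' he' e he).symm
    · exact ((hx e he).2 e' he' fun h => hne (by subst h; rfl)).mono (by omega)
  · rintro ⟨e, he⟩ w hw hr h0 hclosed
    obtain ⟨q, hq, hq'⟩ := exists_run_mem_coincVerts hw hr h0 hclosed
    exact hnear e he q (by omega) hq'
  · rintro ⟨e, he⟩ w hw hr h0 hclosed
    obtain ⟨q, hq, hq'⟩ := exists_run_mem_coincVerts hw hr h0 hclosed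
    exact hnear e he ((e.1, true) :: q) (by simp; omega) hq'
  · intro w v hw hr h0 hclosed
    obtain ⟨e, he, hmem'⟩ := hmeets w v hw hr h0 hclosed
    exact ⟨⟨e, he⟩, hmem'⟩

end Selection

section Existence

variable {m : ℕ}

lemma card_perm_tuples (m N : ℕ) :
    Fintype.card (Fin m → Equiv.Perm (Fin N)) = N.factorial ^ m := by
  simp [Fintype.card_perm]

lemma prob_le_of_le_card {N : ℕ} {P : (Fin m → Equiv.Perm (Fin N)) → Prop}
    {f : (Fin m → Equiv.Perm (Fin N)) → ℕ} {c s : ℝ} (hc : 0 < c) (h : ∀ σ, P σ → c ≤ f σ)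
    (hs : ∑ σ, (f σ : ℝ) ≤ s * (N.factorial : ℝ) ^ m) : prob m N P ≤ s / c := by
  have hpos : (0 : ℝ) < (N.factorial : ℝ) ^ m := by positivity
  rw [prob, div_le_div_iff₀ hpos hc]
  refine le_trans ?_ hs
  calc ((Finset.univ.filter P).card : ℝ) * c = ∑ σ ∈ Finset.univ.filter P, c := by
        rw [Finset.sum_const, nsmul_eq_mul]
    _ ≤ ∑ σ ∈ Finset.univ.filter P, (f σ : ℝ) :=
        Finset.sum_le_sum fun σ hσ => h σ (Finset.mem_filter.1 hσ).2
    _ ≤ ∑ σ, (f σ : ℝ) :=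
        Finset.sum_le_sum_of_subset_of_nonneg (Finset.subset_univ _) fun _ _ _ => by positivity

/-- Properties whose failure probabilities add up to less than one hold together. -/
lemma exists_of_prob_lt {N : ℕ} {P Q R : (Fin m → Equiv.Perm (Fin N)) → Prop}
    (h : prob m N (fun σ => ¬ P σ) + prob m N (fun σ => ¬ Q σ) + prob m N (fun σ => ¬ R σ) < 1) :
    ∃ σ, P σ ∧ Q σ ∧ R σ := by
  by_contra! hall
  have hpos : (0 : ℝ) < (N.factorial : ℝ) ^ m := by positivity
  simp only [prob] at h
  rw [← add_div, ← add_div, div_lt_one hpos] at h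
  have hcover : (Finset.univ : Finset (Fin m → Equiv.Perm (Fin N))) ⊆
      Finset.univ.filter (fun σ => ¬ P σ) ∪ Finset.univ.filter (fun σ => ¬ Q σ) ∪
        Finset.univ.filter (fun σ => ¬ R σ) := by
    intro σ _
    have := hall σ
    simp only [Finset.mem_union, Finset.mem_filter, Finset.mem_univ, true_and]
    tauto
  have hcard := (Finset.card_le_card hcover).trans
    ((Finset.card_union_le _ _).trans (Nat.add_le_add_right (Finset.card_union_le _ _) _))
  rw [Finset.card_univ, card_perm_tuples] at hcard
  have hcard' : ((N.factorial ^ m : ℕ) : ℝ) ≤ _ := Nat.cast_le.2 hcard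
  push_cast at hcard'
  refine absurd h (not_lt.2 ?_)
  convert hcard' <;> rfl

lemma card_coinc_empty_le {N M t : ℕ} (hN : 0 < N) (hM : 2 * M ≤ N) {w : List (Letter m)}
    (hw : w.length ≤ M) (v : Fin N) :
    ((Finset.univ.filter fun σ : Fin m → Equiv.Perm (Fin N) =>
      t ≤ coinc σ ∅ {v} w v).card : ℝ) ≤
      (2 * ((M : ℝ) + 1) ^ 2 / N) ^ t * (N.factorial : ℝ) ^ m := by
  have hempty : compat (∅ : Finset (Fin m × Fin N × Fin N)) = Finset.univ := by
    ext σ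
    simp [mem_compat]
  have h := card_coinc_le (m := m) (V := Fin N) (M := M) (by rw [Fintype.card_fin]; omega) w ∅ {v} v
    t (by simpa using hw) (by simp; omega)
  rw [hempty, Fintype.card_fin, Finset.card_univ, card_perm_tuples] at h
  push_cast at h
  refine h.trans ?_
  have hN' : (0 : ℝ) < N := by exact_mod_cast hN
  have hM' : 2 * (M : ℝ) ≤ N := by exact_mod_cast hM
  have h1 : ((w.length.choose t : ℕ) : ℝ) ≤ ((M : ℝ) + 1) ^ t := by
    have : w.length.choose t ≤ (M + 1) ^ t :=
      (Nat.choose_le_pow _ _).trans (Nat.pow_le_pow_left (by omega) t)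
    exact_mod_cast this
  have h2 : ((M : ℝ) + 1) / (N - M) ≤ 2 * ((M : ℝ) + 1) / N := by
    rw [div_le_div_iff₀ (by linarith) hN']
    nlinarith [(Nat.cast_nonneg M : (0 : ℝ) ≤ M)]
  have h3 : (0 : ℝ) ≤ ((M : ℝ) + 1) / (N - M) := div_nonneg (by positivity) (by linarith)
  refine mul_le_mul_of_nonneg_right ?_ (by positivity)
  calc ((w.length.choose t : ℕ) : ℝ) * (((M : ℝ) + 1) / (N - M)) ^ t
      ≤ ((M : ℝ) + 1) ^ t * (2 * ((M : ℝ) + 1) / N) ^ t := by gcongr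
    _ = _ := by
      rw [← mul_pow]
      congr 1
      ring

/-- The average number of starting points of short walks with `t` coincidences. -/
lemma sum_card_coincVerts_le {N M : ℕ} (t : ℕ) (hN : 0 < N) (hM : 2 * M ≤ N) :
    ∑ σ : Fin m → Equiv.Perm (Fin N), ((coincVerts σ t M).card : ℝ) ≤
      N * (2 * (m : ℝ) + 1) ^ M * (2 * ((M : ℝ) + 1) ^ 2 / N) ^ t * (N.factorial : ℝ) ^ m := by
  have hswap : ∑ σ : Fin m → Equiv.Perm (Fin N), (coincVerts σ t M).card =
      ∑ v : Fin N, (Finset.univ.filter fun σ : Fin m → Equiv.Perm (Fin N) =>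
        ∃ w ∈ words m M, t ≤ coinc σ ∅ {v} w v).card := by
    simp only [coincVerts, Finset.card_filter]
    exact Finset.sum_comm
  have hv : ∀ v : Fin N, ((Finset.univ.filter fun σ : Fin m → Equiv.Perm (Fin N) =>
      ∃ w ∈ words m M, t ≤ coinc σ ∅ {v} w v).card : ℝ) ≤
      (2 * (m : ℝ) + 1) ^ M * ((2 * ((M : ℝ) + 1) ^ 2 / N) ^ t * (N.factorial : ℝ) ^ m) := by
    intro v
    have hsub : (Finset.univ.filter fun σ : Fin m → Equiv.Perm (Fin N) =>
        ∃ w ∈ words m M, t ≤ coinc σ ∅ {v} w v) ⊆ (words m M).biUnion fun w =>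
          Finset.univ.filter fun σ => t ≤ coinc σ ∅ {v} w v := by
      intro σ hσ
      obtain ⟨w, hw, hw'⟩ := (Finset.mem_filter.1 hσ).2
      exact Finset.mem_biUnion.2 ⟨w, hw, Finset.mem_filter.2 ⟨Finset.mem_univ _, hw'⟩⟩
    have hcard := (Finset.card_le_card hsub).trans Finset.card_biUnion_le
    calc _ ≤ ∑ w ∈ words m M, ((Finset.univ.filter fun σ : Fin m → Equiv.Perm (Fin N) =>
          t ≤ coinc σ ∅ {v} w v).card : ℝ) := by exact_mod_cast hcard
      _ ≤ ∑ _w ∈ words m M, (2 * ((M : ℝ) + 1) ^ 2 / N) ^ t * (N.factorial : ℝ) ^ m :=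
        Finset.sum_le_sum fun w hw => card_coinc_empty_le hN hM (mem_words.1 hw) v
      _ ≤ _ := by
        rw [Finset.sum_const, nsmul_eq_mul]
        refine mul_le_mul_of_nonneg_right ?_ (by positivity)
        exact_mod_cast card_words_le M
  calc ∑ σ : Fin m → Equiv.Perm (Fin N), ((coincVerts σ t M).card : ℝ)
      = ∑ v : Fin N, ((Finset.univ.filter fun σ : Fin m → Equiv.Perm (Fin N) =>
        ∃ w ∈ words m M, t ≤ coinc σ ∅ {v} w v).card : ℝ) := by exact_mod_cast hswap
    _ ≤ ∑ _v : Fin N, _ := Finset.sum_le_sum fun v _ => hv v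
    _ = _ := by
      rw [Finset.sum_const, Finset.card_univ, Fintype.card_fin, nsmul_eq_mul]
      ring

lemma succ_sq_le_four_pow (M : ℕ) : ((M : ℝ) + 1) ^ 2 ≤ 4 ^ M := by
  have h : M + 1 ≤ 2 ^ M := Nat.lt_two_pow_self
  have h' : (M : ℝ) + 1 ≤ 2 ^ M := by exact_mod_cast h
  calc ((M : ℝ) + 1) ^ 2 ≤ (2 ^ M) ^ 2 := by gcongr
    _ = 4 ^ M := by rw [← pow_mul, mul_comm, pow_mul]; norm_num

lemma prob_not_tangleFree_le {N M : ℕ} (hN : 0 < N) (hM : 2 * M ≤ N) :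
    prob m N (fun σ => ¬ TangleFree σ M) ≤ 4 * (16 * (2 * (m : ℝ) + 1)) ^ M / N := by
  have hN' : (0 : ℝ) < N := by exact_mod_cast hN
  refine (prob_le_of_le_card (f := fun σ => (coincVerts σ 2 M).card) one_pos ?_
    (sum_card_coincVerts_le 2 hN hM)).trans ?_
  · intro σ hσ
    simp only [TangleFree] at hσ
    push Not at hσ
    obtain ⟨v, w, hw, hvw⟩ := hσ
    have : 0 < (coincVerts σ 2 M).card :=
      Finset.card_pos.2 ⟨v, Finset.mem_filter.2 ⟨Finset.mem_univ _, w, mem_words.2 hw, hvw⟩⟩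
    exact_mod_cast this
  · rw [div_one]
    calc (N : ℝ) * (2 * (m : ℝ) + 1) ^ M * (2 * ((M : ℝ) + 1) ^ 2 / N) ^ 2
        = 4 * ((((M : ℝ) + 1) ^ 2) ^ 2 * (2 * (m : ℝ) + 1) ^ M) / N := by
          field_simp
          ring
      _ ≤ 4 * ((4 ^ M) ^ 2 * (2 * (m : ℝ) + 1) ^ M) / N := by
          gcongr
          exact succ_sq_le_four_pow M
      _ = _ := by
          rw [← pow_mul, mul_comm M 2, pow_mul, ← mul_pow]
          norm_num

lemma prob_not_few_coincVerts_le {N L : ℕ} (hN : 0 < N) (hL : 2 * (L + 1) ≤ N) :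
    prob m N (fun σ => ¬ (2 * m + 1) ^ (L + 3) * (2 * (coincVerts σ 1 (L + 1)).card) < N) ≤
      4 * (16 * (2 * (m : ℝ) + 1)) ^ (2 * L + 4) / N := by
  have hN' : (0 : ℝ) < N := by exact_mod_cast hN
  have hb : (0 : ℝ) < 2 * (m : ℝ) + 1 := by positivity
  have hc : (0 : ℝ) < N / (2 * (2 * (m : ℝ) + 1) ^ (L + 3)) := by positivity
  refine (prob_le_of_le_card (f := fun σ => (coincVerts σ 1 (L + 1)).card) hc ?_
    (sum_card_coincVerts_le 1 hN hL)).trans ?_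
  · intro σ hσ
    rw [div_le_iff₀ (by positivity)]
    have h : (N : ℝ) ≤ (2 * (m : ℝ) + 1) ^ (L + 3) * (2 * ((coincVerts σ 1 (L + 1)).card : ℝ)) := by
      exact_mod_cast not_lt.1 hσ
    linarith
  · have h4 : (4 : ℝ) ^ (L + 1) ≤ 16 ^ (2 * L + 4) := by
      calc (4 : ℝ) ^ (L + 1) ≤ 16 ^ (L + 1) := by gcongr; norm_num
        _ ≤ 16 ^ (2 * L + 4) := pow_le_pow_right₀ (by norm_num) (by omega)
    have hexp : (2 * (m : ℝ) + 1) ^ (2 * L + 4) =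
        (2 * (m : ℝ) + 1) ^ (L + 1) * (2 * (m : ℝ) + 1) ^ (L + 3) := by
      rw [← pow_add]
      congr 1
      ring
    calc (N : ℝ) * (2 * (m : ℝ) + 1) ^ (L + 1) * (2 * (((L + 1 : ℕ) : ℝ) + 1) ^ 2 / N) ^ 1 /
          (N / (2 * (2 * (m : ℝ) + 1) ^ (L + 3)))
        = 4 * ((((L + 1 : ℕ) : ℝ) + 1) ^ 2 * (2 * (m : ℝ) + 1) ^ (2 * L + 4)) / N := by
          rw [hexp]
          field_simp
          ring
      _ ≤ 4 * (16 ^ (2 * L + 4) * (2 * (m : ℝ) + 1) ^ (2 * L + 4)) / N := by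
          gcongr
          exact (succ_sq_le_four_pow _).trans h4
      _ = _ := by rw [← mul_pow]

/-- For a suitable constant `K` and large `L`, some tuple of permutations of `4 ^ (K * L)` points is
nearly Ramanujan and admits a marking. -/
theorem exists_specBound_marking (hm : 0 < m) {ρ : ℝ} (hρ : 2 * rad m < ρ) :
    ∃ K : ℕ, 0 < K ∧ ∀ᶠ L : ℕ in Filter.atTop,
      ∃ σ : Fin m → Equiv.Perm (Fin (4 ^ (K * L))), SpecBound σ ρ ∧
        ∃ F : Finset (Fin m × Fin (4 ^ (K * L))),
          Nonempty (Marking σ L (L + 2) {e // e ∈ F}) := by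
  set B : ℕ := (16 * (2 * m + 1)) ^ 8 with hB
  refine ⟨B + 2, by omega, ?_⟩
  have hspec : Filter.Tendsto (fun L : ℕ => prob m (4 ^ ((B + 2) * L)) fun σ => ¬ SpecBound σ ρ)
      Filter.atTop (nhds 0) :=
    (tendsto_prob_not_specBound hm hρ).comp
      (Filter.tendsto_id.const_mul_atTop' (by omega : 0 < B + 2))
  filter_upwards [hspec.eventually_lt_const (by norm_num : (0 : ℝ) < 1 / 2),
    Filter.eventually_ge_atTop 1] with L hL hL1
  set N : ℕ := 4 ^ ((B + 2) * L) with hN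
  have hNpos : 0 < N := by positivity
  have hpow : (16 * B) ^ L ≤ N := by
    rw [hN, pow_mul]
    refine Nat.pow_le_pow_left ?_ L
    have : B ≤ 4 ^ B := (Nat.lt_pow_self (by norm_num)).le
    rw [pow_add]
    omega
  have hBpos : 0 < B := by positivity
  have hlarge : 16 * L ≤ N := by
    refine le_trans ?_ hpow
    calc 16 * L ≤ 16 ^ L := by
          clear hpow hN hL
          clear_value N
          induction L, hL1 using Nat.le_induction with
          | base => norm_num
          | succ n hn ih => rw [pow_succ]; omega
      _ ≤ (16 * B) ^ L := Nat.pow_le_pow_left (by omega) L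
  have hbound : ∀ e : ℕ, e ≤ 8 * L → 4 * (16 * (2 * (m : ℝ) + 1)) ^ e / (N : ℝ) ≤ 1 / 4 := by
    intro e he
    rw [div_le_iff₀ (by exact_mod_cast hNpos)]
    have h1 : 16 * (16 * (2 * m + 1)) ^ e ≤ N := by
      calc 16 * (16 * (2 * m + 1)) ^ e ≤ 16 ^ L * (16 * (2 * m + 1)) ^ (8 * L) := by
            refine Nat.mul_le_mul ?_ (Nat.pow_le_pow_right (by omega) he)
            exact Nat.le_self_pow (by omega) 16
        _ = (16 * B) ^ L := by rw [pow_mul, ← mul_pow]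
        _ ≤ N := hpow
    have h2 : 16 * (16 * (2 * (m : ℝ) + 1)) ^ e ≤ N := by exact_mod_cast h1
    linarith
  obtain ⟨σ, h1, h2, h3⟩ := exists_of_prob_lt (m := m) (N := N) (P := fun σ => SpecBound σ ρ)
    (Q := fun σ => TangleFree σ (3 * L + 5))
    (R := fun σ => (2 * m + 1) ^ (L + 3) * (2 * (coincVerts σ 1 (L + 1)).card) < N) (by
      have ha := (prob_not_tangleFree_le (m := m) (M := 3 * L + 5) hNpos (by omega)).trans
        (hbound _ (by omega))
      have hb := (prob_not_few_coincVerts_le (m := m) (L := L) hNpos (by omega)).trans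
        (hbound _ (by omega))
      linarith)
  exact ⟨σ, h1, exists_marking h2 (by rw [Fintype.card_fin]; exact h3)⟩

end Existence

/-- For `8 ≤ m`, there are `2 * m`-regular Ramanujan-type graphs on `4 ^ (K * L)` vertices with
girth more than `L` and logarithmic diameter, for all large `L`. -/
theorem exists_graph {m : ℕ} (hm : 8 ≤ m) : ∃ K : ℕ, 0 < K ∧ ∀ᶠ L : ℕ in Filter.atTop,
    ∃ G : SimpleGraph (Fin (4 ^ (K * L))),
      (∀ v, (Finset.univ.filter fun w => G.Adj v w).card = 2 * m) ∧
      (∀ x : Fin (4 ^ (K * L)) → ℝ, ∑ v, x v = 0 →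
        |∑ v, ∑ w, if G.Adj v w then x v * x w else 0| ≤ 2 * √(2 * m) * ∑ v, x v ^ 2) ∧
      L < G.girth ∧ ∀ u v, G.dist u v ≤ 2 * (K * L) + 1 := by
  have hrad : 2 * rad m < 2 * √(2 * m) := by
    have h : rad m < √(2 * m) := by
      have hm' : (8 : ℝ) ≤ m := by exact_mod_cast hm
      exact Real.sqrt_lt_sqrt (by linarith) (by linarith)
    linarith
  obtain ⟨ρ, hρ, hρ'⟩ := exists_between hrad
  obtain ⟨R, hR⟩ : ∃ R : ℕ, 32 * (m : ℝ) ^ 2 / (2 * √(2 * m) - ρ) < R := exists_nat_gt _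
  have hR' : ρ + 32 * (m : ℝ) ^ 2 / ((R : ℝ) + 1) ^ 2 ≤ 2 * √(2 * m) := by
    have hpos : 0 < 2 * √(2 * m) - ρ := by linarith
    rw [div_lt_iff₀ hpos] at hR
    have h2 : 32 * (m : ℝ) ^ 2 / ((R : ℝ) + 1) ^ 2 ≤ 2 * √(2 * m) - ρ := by
      rw [div_le_iff₀ (by positivity)]
      have hR0 : (0 : ℝ) ≤ R := Nat.cast_nonneg R
      nlinarith [mul_nonneg hpos.le (by positivity : (0 : ℝ) ≤ (R : ℝ) ^ 2 + R + 1)]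
    linarith
  obtain ⟨K, hK, hev⟩ := exists_specBound_marking (m := m) (by omega) hρ
  refine ⟨K, hK, ?_⟩
  filter_upwards [hev, Filter.eventually_ge_atTop (2 * (R + 2))] with L hL hLR
  obtain ⟨σ, hσ, F, ⟨T⟩⟩ := hL
  have hspec := T.specBound_surgery (by positivity) (by omega) le_rfl hLR hσ hrad.le hR'
  exact ⟨schreierGraph T.surgery, schreierGraph_properties hm (Nat.mul_pos hK (by omega))
    (by omega) (fun w v hw hr h => T.surgery_eq_nil le_rfl w v hw hr h) hspec⟩

end RamanujanGraph

/-- Existence of Ramanujan graphs (Lubotzky–Phillips–Sarnak): for every constant `k`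
there are `d ≥ k`, constants `c₁, c₂ > 0` and infinitely many `n` carrying an
`(n,d,β)`-expander with `β ≤ 2/√d`, girth at least `c₁·log n/log d` and diameter at most
`c₂·log n/log d`. -/
theorem ramanujan_graphs_exist (k : ℕ) :
    ∃ d : ℕ, d ≥ k ∧ ∃ c₁ > (0 : ℝ), ∃ c₂ > (0 : ℝ),
      {n : ℕ | ∃ (G : SimpleGraph (Fin n)) (β : ℝ) (g : ℕ),
        IsExpander n d β G ∧ β ≤ 2 / Real.sqrt d ∧
        G.girth = (g : ℕ∞) ∧ c₁ * Real.log n / Real.log d ≤ (g : ℝ) ∧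
        ∀ u v : Fin n, (G.dist u v : ℝ) ≤ c₂ * Real.log n / Real.log d}.Infinite := by
  obtain ⟨K, hK, hev⟩ := RamanujanGraph.exists_graph (m := k + 8) (by omega)
  have hK' : (0 : ℝ) < K := by exact_mod_cast hK
  have hd : (0 : ℝ) < Real.log ((2 * (k + 8) : ℕ) : ℝ) :=
    Real.log_pos (by exact_mod_cast (by omega : 1 < 2 * (k + 8)))
  have h4 : (0 : ℝ) < Real.log 4 := Real.log_pos (by norm_num)
  refine ⟨2 * (k + 8), by omega, Real.log ((2 * (k + 8) : ℕ) : ℝ) / (K * Real.log 4),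
    by positivity, 3 * Real.log ((2 * (k + 8) : ℕ) : ℝ) / Real.log 4, by positivity, ?_⟩
  refine Set.infinite_of_forall_exists_gt fun b => ?_
  obtain ⟨L, ⟨G, hdeg, hspec, hgirth, hdist⟩, hLb⟩ :=
    (hev.and (Filter.eventually_ge_atTop (b + 1))).exists
  have hKL : L ≤ K * L := Nat.le_mul_of_pos_left L hK
  have hlog : Real.log ((4 ^ (K * L) : ℕ) : ℝ) = K * L * Real.log 4 := by
    push_cast
    rw [Real.log_pow]
    push_cast
    ring
  refine ⟨4 ^ (K * L), ⟨G, 2 / Real.sqrt ((2 * (k + 8) : ℕ) : ℝ), G.girth, ⟨hdeg, fun x hx => ?_⟩,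
    le_rfl, rfl, ?_, fun u v => ?_⟩, ?_⟩
  · refine (hspec x hx).trans (le_of_eq ?_)
    congr 1
    rw [div_mul_eq_mul_div, mul_div_assoc, Real.div_sqrt]
    push_cast
    ring
  · rw [hlog]
    have hlt : (L : ℝ) ≤ G.girth := by exact_mod_cast hgirth.le
    refine le_trans (le_of_eq ?_) hlt
    field_simp
  · rw [hlog]
    have h1 : (G.dist u v : ℝ) ≤ 3 * (K * L) := by
      have := hdist u v
      exact_mod_cast (by omega : G.dist u v ≤ 3 * (K * L))
    refine h1.trans (le_of_eq ?_)
    field_simp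
  · exact lt_of_lt_of_le (by omega : b < L)
      (hKL.trans (Nat.lt_pow_self (by norm_num : 1 < 4)).le)
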